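/- For every graph H with chromatic number χ(H) = r ≥ 3 and every γ > 0 there exist ε > 0 and n₀ ∈ ℕ such that for every graph G on n ≥ n₀ vertices and every proper edge coloring χ of G, if φ_χ^R(G,H) ≥ ex(n,H) − εn² then there exists a partition of the vertex set V(G) = V₁ ∪ … ∪ V_{r−1} into r−1 parts with Σ_{i=1}^{r−1} e(V_i) < γn². -/

import Mathlib

namespace RainbowDecomp

variable {V : Type*} {W : Type*}

/-- The number of edges of a graph. -/
noncomputable def eCount (G : SimpleGraph V) : ℕ := G.edgeSet.ncard

/-- `χ` is a proper edge coloring of `G`: any two distinct edges of `G` sharing a vertex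
receive distinct colors. -/
def ProperEdgeColoring (G : SimpleGraph V) (χ : Sym2 V → ℕ) : Prop :=
  ∀ ⦃e f : Sym2 V⦄, e ∈ G.edgeSet → f ∈ G.edgeSet → e ≠ f →
    (∃ v, v ∈ e ∧ v ∈ f) → χ e ≠ χ f

/-- `S` is the edge set of a (sub)copy of `H` in `G`. -/
def IsCopyEdgeSet (H : SimpleGraph W) (G : SimpleGraph V) (S : Set (Sym2 V)) : Prop :=
  ∃ f : W → V, Function.Injective f ∧ (∀ ⦃a b⦄, H.Adj a b → G.Adj (f a) (f b)) ∧
    S = Sym2.map f '' H.edgeSet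

/-- `G` contains a subgraph isomorphic to `H`. -/
def ContainsCopy (H : SimpleGraph W) (G : SimpleGraph V) : Prop :=
  ∃ f : W → V, Function.Injective f ∧ ∀ ⦃a b⦄, H.Adj a b → G.Adj (f a) (f b)

/-- `P` is a partition of the edge set of `G` into `t` (nonempty) parts. -/
def IsEdgePartition (G : SimpleGraph V) {t : ℕ} (P : Fin t → Set (Sym2 V)) : Prop :=
  (∀ i, P i ⊆ G.edgeSet) ∧ ∀ e ∈ G.edgeSet, ∃! i, e ∈ P i

/-- `P` is an `H`-decomposition of `G`: every part is a single edge or the edge set of a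
copy of `H`. -/
def IsHDecomp (G : SimpleGraph V) (H : SimpleGraph W) {t : ℕ}
    (P : Fin t → Set (Sym2 V)) : Prop :=
  IsEdgePartition G P ∧ ∀ i, (∃ e, P i = {e}) ∨ IsCopyEdgeSet H G (P i)

/-- `P` is a rainbow `H`-decomposition of `G` under `χ`: every part is a single edge or
the edge set of a rainbow copy of `H`. -/
def IsRainbowHDecomp (G : SimpleGraph V) (H : SimpleGraph W) (χ : Sym2 V → ℕ) {t : ℕ}
    (P : Fin t → Set (Sym2 V)) : Prop :=
  IsEdgePartition G P ∧
    ∀ i, (∃ e, P i = {e}) ∨ (IsCopyEdgeSet H G (P i) ∧ Set.InjOn χ (P i))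

/-- `φ(G,H)`, the minimum number of parts in an `H`-decomposition of `G`. -/
noncomputable def phi (G : SimpleGraph V) (H : SimpleGraph W) : ℕ :=
  sInf {t | ∃ P : Fin t → Set (Sym2 V), IsHDecomp G H P}

/-- `φ_χ^R(G,H)`, the minimum number of parts in a rainbow `H`-decomposition of `G`
under `χ`. -/
noncomputable def phiR (G : SimpleGraph V) (H : SimpleGraph W) (χ : Sym2 V → ℕ) : ℕ :=
  sInf {t | ∃ P : Fin t → Set (Sym2 V), IsRainbowHDecomp G H χ P}

/-- `N(G,H)`, the maximum number of pairwise edge-disjoint copies of `H` in `G`. -/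
noncomputable def Ncopies (G : SimpleGraph V) (H : SimpleGraph W) : ℕ :=
  sSup {k | ∃ C : Fin k → Set (Sym2 V), (∀ i, IsCopyEdgeSet H G (C i)) ∧
    ∀ i j, i ≠ j → Disjoint (C i) (C j)}

/-- `N_χ^R(G,H)`, the maximum number of pairwise edge-disjoint rainbow copies of `H`
in `G` under `χ`. -/
noncomputable def NcopiesR (G : SimpleGraph V) (H : SimpleGraph W) (χ : Sym2 V → ℕ) : ℕ :=
  sSup {k | ∃ C : Fin k → Set (Sym2 V),
    (∀ i, IsCopyEdgeSet H G (C i) ∧ Set.InjOn χ (C i)) ∧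
    ∀ i j, i ≠ j → Disjoint (C i) (C j)}

/-- `ex(n,H)`, the maximum number of edges of an `H`-free graph on `n` vertices. -/
noncomputable def exNum (n : ℕ) (H : SimpleGraph W) : ℕ :=
  sSup {m | ∃ G : SimpleGraph (Fin n), ¬ ContainsCopy H G ∧ eCount G = m}

/-- `φ^R(n,H)`, the maximum of `φ_χ^R(G,H)` over all graphs `G` on `n` vertices and all
proper edge colorings `χ` of `G`. -/
noncomputable def phiRmax (n : ℕ) (H : SimpleGraph W) : ℕ :=
  sSup {t | ∃ G : SimpleGraph (Fin n), ∃ χ : Sym2 (Fin n) → ℕ,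
    ProperEdgeColoring G χ ∧ phiR G H χ = t}

/-- `e(A)`, the number of edges of `G` with both endpoints in `A`. -/
noncomputable def eInside (G : SimpleGraph V) (A : Set V) : ℕ :=
  {e ∈ G.edgeSet | ∀ v ∈ e, v ∈ A}.ncard

/-- `e(A,B)`, the number of edges of `G` with one endpoint in `A` and one in `B`
(counted as ordered pairs). -/
noncomputable def eBetween (G : SimpleGraph V) (A B : Set V) : ℕ :=
  {p : V × V | p.1 ∈ A ∧ p.2 ∈ B ∧ G.Adj p.1 p.2}.ncard

/-- The edge density `d(A,B)` between `A` and `B`. -/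
noncomputable def density (G : SimpleGraph V) (A B : Set V) : ℝ :=
  (eBetween G A B : ℝ) / ((A.ncard : ℝ) * (B.ncard : ℝ))

/-- The pair `(A,B)` is `ε`-regular in `G`. -/
def IsRegularPair (G : SimpleGraph V) (ε : ℝ) (A B : Set V) : Prop :=
  ∀ A' ⊆ A, ∀ B' ⊆ B, ε * (A.ncard : ℝ) ≤ (A'.ncard : ℝ) →
    ε * (B.ncard : ℝ) ≤ (B'.ncard : ℝ) →
    |density G A' B' - density G A B| ≤ ε

/-- The edges of the (transversal) clique with vertices `g 0, …, g (r-1)`. -/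
def transversalEdges {r : ℕ} (g : Fin r → V) : Set (Sym2 V) :=
  {e | ∃ k l : Fin r, k ≠ l ∧ e = s(g k, g l)}

/-- The number of rainbow transversal copies of `K_r` (one vertex in each `Vs l`)
containing the edge `uv` with `u ∈ Vs i` and `v ∈ Vs j`. -/
noncomputable def rainbowCliqueCount {r : ℕ} (G : SimpleGraph V) (χ : Sym2 V → ℕ)
    (Vs : Fin r → Set V) (i j : Fin r) (u v : V) : ℕ :=
  {g : Fin r → V | (∀ l, g l ∈ Vs l) ∧ (∀ k l, k ≠ l → G.Adj (g k) (g l)) ∧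
    g i = u ∧ g j = v ∧ Set.InjOn χ (transversalEdges g)}.ncard

/-- The number of non-rainbow transversal copies of `K_r` (one vertex in each `Vs l`)
containing the edge `uv` with `u ∈ Vs i` and `v ∈ Vs j`. -/
noncomputable def nonRainbowCliqueCount {r : ℕ} (G : SimpleGraph V) (χ : Sym2 V → ℕ)
    (Vs : Fin r → Set V) (i j : Fin r) (u v : V) : ℕ :=
  {g : Fin r → V | (∀ l, g l ∈ Vs l) ∧ (∀ k l, k ≠ l → G.Adj (g k) (g l)) ∧
    g i = u ∧ g j = v ∧ ¬ Set.InjOn χ (transversalEdges g)}.ncard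

/-- The edge set of the clique on the vertex set `K`. -/
def cliqueEdges (K : Finset V) : Set (Sym2 V) :=
  {e | ∃ u ∈ K, ∃ v ∈ K, u ≠ v ∧ e = s(u, v)}

open scoped Classical in
/-- The probability of the event `A` under the random subgraph of `G` in which every
edge `e` is retained independently with probability `q e`. -/
noncomputable def edgeSubsetProb [Fintype V] (G : SimpleGraph V) (q : Sym2 V → ℝ)
    (A : Set (Finset (Sym2 V))) : ℝ :=
  ∑ E' ∈ (Set.toFinite G.edgeSet).toFinset.powerset,
    (∏ e ∈ E', q e) * (∏ e ∈ (Set.toFinite G.edgeSet).toFinset \ E', (1 - q e)) *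
      A.indicator (fun _ => (1 : ℝ)) E'

section Nibble

open Finset

variable {X ι : Type*} [DecidableEq X] [Fintype ι]

/-- The weighted degree of `x` counting only the hyperedges contained in `A`. -/
noncomputable def wDeg (E : ι → Finset X) (w : ι → ℝ) (A : Finset X) (x : X) : ℝ :=
  ∑ f, if x ∈ E f ∧ E f ⊆ A then w f else 0

/-- One step of the random greedy process with intensity `u`: every hyperedge `f` inside the set
`A` of surviving vertices is removed at rate `w f`, and every vertex is removed at the rate that
raises its total removal rate to at least one. -/
noncomputable def nibbleStep (E : ι → Finset X) (u : ℝ) (w : ι → ℝ) :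
    (Finset X → ℝ) →ₗ[ℝ] (Finset X → ℝ) where
  toFun φ A := φ A + u * ((∑ f, (if E f ⊆ A then w f else 0) * (φ (A \ E f) - φ A)) +
    ∑ x ∈ A, max (1 - wDeg E w A x) 0 * (φ (A \ {x}) - φ A))
  map_add' φ φ' := by
    ext A
    simp only [Pi.add_apply]
    have h1 : ∀ (B : Finset X), (φ B + φ' B) - (φ A + φ' A) = (φ B - φ A) + (φ' B - φ' A) := by
      intro B; ring
    simp only [h1, mul_add, sum_add_distrib]
    ring
  map_smul' c φ := by
    ext A
    simp only [Pi.smul_apply, smul_eq_mul, RingHom.id_apply]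
    have h1 : ∀ (B : Finset X) (r : ℝ), r * (c * φ B - c * φ A) = c * (r * (φ B - φ A)) := by
      intro B r; ring
    simp only [h1, ← mul_sum]
    ring

/-- The expectation functional after `i` steps of the process in which step `j` uses the
weights `W j`. -/
noncomputable def nibbleE [Fintype X] (E : ι → Finset X) (u : ℝ) (W : ℕ → ι → ℝ) :
    ℕ → (Finset X → ℝ) →ₗ[ℝ] ℝ
  | 0 => LinearMap.proj univ
  | i + 1 => (nibbleE E u W i).comp (nibbleStep E u (W i))

variable {E : ι → Finset X} {u : ℝ} {w : ι → ℝ}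

lemma nibbleStep_apply (φ : Finset X → ℝ) (A : Finset X) : nibbleStep E u w φ A =
    φ A + u * ((∑ f, (if E f ⊆ A then w f else 0) * (φ (A \ E f) - φ A)) +
    ∑ x ∈ A, max (1 - wDeg E w A x) 0 * (φ (A \ {x}) - φ A)) := rfl

lemma nibbleStep_const (c : ℝ) : nibbleStep E u w (fun _ => c) = fun _ => c := by
  ext A; simp [nibbleStep_apply]

lemma wDeg_nonneg (hw : ∀ f, 0 ≤ w f) (A : Finset X) (x : X) : 0 ≤ wDeg E w A x :=
  sum_nonneg fun f _ => by split_ifs <;> simp [hw]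

lemma nibbleStep_nonneg [Fintype X] (hw : ∀ f, 0 ≤ w f) (hu : 0 ≤ u)
    (hR : u * (∑ f, w f + Fintype.card X) ≤ 1) {φ : Finset X → ℝ} (hφ : ∀ A, 0 ≤ φ A)
    (A : Finset X) : 0 ≤ nibbleStep E u w φ A := by
  rw [nibbleStep_apply]
  have h1 : -(∑ f, w f) * φ A ≤ ∑ f, (if E f ⊆ A then w f else 0) * (φ (A \ E f) - φ A) := by
    rw [neg_mul, sum_mul, ← sum_neg_distrib]
    refine sum_le_sum fun f _ => ?_
    have := hφ A; have := hφ (A \ E f); have := hw f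
    split_ifs <;> nlinarith [mul_nonneg (hw f) (hφ A), mul_nonneg (hw f) (hφ (A \ E f))]
  have h2 : -(Fintype.card X : ℝ) * φ A ≤
      ∑ x ∈ A, max (1 - wDeg E w A x) 0 * (φ (A \ {x}) - φ A) := by
    have h3 : ∀ x ∈ A, -φ A ≤ max (1 - wDeg E w A x) 0 * (φ (A \ {x}) - φ A) := by
      intro x _
      have hd := wDeg_nonneg (E := E) hw A x
      have hm1 : max (1 - wDeg E w A x) 0 ≤ 1 := max_le (by linarith) zero_le_one
      have hm0 : 0 ≤ max (1 - wDeg E w A x) 0 := le_max_right _ _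
      nlinarith [mul_nonneg hm0 (hφ (A \ {x})), mul_nonneg (sub_nonneg.2 hm1) (hφ A)]
    have h4 := card_nsmul_le_sum A _ _ h3
    rw [nsmul_eq_mul] at h4
    have h5 : (#A : ℝ) ≤ Fintype.card X := by exact_mod_cast card_le_univ A
    nlinarith [hφ A]
  nlinarith [hφ A, mul_le_mul_of_nonneg_left (add_le_add h1 h2) hu,
    mul_le_mul_of_nonneg_right hR (hφ A)]

/-- The indicator of the event that `Z` survives. -/
noncomputable def survives (Z A : Finset X) : ℝ := if Z ⊆ A then 1 else 0

lemma survives_nonneg (Z A : Finset X) : 0 ≤ survives Z A := by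
  unfold survives; split_ifs <;> simp

lemma survives_le_one (Z A : Finset X) : survives Z A ≤ 1 := by
  unfold survives; split_ifs <;> simp

lemma sum_wDeg (Z A : Finset X) : ∑ x ∈ Z, wDeg E w A x =
    ∑ f, (if E f ⊆ A then w f else 0) * #(Z ∩ E f) := by
  unfold wDeg
  rw [sum_comm]
  refine sum_congr rfl fun f _ => ?_
  by_cases h : E f ⊆ A
  · simp only [h, and_true, if_true]
    rw [← sum_filter, sum_const, nsmul_eq_mul, mul_comm, filter_mem_eq_inter]
  · simp [h]

lemma nibbleStep_survives_of_subset {Z A : Finset X} (h : Z ⊆ A) :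
    nibbleStep E u w (survives Z) A =
      1 - u * ((∑ f, (if E f ⊆ A then w f else 0) * (if (Z ∩ E f).Nonempty then 1 else 0)) +
        ∑ x ∈ Z, max (1 - wDeg E w A x) 0) := by
  rw [nibbleStep_apply]
  have hA : survives Z A = 1 := by simp [survives, h]
  have h1 : ∀ B : Finset X, survives Z (A \ B) - survives Z A =
      -(if (Z ∩ B).Nonempty then 1 else 0) := by
    intro B
    rw [hA]
    have : Z ⊆ A \ B ↔ ¬ (Z ∩ B).Nonempty := by
      rw [subset_sdiff, not_nonempty_iff_eq_empty, disjoint_iff_inter_eq_empty]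
      simp [h]
    unfold survives
    by_cases hB : (Z ∩ B).Nonempty
    · simp [this, hB]
    · simp [this, hB]
  have h2 : ∑ x ∈ A, max (1 - wDeg E w A x) 0 * (survives Z (A \ {x}) - survives Z A) =
      - ∑ x ∈ Z, max (1 - wDeg E w A x) 0 := by
    rw [← sum_neg_distrib, ← sum_subset h]
    · refine sum_congr rfl fun x hx => ?_
      rw [h1, if_pos ⟨x, by simp [hx]⟩]; ring
    · intro x _ hx
      rw [h1, if_neg]
      · simp
      · rintro ⟨y, hy⟩
        rw [mem_inter, mem_singleton] at hy
        exact hx (hy.2 ▸ hy.1)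
  rw [h2]
  simp only [h1, mul_neg, sum_neg_distrib]
  rw [hA]
  ring

lemma nibbleStep_survives_of_not_subset {Z A : Finset X} (h : ¬ Z ⊆ A) :
    nibbleStep E u w (survives Z) A = 0 := by
  have h1 : ∀ B : Finset X, survives Z (A \ B) = 0 := fun B =>
    if_neg fun h' => h (h'.trans sdiff_subset)
  rw [nibbleStep_apply]
  simp [h1, show survives Z A = 0 from if_neg h]

lemma nibbleStep_survives_le (hw : ∀ f, 0 ≤ w f) (hu : 0 ≤ u) {δ : ℝ} (hδ0 : 0 ≤ δ)
    (hδ : ∀ x y, x ≠ y → ∑ f, (if x ∈ E f ∧ y ∈ E f then w f else 0) ≤ δ) (Z A : Finset X) :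
    nibbleStep E u w (survives Z) A ≤
      (1 - u * (#Z - (#Z : ℝ) ^ 2 * δ)) * survives Z A := by
  by_cases h : Z ⊆ A
  swap
  · rw [nibbleStep_survives_of_not_subset h, show survives Z A = 0 from if_neg h, mul_zero]
  rw [nibbleStep_survives_of_subset h, show survives Z A = 1 from if_pos h, mul_one]
  refine sub_le_sub_left (mul_le_mul_of_nonneg_left ?_ hu) _
  have h1 : (#Z : ℝ) ≤ ∑ x ∈ Z, wDeg E w A x + ∑ x ∈ Z, max (1 - wDeg E w A x) 0 := by
    rw [← sum_add_distrib, ← nsmul_one (#Z)]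
    refine card_nsmul_le_sum _ _ _ fun x _ => ?_
    linarith [le_max_left (1 - wDeg E w A x) 0]
  have h2 : ∑ f, (if E f ⊆ A then w f else 0) * (#(Z ∩ E f) : ℝ) ≤
      ∑ f, (if E f ⊆ A then w f else 0) * (if (Z ∩ E f).Nonempty then 1 else 0) +
      ∑ f, w f * #((Z ∩ E f).offDiag) := by
    rw [← sum_add_distrib]
    refine sum_le_sum fun f _ => ?_
    have h3 : (#(Z ∩ E f) : ℝ) ≤ (if (Z ∩ E f).Nonempty then 1 else 0) +
        #((Z ∩ E f).offDiag) := by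
      split_ifs with hn
      · have hp : 1 ≤ #(Z ∩ E f) := card_pos.2 hn
        have : #(Z ∩ E f) ≤ 1 + #((Z ∩ E f).offDiag) := by
          rw [offDiag_card]
          obtain ⟨m, hm⟩ := Nat.exists_eq_add_of_le' hp
          rw [hm, ← Nat.mul_sub_one, Nat.add_sub_cancel]; nlinarith
        exact_mod_cast this
      · rw [not_nonempty_iff_eq_empty.1 hn]; simp
    have h4 := hw f
    split_ifs at h3 ⊢ <;> nlinarith [(Nat.cast_nonneg (#((Z ∩ E f).offDiag)) : (0 : ℝ) ≤ _)]
  have h5 : ∑ f, w f * #((Z ∩ E f).offDiag) ≤ (#Z : ℝ) ^ 2 * δ := by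
    have h6 : ∀ f, w f * #((Z ∩ E f).offDiag) =
        ∑ p ∈ Z.offDiag, if p.1 ∈ E f ∧ p.2 ∈ E f then w f else 0 := by
      intro f
      rw [← sum_filter, sum_const, nsmul_eq_mul, mul_comm]
      congr 3
      ext p; simp only [mem_offDiag, mem_inter, mem_filter]; tauto
    simp only [h6]
    rw [sum_comm]
    refine (sum_le_card_nsmul _ _ δ fun p hp => hδ _ _ (mem_offDiag.1 hp).2.2).trans ?_
    rw [nsmul_eq_mul]
    refine mul_le_mul_of_nonneg_right ?_ hδ0
    rw [offDiag_card, sq]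
    exact_mod_cast Nat.sub_le _ _
  rw [sum_wDeg] at h1
  linarith

lemma le_nibbleStep_survives (hw : ∀ f, 0 ≤ w f) (hu : 0 ≤ u) (Z A : Finset X) :
    (1 - u * #Z) * survives Z A -
      u * (survives Z A * ∑ x ∈ Z, max (wDeg E w A x - 1) 0) ≤
      nibbleStep E u w (survives Z) A := by
  by_cases h : Z ⊆ A
  swap
  · rw [nibbleStep_survives_of_not_subset h, show survives Z A = 0 from if_neg h]; simp
  rw [nibbleStep_survives_of_subset h, show survives Z A = 1 from if_pos h, mul_one, one_mul]
  have h1 : (#Z : ℝ) + ∑ x ∈ Z, max (wDeg E w A x - 1) 0 =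
      ∑ x ∈ Z, wDeg E w A x + ∑ x ∈ Z, max (1 - wDeg E w A x) 0 := by
    rw [← sum_add_distrib, ← nsmul_one (#Z), ← sum_const, ← sum_add_distrib]
    refine sum_congr rfl fun x _ => ?_
    rcases le_total (wDeg E w A x) 1 with h | h
    · rw [max_eq_right (by linarith), max_eq_left (by linarith)]; ring
    · rw [max_eq_left (by linarith), max_eq_right (by linarith)]; ring
  have h2 : ∑ f, (if E f ⊆ A then w f else 0) * (if (Z ∩ E f).Nonempty then 1 else 0) ≤
      ∑ f, (if E f ⊆ A then w f else 0) * (#(Z ∩ E f) : ℝ) := by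
    refine sum_le_sum fun f _ => mul_le_mul_of_nonneg_left ?_ (by split_ifs <;> simp [hw])
    split_ifs with hn
    · exact_mod_cast card_pos.2 hn
    · positivity
  rw [sum_wDeg] at h1
  nlinarith

section Expectation

variable [Fintype X] {W : ℕ → ι → ℝ} {n : ℕ}

lemma nibbleE_const (c : ℝ) (i : ℕ) : nibbleE E u W i (fun _ => c) = c := by
  induction i with
  | zero => rfl
  | succ i ih => rw [nibbleE, LinearMap.comp_apply, nibbleStep_const, ih]

lemma nibbleE_nonneg (hW : ∀ j f, 0 ≤ W j f) (hu : 0 ≤ u)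
    (hR : ∀ j < n, u * (∑ f, W j f + Fintype.card X) ≤ 1) {i : ℕ} (hi : i ≤ n)
    {φ : Finset X → ℝ} (hφ : ∀ A, 0 ≤ φ A) : 0 ≤ nibbleE E u W i φ := by
  induction i generalizing φ with
  | zero => exact hφ _
  | succ i ih =>
    rw [nibbleE, LinearMap.comp_apply]
    exact ih (by omega) fun A => nibbleStep_nonneg (hW i) hu (hR i (by omega)) hφ A

lemma nibbleE_mono (hW : ∀ j f, 0 ≤ W j f) (hu : 0 ≤ u)
    (hR : ∀ j < n, u * (∑ f, W j f + Fintype.card X) ≤ 1) {i : ℕ} (hi : i ≤ n)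
    {φ φ' : Finset X → ℝ} (hφ : ∀ A, φ A ≤ φ' A) : nibbleE E u W i φ ≤ nibbleE E u W i φ' := by
  rw [← sub_nonneg, ← map_sub]
  exact nibbleE_nonneg hW hu hR hi fun A => by simpa using hφ A

lemma nibbleE_survives_le_one (hW : ∀ j f, 0 ≤ W j f) (hu : 0 ≤ u)
    (hR : ∀ j < n, u * (∑ f, W j f + Fintype.card X) ≤ 1) {i : ℕ} (hi : i ≤ n)
    (Z : Finset X) : nibbleE E u W i (survives Z) ≤ 1 :=
  (nibbleE_mono hW hu hR hi (survives_le_one Z)).trans_eq (nibbleE_const 1 i)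

lemma nibbleE_survives_le (hW : ∀ j f, 0 ≤ W j f) (hu : 0 ≤ u) (hu1 : u ≤ 1)
    (hR : ∀ j < n, u * (∑ f, W j f + Fintype.card X) ≤ 1) {δ : ℝ} (hδ0 : 0 ≤ δ)
    (hδ : ∀ j < n, ∀ x y, x ≠ y → ∑ f, (if x ∈ E f ∧ y ∈ E f then W j f else 0) ≤ δ)
    {i : ℕ} (hi : i ≤ n) (Z : Finset X) :
    nibbleE E u W i (survives Z) ≤ (1 - u) ^ (#Z * i) + i * u * ((#Z : ℝ) ^ 2 * δ) := by
  induction i with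
  | zero => simpa using nibbleE_survives_le_one hW hu hR hi Z
  | succ i ih =>
    have h1 : nibbleE E u W (i + 1) (survives Z) ≤
        (1 - u * (#Z - (#Z : ℝ) ^ 2 * δ)) * nibbleE E u W i (survives Z) := by
      rw [nibbleE, LinearMap.comp_apply, ← smul_eq_mul, ← map_smul]
      exact nibbleE_mono hW hu hR (i := i) (by omega) fun A =>
        nibbleStep_survives_le (hW i) hu hδ0 (hδ i (by omega)) Z A
    have h2 : 0 ≤ nibbleE E u W i (survives Z) :=
      nibbleE_nonneg hW hu hR (by omega) (survives_nonneg Z)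
    have h3 := nibbleE_survives_le_one (E := E) hW hu hR (i := i) (by omega) Z
    have h4 : 1 - u * #Z ≤ (1 - u) ^ #Z := by
      have := one_add_mul_le_pow (a := -u) (by linarith) #Z
      rw [← sub_eq_add_neg] at this; linarith
    have h5 := ih (by omega)
    have h6 : 0 ≤ (1 - u) ^ #Z := pow_nonneg (by linarith) _
    have h7 : (1 - u) ^ #Z ≤ 1 := pow_le_one₀ (by linarith) (by linarith)
    have h8 : 0 ≤ (#Z : ℝ) ^ 2 * δ := by positivity
    have h9 : 0 ≤ (i : ℝ) * u * ((#Z : ℝ) ^ 2 * δ) := by positivity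
    calc _ ≤ _ := h1
      _ = (1 - u * #Z) * nibbleE E u W i (survives Z) +
          u * ((#Z : ℝ) ^ 2 * δ) * nibbleE E u W i (survives Z) := by ring
      _ ≤ (1 - u) ^ #Z * nibbleE E u W i (survives Z) + u * ((#Z : ℝ) ^ 2 * δ) * 1 := by gcongr
      _ ≤ (1 - u) ^ #Z * ((1 - u) ^ (#Z * i) + i * u * ((#Z : ℝ) ^ 2 * δ)) +
          u * ((#Z : ℝ) ^ 2 * δ) * 1 := by gcongr
      _ ≤ (1 - u) ^ #Z * (1 - u) ^ (#Z * i) + 1 * (i * u * ((#Z : ℝ) ^ 2 * δ)) +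
          u * ((#Z : ℝ) ^ 2 * δ) * 1 := by rw [mul_add]; gcongr
      _ = _ := by push_cast; rw [mul_add, mul_one, pow_add]; ring

end Expectation

section Moments

lemma wDeg_eq (A : Finset X) (x : X) :
    wDeg E w A x = ∑ f, (if x ∈ E f then w f else 0) * survives (E f) A := by
  unfold wDeg survives
  refine sum_congr rfl fun f _ => ?_
  by_cases h1 : x ∈ E f <;> by_cases h2 : E f ⊆ A <;> simp [h1, h2]

lemma wDeg_eq_zero {A : Finset X} {x : X} (h : x ∉ A) : wDeg E w A x = 0 := by
  unfold wDeg
  exact sum_eq_zero fun f _ => if_neg fun h' => h (h'.2 h'.1)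

lemma survives_mul (Z Z' A : Finset X) :
    survives Z A * survives Z' A = survives (Z ∪ Z') A := by
  unfold survives
  by_cases h1 : Z ⊆ A <;> by_cases h2 : Z' ⊆ A <;> simp [union_subset_iff, h1, h2]

variable [Fintype X] {a : ι → ℝ} {θ : ℝ}

/-- The total squared deviation of the surviving degrees from their targets. -/
noncomputable def degVar (E : ι → Finset X) (w : ι → ℝ) (d : X → ℝ) (A : Finset X) : ℝ :=
  ∑ x, survives {x} A * (wDeg E w A x - d x) ^ 2

lemma degVar_nonneg (d : X → ℝ) (A : Finset X) : 0 ≤ degVar E w d A :=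
  sum_nonneg fun _ _ => mul_nonneg (survives_nonneg _ _) (sq_nonneg _)

lemma sum_mul_excess_le (hw : ∀ f, 0 ≤ w f) {d : X → ℝ} (hd0 : ∀ x, 0 ≤ d x) (hθ : 0 < θ)
    (hd : ∀ x, d x ≤ 1 - θ) {K : ℝ} (ha : ∀ f, a f ≤ K) (hK : 0 ≤ K) (A : Finset X) :
    ∑ f, a f * w f * (survives (E f) A * ∑ x ∈ E f, max (wDeg E w A x - 1) 0) ≤
      K * (1 + 1 / θ) * degVar E w d A := by
  have h1 : ∑ f, a f * w f * (survives (E f) A * ∑ x ∈ E f, max (wDeg E w A x - 1) 0) ≤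
      K * ∑ x, wDeg E w A x * max (wDeg E w A x - 1) 0 := by
    have h2 : ∑ x, wDeg E w A x * max (wDeg E w A x - 1) 0 =
        ∑ f, w f * (survives (E f) A * ∑ x ∈ E f, max (wDeg E w A x - 1) 0) := by
      calc _ = ∑ x, ∑ f, (if x ∈ E f then w f else 0) * survives (E f) A *
            max (wDeg E w A x - 1) 0 := by
            refine sum_congr rfl fun x _ => ?_
            nth_rewrite 1 [wDeg_eq]; rw [sum_mul]
        _ = _ := by
            rw [sum_comm]
            refine sum_congr rfl fun f _ => ?_
            rw [mul_sum, mul_sum, ← sum_subset (subset_univ (E f))]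
            · refine sum_congr rfl fun x hx => ?_
              rw [if_pos hx]; ring
            · intro x _ hx; simp [hx]
    rw [h2, mul_sum]
    refine sum_le_sum fun f _ => ?_
    rw [mul_assoc]
    refine mul_le_mul_of_nonneg_right (ha f) (mul_nonneg (hw f) (mul_nonneg (survives_nonneg _ _)
      (sum_nonneg fun x _ => le_max_right _ _)))
  refine h1.trans ?_
  rw [mul_assoc]
  refine mul_le_mul_of_nonneg_left ?_ hK
  unfold degVar
  rw [mul_sum]
  refine sum_le_sum fun x _ => ?_
  by_cases hx : x ∈ A
  swap
  · rw [wDeg_eq_zero hx]; simp [survives, hx]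
  rw [show survives {x} A = 1 by simp [survives, hx], one_mul]
  set D := wDeg E w A x
  rcases le_total D 1 with h | h
  · rw [max_eq_right (by linarith), mul_zero]; positivity
  · rw [max_eq_left (by linarith)]
    have h3 := hd x
    have h4 := hd0 x
    have h5 : D ≤ (1 + 1 / θ) * (D - d x) := by
      have : d x ≤ 1 / θ * (D - d x) := by
        rw [one_div, inv_mul_eq_div, le_div_iff₀ hθ]; nlinarith
      linarith
    calc D * (D - 1) ≤ ((1 + 1 / θ) * (D - d x)) * (D - d x) := by
          apply mul_le_mul h5 (by linarith) (by linarith) (by linarith)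
      _ = _ := by ring

end Moments

section SecondMoment

variable {ψ : ι → ℝ} {k : ℕ} {δ δ₁ p Λ : ℝ}

/-- The total weight of the hyperedges at `x`. -/
noncomputable def fracDeg (E : ι → Finset X) (ψ : ι → ℝ) (x : X) : ℝ :=
  ∑ f, if x ∈ E f then ψ f else 0

lemma fracDeg_nonneg (hψ : ∀ f, 0 ≤ ψ f) (x : X) : 0 ≤ fracDeg E ψ x :=
  sum_nonneg fun f _ => by split_ifs <;> simp [hψ]

lemma wDeg_sq_le (L : (Finset X → ℝ) →ₗ[ℝ] ℝ) (hk : ∀ f, #(E f) = k) (hk1 : 1 ≤ k)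
    (hψ : ∀ f, 0 ≤ ψ f) (hψ1 : ∀ x, fracDeg E ψ x ≤ 1) (hδ1 : 0 ≤ δ₁) (hδ0 : 0 ≤ δ)
    (hδ : ∀ x y, x ≠ y → ∑ f, (if x ∈ E f ∧ y ∈ E f then ψ f else 0) ≤ δ)
    (hL1 : ∀ Z, L (survives Z) ≤ 1)
    (hL : ∀ Z, #Z ≤ 2 * k → L (survives Z) ≤ p ^ #Z + δ₁) (hp : 0 < p)
    (hΛ : (p ^ (k - 1))⁻¹ ≤ Λ) (x : X) :
    L (fun A => wDeg E (fun f => (p ^ (k - 1))⁻¹ * ψ f) A x ^ 2) ≤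
      fracDeg E ψ x ^ 2 * p + Λ ^ 2 * (δ₁ + k * δ) := by
  set l := (p ^ (k - 1))⁻¹ with hl
  have hl0 : 0 < l := by positivity
  set c : ι → ℝ := fun f => if x ∈ E f then ψ f else 0 with hc
  have hc0 : ∀ f, 0 ≤ c f := fun f => by simp only [hc]; split_ifs <;> simp [hψ]
  have hd : fracDeg E ψ x = ∑ f, c f := rfl
  have h1 : (fun A => wDeg E (fun f => l * ψ f) A x ^ 2) =
      l ^ 2 • ∑ f, ∑ g, (c f * c g) • survives (E f ∪ E g) := by
    ext A
    have : wDeg E (fun f => l * ψ f) A x = l * ∑ f, c f * survives (E f) A := by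
      rw [wDeg_eq, mul_sum]
      refine sum_congr rfl fun f _ => ?_
      simp only [hc]; split_ifs <;> ring
    rw [this, mul_pow, sq (∑ f, _), sum_mul_sum]
    simp only [Pi.smul_apply, smul_eq_mul, Finset.sum_apply]
    congr 1
    refine sum_congr rfl fun f _ => sum_congr rfl fun g _ => ?_
    rw [← survives_mul]; ring
  have h2 : ∀ f g, c f * c g * L (survives (E f ∪ E g)) ≤ c f * c g * (p ^ (2 * k - 1) + δ₁) +
      c f * ∑ y ∈ (E f).erase x, (if x ∈ E g ∧ y ∈ E g then ψ g else 0) := by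
    intro f g
    have hs : ∀ y ∈ (E f).erase x, 0 ≤ (if x ∈ E g ∧ y ∈ E g then ψ g else 0) := by
      intro y _; split_ifs <;> simp [hψ]
    have h0 := sum_nonneg hs
    by_cases hf : x ∈ E f
    swap
    · simp [hc, hf]
    by_cases hg : x ∈ E g
    swap
    · simp [hc, hg]
    by_cases hy : ∃ y ∈ (E f).erase x, y ∈ E g
    · obtain ⟨y, hy, hyg⟩ := hy
      have h3 := single_le_sum hs hy
      rw [if_pos ⟨hg, hyg⟩] at h3
      have h4 : c g = ψ g := by simp [hc, hg]
      have h5 : c f * c g * L (survives (E f ∪ E g)) ≤ c f * c g * 1 :=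
        mul_le_mul_of_nonneg_left (hL1 _) (mul_nonneg (hc0 f) (hc0 g))
      have h6 : 0 ≤ c f * c g * (p ^ (2 * k - 1) + δ₁) :=
        mul_nonneg (mul_nonneg (hc0 f) (hc0 g)) (by positivity)
      have h7 := mul_le_mul_of_nonneg_left h3 (hc0 f)
      rw [h4] at h5 h6 ⊢
      linarith
    · have h3 : E f ∩ E g = {x} := by
        ext y
        simp only [mem_inter, mem_singleton]
        constructor
        · rintro ⟨h, h'⟩
          by_contra hne
          exact hy ⟨y, mem_erase.2 ⟨hne, h⟩, h'⟩
        · rintro rfl; exact ⟨hf, hg⟩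
      have h4 : #(E f ∪ E g) = 2 * k - 1 := by
        have := card_union_add_card_inter (E f) (E g)
        rw [h3, card_singleton, hk, hk] at this; omega
      have h5 := hL (E f ∪ E g) (by omega)
      rw [h4] at h5
      have := mul_le_mul_of_nonneg_left h5 (mul_nonneg (hc0 f) (hc0 g))
      have := mul_nonneg (hc0 f) h0
      linarith
  have h3 : ∑ f, ∑ g, c f * c g * L (survives (E f ∪ E g)) ≤
      fracDeg E ψ x ^ 2 * p ^ (2 * k - 1) + (δ₁ + k * δ) := by
    have hd0 := fracDeg_nonneg (E := E) hψ x
    have hd1 := hψ1 x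
    calc _ ≤ ∑ f, ∑ g, (c f * c g * (p ^ (2 * k - 1) + δ₁) +
          c f * ∑ y ∈ (E f).erase x, (if x ∈ E g ∧ y ∈ E g then ψ g else 0)) :=
          sum_le_sum fun f _ => sum_le_sum fun g _ => h2 f g
      _ = fracDeg E ψ x ^ 2 * (p ^ (2 * k - 1) + δ₁) + ∑ f, c f *
          ∑ y ∈ (E f).erase x, ∑ g, (if x ∈ E g ∧ y ∈ E g then ψ g else 0) := by
          simp only [sum_add_distrib, hd, sq, sum_mul]
          congr 1
          · refine sum_congr rfl fun f _ => ?_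
            rw [mul_sum, sum_mul]
          · refine sum_congr rfl fun f _ => ?_
            rw [← mul_sum, sum_comm]
      _ ≤ fracDeg E ψ x ^ 2 * (p ^ (2 * k - 1) + δ₁) + ∑ f, c f * (k * δ) := by
          gcongr with f _
          · exact hc0 f
          refine (sum_le_card_nsmul _ _ δ fun y hy => hδ _ _ (ne_of_mem_erase hy).symm).trans ?_
          rw [nsmul_eq_mul]
          gcongr
          exact (card_le_card (erase_subset _ _)).trans (hk f).le
      _ = fracDeg E ψ x ^ 2 * (p ^ (2 * k - 1) + δ₁) + fracDeg E ψ x * (k * δ) := by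
          rw [← sum_mul, hd]
      _ ≤ fracDeg E ψ x ^ 2 * p ^ (2 * k - 1) + (1 * δ₁ + 1 * (k * δ)) := by
          rw [mul_add, add_assoc]
          gcongr
          exact pow_le_one₀ hd0 hd1
      _ = _ := by ring
  rw [h1, map_smul, map_sum]
  simp only [map_sum, map_smul, smul_eq_mul]
  have h4 : l ^ 2 * p ^ (2 * k - 1) = p := by
    obtain ⟨j, rfl⟩ := Nat.exists_eq_add_of_le' hk1
    rw [hl, show 2 * (j + 1) - 1 = (j + 1 - 1) * 2 + 1 by omega, pow_succ p, pow_mul, inv_pow,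
      ← mul_assoc, inv_mul_cancel₀ (by positivity), one_mul]
  calc _ ≤ l ^ 2 * (fracDeg E ψ x ^ 2 * p ^ (2 * k - 1) + (δ₁ + k * δ)) := by gcongr
    _ = fracDeg E ψ x ^ 2 * (l ^ 2 * p ^ (2 * k - 1)) + l ^ 2 * (δ₁ + k * δ) := by ring
    _ ≤ _ := by rw [h4]; gcongr

lemma degVar_le [Fintype X] (L : (Finset X → ℝ) →ₗ[ℝ] ℝ) (hk : ∀ f, #(E f) = k) (hk1 : 1 ≤ k)
    (hψ : ∀ f, 0 ≤ ψ f) (hψ1 : ∀ x, fracDeg E ψ x ≤ 1) (hδ1 : 0 ≤ δ₁) (hδ0 : 0 ≤ δ)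
    (hδ : ∀ x y, x ≠ y → ∑ f, (if x ∈ E f ∧ y ∈ E f then ψ f else 0) ≤ δ)
    (hL1 : ∀ Z, L (survives Z) ≤ 1)
    (hL : ∀ Z, #Z ≤ 2 * k → L (survives Z) ≤ p ^ #Z + δ₁) (hp : 0 < p)
    (hΛ : (p ^ (k - 1))⁻¹ ≤ Λ) :
    L (degVar E (fun f => (p ^ (k - 1))⁻¹ * ψ f) (fracDeg E ψ)) ≤
      2 * (∑ x, fracDeg E ψ x ^ 2) * p -
      2 * ∑ f, (∑ x ∈ E f, fracDeg E ψ x) * ((p ^ (k - 1))⁻¹ * ψ f) * L (survives (E f)) +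
      Fintype.card X * (δ₁ + Λ ^ 2 * (δ₁ + k * δ)) := by
  set l := (p ^ (k - 1))⁻¹ with hl
  set d := fracDeg E ψ with hd
  set w : ι → ℝ := fun f => l * ψ f with hw
  have h1 : degVar E w d = (∑ x, (fun A => wDeg E w A x ^ 2)) -
      (2 : ℝ) • (∑ f, ((∑ x ∈ E f, d x) * w f) • survives (E f)) +
      ∑ x, (d x ^ 2) • survives {x} := by
    ext A
    have h2 : ∑ f, (∑ x ∈ E f, d x) * w f * survives (E f) A = ∑ x, d x * wDeg E w A x := by
      simp only [wDeg_eq, mul_sum, sum_mul]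
      rw [sum_comm]
      refine sum_congr rfl fun f _ => ?_
      rw [← sum_subset (subset_univ (E f))]
      · refine sum_congr rfl fun x hx => ?_
        rw [if_pos hx]; ring
      · intro x _ hx; simp [hx]
    simp only [Pi.add_apply, Pi.sub_apply, Pi.smul_apply, Finset.sum_apply, smul_eq_mul]
    rw [h2, mul_sum, ← sum_sub_distrib, ← sum_add_distrib]
    refine sum_congr rfl fun x _ => ?_
    by_cases hx : x ∈ A
    · rw [show survives {x} A = 1 by simp [survives, hx]]; ring
    · rw [wDeg_eq_zero hx, show survives {x} A = 0 by simp [survives, hx]]; ring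
  rw [h1, map_add, map_sub, map_smul, map_sum, map_sum, map_sum]
  simp only [map_smul, smul_eq_mul]
  have h2 : ∑ x, L (fun A => wDeg E w A x ^ 2) ≤ ∑ x, (d x ^ 2 * p + Λ ^ 2 * (δ₁ + k * δ)) :=
    sum_le_sum fun x _ => wDeg_sq_le L hk hk1 hψ hψ1 hδ1 hδ0 hδ hL1 hL hp hΛ x
  have h3 : ∑ x, d x ^ 2 * L (survives {x}) ≤ ∑ x, (d x ^ 2 * p + δ₁) := by
    refine sum_le_sum fun x _ => ?_
    have h4 := hL {x} (by rw [card_singleton]; omega)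
    rw [card_singleton, pow_one] at h4
    have h5 : d x ^ 2 ≤ 1 := pow_le_one₀ (fracDeg_nonneg hψ x) (hψ1 x)
    nlinarith [mul_le_mul_of_nonneg_left h4 (sq_nonneg (d x))]
  rw [sum_add_distrib, sum_const, nsmul_eq_mul, card_univ, ← sum_mul] at h2 h3
  linarith

end SecondMoment

section Dynamics

lemma one_sub_pow_le {u : ℝ} (hu : 0 ≤ u) (hu1 : u ≤ 1) (k : ℕ) :
    (1 - u) ^ k ≤ 1 - k * u + k ^ 2 * u ^ 2 := by
  have h1 : (1 - u) ^ k * (1 + k * u) ≤ 1 := by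
    calc _ ≤ (1 - u) ^ k * (1 + u) ^ k :=
          mul_le_mul_of_nonneg_left (one_add_mul_le_pow (by linarith) k)
            (pow_nonneg (by linarith) _)
      _ = (1 - u ^ 2) ^ k := by rw [← mul_pow]; ring
      _ ≤ 1 := pow_le_one₀ (by nlinarith) (by nlinarith)
  have h2 : 0 ≤ (k : ℝ) * u := by positivity
  have h3 : 1 ≤ (1 - k * u + k ^ 2 * u ^ 2) * (1 + k * u) := by
    have : (1 - k * u + k ^ 2 * u ^ 2) * (1 + k * u) = 1 + (k * u) ^ 3 := by ring
    rw [this]; linarith [pow_nonneg h2 3]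
  exact le_of_mul_le_mul_right (h1.trans h3) (by linarith)

lemma sum_survives_step [Fintype X] {L : (Finset X → ℝ) →ₗ[ℝ] ℝ}
    (hL0 : ∀ φ φ' : Finset X → ℝ, (∀ A, φ A ≤ φ' A) → L φ ≤ L φ') {k : ℕ}
    (hk : ∀ f, #(E f) = k) (hw : ∀ f, 0 ≤ w f) (hu : 0 ≤ u) {d : X → ℝ} (hd0 : ∀ x, 0 ≤ d x)
    {θ : ℝ} (hθ : 0 < θ) (hd : ∀ x, d x ≤ 1 - θ) {K : ℝ} {a : ι → ℝ} (ha0 : ∀ f, 0 ≤ a f)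
    (ha : ∀ f, a f ≤ K) (hK : 0 ≤ K) :
    (1 - k * u) * ∑ f, a f * w f * L (survives (E f)) -
        u * (K * (1 + 1 / θ) * L (degVar E w d)) ≤
      ∑ f, a f * w f * L (nibbleStep E u w (survives (E f))) := by
  have h1 : ∀ f, (1 - k * u) * L (survives (E f)) -
      u * L (fun A => survives (E f) A * ∑ x ∈ E f, max (wDeg E w A x - 1) 0) ≤
      L (nibbleStep E u w (survives (E f))) := by
    intro f
    rw [← smul_eq_mul (1 - (k : ℝ) * u), ← smul_eq_mul u, ← map_smul, ← map_smul, ← map_sub]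
    refine hL0 _ _ fun A => ?_
    have := le_nibbleStep_survives (E := E) hw hu (E f) A
    rw [hk] at this
    simpa [mul_comm u (k : ℝ)] using this
  have h2 : ∑ f, a f * w f * L (fun A => survives (E f) A * ∑ x ∈ E f,
      max (wDeg E w A x - 1) 0) ≤ K * (1 + 1 / θ) * L (degVar E w d) := by
    have h3 : ∑ f, a f * w f * L (fun A => survives (E f) A * ∑ x ∈ E f,
        max (wDeg E w A x - 1) 0) = L (∑ f, (a f * w f) • (fun A => survives (E f) A *
          ∑ x ∈ E f, max (wDeg E w A x - 1) 0)) := by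
      rw [map_sum]; simp only [map_smul, smul_eq_mul]
    rw [h3, ← smul_eq_mul, ← map_smul]
    refine hL0 _ _ fun A => ?_
    simpa using sum_mul_excess_le (a := a) hw hd0 hθ hd ha hK A
  have h3 := sum_le_sum fun f (_ : f ∈ univ) =>
    mul_le_mul_of_nonneg_left (h1 f) (mul_nonneg (ha0 f) (hw f))
  refine le_trans ?_ h3
  simp only [mul_sub, sum_sub_distrib]
  have h4 := mul_le_mul_of_nonneg_left h2 hu
  have h5 : ∑ f, a f * w f * ((1 - k * u) * L (survives (E f))) =
      (1 - k * u) * ∑ f, a f * w f * L (survives (E f)) := by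
    rw [mul_sum]; exact sum_congr rfl fun f _ => by ring
  have h6 : ∑ f, a f * w f * (u * L (fun A => survives (E f) A * ∑ x ∈ E f,
      max (wDeg E w A x - 1) 0)) = u * ∑ f, a f * w f * L (fun A => survives (E f) A *
        ∑ x ∈ E f, max (wDeg E w A x - 1) 0) := by
    rw [mul_sum]; exact sum_congr rfl fun f _ => by ring
  rw [h5, h6]
  linarith

lemma recursion_bounds {n : ℕ} {Q L M : ℕ → ℝ} {S N q u C δ T : ℝ} (hu : 0 ≤ u) (hC : 0 ≤ C)
    (hδ : 0 ≤ δ) (hN : 0 ≤ N) (hT : n * u ≤ T) (hq0 : 0 ≤ q) (hq : q = 1 - u)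
    (hQ0 : ∀ i < n, 0 ≤ Q i) (hQ : ∀ i < n, Q i ≤ 2 * S * q ^ i - 2 * L i + N * δ)
    (hL0 : L 0 = S) (hL : ∀ i < n, q * L i - C * u * Q i - C * N * u ^ 2 ≤ L (i + 1))
    (hM : ∀ i < n, q * M i - C * u * Q i - C * N * u ^ 2 ≤ M (i + 1)) :
    M 0 * (1 - q ^ n) - T ^ 2 *
      (2 * C * (Real.exp (2 * C * T) * (T + 1) * (δ + C * u)) + C * u) * N ≤
      u * ∑ i ∈ range n, M i := by
  have hT0 : 0 ≤ T := le_trans (by positivity) hT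
  set Γ := Real.exp (2 * C * T) * (T + 1) * (δ + C * u) with hΓ
  have hG : ∀ i, i < n → S * q ^ i - L i + δ * N / 2 ≤
      (1 + 2 * C * u) ^ i * ((1 + i * u) * (δ + C * u) * N) := by
    intro i
    induction i with
    | zero =>
      intro _
      rw [hL0]; simp only [pow_zero, mul_one, Nat.cast_zero, zero_mul, add_zero, one_mul]
      nlinarith [mul_nonneg (mul_nonneg hC hu) hN, mul_nonneg hδ hN]
    | succ i ih =>
      intro hi
      have h1 := ih (by omega)
      have h2 := hL i (by omega)
      have h3 := hQ i (by omega)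
      have h4 := hQ0 i (by omega)
      set G := S * q ^ i - L i + δ * N / 2 with hGd
      have hG0 : 0 ≤ G := by rw [hGd]; linarith
      have h5 : S * q ^ (i + 1) - L (i + 1) + δ * N / 2 ≤
          (1 + 2 * C * u) * G + u * ((δ + C * u) * N) := by
        have h6 : C * u * Q i ≤ C * u * (2 * G) := by gcongr; rw [hGd]; linarith
        have h7 : S * q ^ (i + 1) - q * L i + δ * N / 2 = q * G + u * (δ * N / 2) := by
          rw [hGd, hq]; ring
        have h8 : q * G ≤ G := by rw [hq]; nlinarith
        have h9 : 0 ≤ u * (δ * N) := by positivity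
        nlinarith
      have h6 : (1 : ℝ) ≤ (1 + 2 * C * u) ^ (i + 1) :=
        one_le_pow₀ (by nlinarith [mul_nonneg hC hu])
      have h7 : 0 ≤ u * ((δ + C * u) * N) := by positivity
      calc _ ≤ _ := h5
        _ ≤ (1 + 2 * C * u) * ((1 + 2 * C * u) ^ i * ((1 + i * u) * (δ + C * u) * N)) +
            (1 + 2 * C * u) ^ (i + 1) * (u * ((δ + C * u) * N)) := by
            exact add_le_add (mul_le_mul_of_nonneg_left h1 (by positivity))
              (le_mul_of_one_le_left h7 h6)
        _ = _ := by push_cast; ring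
  have hQΓ : ∀ i < n, Q i ≤ 2 * Γ * N := by
    intro i hi
    have h1 := hG i hi
    have h2 := hQ i hi
    have hiu : (i : ℝ) * u ≤ T := le_trans (by gcongr) hT
    have h3 : (1 + 2 * C * u) ^ i ≤ Real.exp (2 * C * T) := by
      calc _ ≤ Real.exp (2 * C * u) ^ i := by
            gcongr; linarith [Real.add_one_le_exp (2 * C * u)]
        _ = Real.exp (2 * C * (i * u)) := by rw [← Real.exp_nat_mul]; ring_nf
        _ ≤ _ := by gcongr
    have h4 : (1 + 2 * C * u) ^ i * ((1 + i * u) * (δ + C * u) * N) ≤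
        Real.exp (2 * C * T) * ((T + 1) * (δ + C * u) * N) := by
      gcongr ?_ * (?_ * _ * _); linarith
    have h5 : Γ * N = Real.exp (2 * C * T) * ((T + 1) * (δ + C * u) * N) := by rw [hΓ]; ring
    linarith
  have hΓ0 : 0 ≤ Γ := by positivity
  set B := (2 * C * Γ + C * u) * N with hB
  have hB0 : 0 ≤ B := by positivity
  have hMi : ∀ i, i ≤ n → q ^ i * M 0 - i * u * B ≤ M i := by
    intro i
    induction i with
    | zero => intro _; simp
    | succ i ih =>
      intro hi
      have h1 := ih (by omega)
      have h2 := hM i (by omega)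
      have h3 := mul_le_mul_of_nonneg_left (hQΓ i (by omega)) (mul_nonneg hC hu)
      have h4 : q * (q ^ i * M 0 - i * u * B) ≤ q * M i := by gcongr
      have h5 : q * (i * u * B) ≤ i * u * B := by
        rw [hq]; nlinarith [mul_nonneg (mul_nonneg (Nat.cast_nonneg i : (0 : ℝ) ≤ i) hu) hB0]
      have h6 : C * u * (2 * Γ * N) + C * N * u ^ 2 = u * B := by rw [hB]; ring
      push_cast
      rw [pow_succ]
      nlinarith
  have hsum : ∑ i ∈ range n, (q ^ i * M 0 - T * B) ≤ ∑ i ∈ range n, M i := by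
    refine sum_le_sum fun i hi => ?_
    have h1 := hMi i (mem_range.1 hi).le
    have hiu : (i : ℝ) * u ≤ T := le_trans (by have := (mem_range.1 hi).le; gcongr) hT
    nlinarith
  have hgeo : u * ∑ i ∈ range n, q ^ i = 1 - q ^ n := by
    have := mul_neg_geom_sum q n
    rw [← this, hq]; ring
  rw [sum_sub_distrib, ← sum_mul, sum_const, card_range, nsmul_eq_mul] at hsum
  have h1 := mul_le_mul_of_nonneg_left hsum hu
  have h2 : u * n * (T * B) ≤ T * (T * B) := by rw [mul_comm u]; gcongr
  calc _ = M 0 * (u * ∑ i ∈ range n, q ^ i) - T * (T * B) := by rw [hgeo, hB]; ring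
    _ ≤ M 0 * (u * ∑ i ∈ range n, q ^ i) - u * n * (T * B) := by linarith
    _ = u * ((∑ i ∈ range n, q ^ i) * M 0 - n * (T * B)) := by ring
    _ ≤ _ := h1

end Dynamics

section Matching

open scoped Classical in
/-- The largest number of pairwise disjoint hyperedges inside `A`. -/
noncomputable def matchNum (E : ι → Finset X) (A : Finset X) : ℕ :=
  (univ.filter fun M : Finset ι => (M : Set ι).PairwiseDisjoint E ∧ ∀ f ∈ M, E f ⊆ A).sup card

lemma exists_matchNum (A : Finset X) : ∃ M : Finset ι, (M : Set ι).PairwiseDisjoint E ∧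
    (∀ f ∈ M, E f ⊆ A) ∧ #M = matchNum E A := by
  classical
  have h : (univ.filter fun M : Finset ι => (M : Set ι).PairwiseDisjoint E ∧
      ∀ f ∈ M, E f ⊆ A).Nonempty := ⟨∅, by simp⟩
  obtain ⟨M, hM, h1⟩ := exists_mem_eq_sup _ h card
  rw [mem_filter] at hM
  exact ⟨M, hM.2.1, hM.2.2, h1.symm⟩

lemma card_le_matchNum {A : Finset X} {M : Finset ι} (h : (M : Set ι).PairwiseDisjoint E)
    (h' : ∀ f ∈ M, E f ⊆ A) : #M ≤ matchNum E A := by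
  classical
  exact le_sup (f := card) (mem_filter.2 ⟨mem_univ _, h, h'⟩)

lemma matchNum_mono {A B : Finset X} (h : A ⊆ B) : matchNum E A ≤ matchNum E B := by
  obtain ⟨M, h1, h2, h3⟩ := exists_matchNum (E := E) A
  exact h3 ▸ card_le_matchNum h1 fun f hf => (h2 f hf).trans h

lemma matchNum_sdiff_add_one_le {A : Finset X} {f : ι} (hf : E f ⊆ A) (hne : (E f).Nonempty) :
    matchNum E (A \ E f) + 1 ≤ matchNum E A := by
  classical
  obtain ⟨M, h1, h2, h3⟩ := exists_matchNum (E := E) (A \ E f)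
  have hd : ∀ g ∈ M, Disjoint (E f) (E g) := fun g hg =>
    (disjoint_of_subset_left (h2 g hg) sdiff_disjoint).symm
  have hfM : f ∉ M := fun h => by
    have := hd f h
    rw [disjoint_self_iff_empty] at this
    exact hne.ne_empty this
  rw [← h3, ← card_insert_of_notMem hfM]
  refine card_le_matchNum ?_ ?_
  · rw [coe_insert]
    exact h1.insert fun g hg _ => hd g hg
  · intro g hg
    rcases mem_insert.1 hg with rfl | hg
    · exact hf
    · exact (h2 g hg).trans sdiff_subset

lemma nibbleStep_matchNum_le (hne : ∀ f, (E f).Nonempty) (hw : ∀ f, 0 ≤ w f) (hu : 0 ≤ u)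
    (A : Finset X) : nibbleStep E u w (fun A => (matchNum E A : ℝ)) A ≤
      matchNum E A - u * ∑ f, w f * survives (E f) A := by
  rw [nibbleStep_apply]
  have h1 : ∑ f, (if E f ⊆ A then w f else 0) * ((matchNum E (A \ E f) : ℝ) - matchNum E A) ≤
      - ∑ f, w f * survives (E f) A := by
    rw [← sum_neg_distrib]
    refine sum_le_sum fun f _ => ?_
    unfold survives
    split_ifs with h
    · have : (matchNum E (A \ E f) : ℝ) + 1 ≤ matchNum E A := by
        exact_mod_cast matchNum_sdiff_add_one_le h (hne f)
      nlinarith [hw f]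
    · simp
  have h2 : ∑ x ∈ A, max (1 - wDeg E w A x) 0 * ((matchNum E (A \ {x}) : ℝ) - matchNum E A) ≤
      0 := by
    refine sum_nonpos fun x _ => mul_nonpos_of_nonneg_of_nonpos (le_max_right _ _) ?_
    have : (matchNum E (A \ {x}) : ℝ) ≤ matchNum E A := by
      exact_mod_cast matchNum_mono sdiff_subset
    linarith
  nlinarith

end Matching

section Assembly

variable [Fintype X] {ψ : ι → ℝ} {k n : ℕ} {δ θ Λ T : ℝ}

/-- The weights used in the `i`-th step of the process. -/
noncomputable def stepWeight {ι : Type*} (k : ℕ) (u : ℝ) (ψ : ι → ℝ) (i : ℕ) (f : ι) : ℝ :=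
  (((1 - u) ^ i) ^ (k - 1))⁻¹ * ψ f

lemma stepWeight_nonneg {ι : Type*} {ψ : ι → ℝ} (hψ : ∀ f, 0 ≤ ψ f) (hu1 : u ≤ 1) (i : ℕ) (f : ι) :
    0 ≤ stepWeight k u ψ i f :=
  mul_nonneg (inv_nonneg.2 (pow_nonneg (pow_nonneg (by linarith) _) _)) (hψ f)

lemma stepWeight_le {ι : Type*} {ψ : ι → ℝ} (hψ : ∀ f, 0 ≤ ψ f) {i : ℕ}
    (hΛ : (((1 - u) ^ i) ^ (k - 1))⁻¹ ≤ Λ) (f : ι) : stepWeight k u ψ i f ≤ Λ * ψ f :=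
  mul_le_mul_of_nonneg_right hΛ (hψ f)

lemma stepWeight_succ {ι : Type*} {ψ : ι → ℝ} (i : ℕ) (f : ι) :
    stepWeight k u ψ (i + 1) f = ((1 - u) ^ (k - 1))⁻¹ * stepWeight k u ψ i f := by
  unfold stepWeight
  rw [pow_succ, mul_pow, mul_inv]; ring

lemma sum_weight_le (hk : ∀ f, #(E f) = k) (hk1 : 1 ≤ k) (hψ : ∀ f, 0 ≤ ψ f)
    (hd : ∀ x, fracDeg E ψ x ≤ 1) : ∑ f, ψ f ≤ Fintype.card X := by
  have h1 : ∑ x, fracDeg E ψ x = ∑ f, (k : ℝ) * ψ f := by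
    unfold fracDeg
    rw [sum_comm]
    refine sum_congr rfl fun f _ => ?_
    rw [← sum_filter, sum_const, nsmul_eq_mul, filter_mem_eq_inter, univ_inter, hk]
  have h2 : ∑ f, ψ f ≤ ∑ f, (k : ℝ) * ψ f := sum_le_sum fun f _ =>
    le_mul_of_one_le_left (hψ f) (by exact_mod_cast hk1)
  have h3 : ∑ x, fracDeg E ψ x ≤ ∑ x : X, (1 : ℝ) := sum_le_sum fun x _ => hd x
  simp only [sum_const, nsmul_eq_mul, mul_one, card_univ] at h3
  linarith

lemma sum_survives_succ (hk : ∀ f, #(E f) = k) (hk1 : 1 ≤ k) (hψ : ∀ f, 0 ≤ ψ f) (hθ : 0 < θ)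
    (hd : ∀ x, fracDeg E ψ x ≤ 1 - θ) (hu : 0 ≤ u) (hu2 : u ≤ 1 / 2)
    (hR : ∀ j < n, u * (∑ f, stepWeight k u ψ j f + Fintype.card X) ≤ 1)
    (hΛ : ∀ i ≤ n, (((1 - u) ^ i) ^ (k - 1))⁻¹ ≤ Λ) (hΛ1 : 1 ≤ Λ)
    {a : ι → ℝ} (ha0 : ∀ f, 0 ≤ a f) (ha : ∀ f, a f ≤ k) {i : ℕ} (hi : i < n) :
    (1 - u) * ∑ f, a f * stepWeight k u ψ i f *
        nibbleE E u (stepWeight k u ψ) i (survives (E f)) -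
      (2 ^ k * k ^ 3 * Λ * (1 + 1 / θ)) * u * nibbleE E u (stepWeight k u ψ) i
        (degVar E (stepWeight k u ψ i) (fracDeg E ψ)) -
      (2 ^ k * k ^ 3 * Λ * (1 + 1 / θ)) * Fintype.card X * u ^ 2 ≤
    ∑ f, a f * stepWeight k u ψ (i + 1) f *
        nibbleE E u (stepWeight k u ψ) (i + 1) (survives (E f)) := by
  set W := stepWeight k u ψ with hW
  have hW0 : ∀ j f, 0 ≤ W j f := stepWeight_nonneg hψ (by linarith)
  set q := 1 - u with hq
  have hq0 : 1 / 2 ≤ q := by linarith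
  set ρ := (q ^ (k - 1))⁻¹ with hρ
  have hρ0 : 0 < ρ := by positivity
  have hρ2 : ρ ≤ 2 ^ k := by
    calc ρ ≤ ((1 / 2 : ℝ) ^ (k - 1))⁻¹ := by rw [hρ]; gcongr
      _ = 2 ^ (k - 1) := by rw [← inv_pow]; norm_num
      _ ≤ 2 ^ k := by gcongr <;> simp
  set Q := nibbleE E u W i (degVar E (W i) (fracDeg E ψ)) with hQ
  have hQ0 : 0 ≤ Q := nibbleE_nonneg hW0 hu hR hi.le (degVar_nonneg _)
  set L := ∑ f, a f * W i f * nibbleE E u W i (survives (E f)) with hL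
  set N : ℝ := (Fintype.card X : ℝ) with hN
  have h1 := sum_survives_step (L := nibbleE E u W i) (w := W i) (d := fracDeg E ψ) (a := a)
    (fun φ φ' h => nibbleE_mono hW0 hu hR hi.le h) hk (hW0 i) hu (fracDeg_nonneg hψ) hθ hd ha0 ha
    (by positivity)
  rw [← hL, ← hQ] at h1
  have hs : ∑ f, a f * W (i + 1) f * nibbleE E u W (i + 1) (survives (E f)) =
      ρ * ∑ f, a f * W i f * nibbleE E u W i (nibbleStep E u (W i) (survives (E f))) := by
    rw [mul_sum]
    refine sum_congr rfl fun f _ => ?_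
    rw [hW, stepWeight_succ, ← hW, ← hq, ← hρ, nibbleE, LinearMap.comp_apply]; ring
  rw [hs]
  have hL0 : 0 ≤ L := sum_nonneg fun f _ => mul_nonneg (mul_nonneg (ha0 f) (hW0 i f))
    (nibbleE_nonneg hW0 hu hR hi.le (survives_nonneg _))
  have hk1' : (1 : ℝ) ≤ k := by exact_mod_cast hk1
  have hLN : L ≤ k * Λ * N := by
    calc L ≤ ∑ f, k * (Λ * ψ f) * 1 := by
          refine sum_le_sum fun f _ => ?_
          have := nibbleE_survives_le_one (E := E) hW0 hu hR hi.le (E f)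
          have h0 : 0 ≤ nibbleE E u W i (survives (E f)) :=
            nibbleE_nonneg hW0 hu hR hi.le (survives_nonneg _)
          have := hW0 i f
          have := ha0 f
          have := hψ f
          gcongr
          · exact ha f
          · exact stepWeight_le hψ (hΛ i hi.le) f
      _ = k * Λ * ∑ f, ψ f := by rw [mul_sum]; exact sum_congr rfl fun f _ => by ring
      _ ≤ _ := by
          gcongr
          exact sum_weight_le hk hk1 hψ fun x => (hd x).trans (by linarith)
  have hθ1 : 1 ≤ 1 + 1 / θ := by have := one_div_pos.2 hθ; linarith
  have hb := one_sub_pow_le hu (by linarith) k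
  rw [← hq] at hb
  have hρq : ρ * q ^ k = q := by
    obtain ⟨j, rfl⟩ := Nat.exists_eq_add_of_le' hk1
    rw [hρ, Nat.add_sub_cancel, pow_succ, ← mul_assoc, inv_mul_cancel₀ (by positivity), one_mul]
  have h2 : q * L - ρ * (k ^ 2 * u ^ 2) * L ≤ ρ * ((1 - k * u) * L) := by
    have := mul_le_mul_of_nonneg_left (mul_le_mul_of_nonneg_right hb hL0) hρ0.le
    rw [← mul_assoc, hρq] at this
    nlinarith
  have h3 : ρ * (k ^ 2 * u ^ 2) * L ≤ (2 ^ k * k ^ 3 * Λ * (1 + 1 / θ)) * N * u ^ 2 := by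
    calc _ ≤ 2 ^ k * (k ^ 2 * u ^ 2) * (k * Λ * N) := by gcongr
      _ = (2 ^ k * k ^ 3 * Λ * 1) * N * u ^ 2 := by ring
      _ ≤ _ := by gcongr
  have h4 : ρ * (u * (k * (1 + 1 / θ) * Q)) ≤ (2 ^ k * k ^ 3 * Λ * (1 + 1 / θ)) * u * Q := by
    have : (k : ℝ) ≤ k ^ 3 * Λ := by
      calc (k : ℝ) = k * 1 := by ring
        _ ≤ k ^ 3 * Λ := by gcongr; exact le_self_pow₀ hk1' (by norm_num)
    calc _ ≤ 2 ^ k * (u * (k ^ 3 * Λ * (1 + 1 / θ) * Q)) := by gcongr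
      _ = _ := by ring
  have h5 := mul_le_mul_of_nonneg_left h1 hρ0.le
  rw [mul_sub] at h5
  linarith

lemma nibble_quantitative (hk : ∀ f, #(E f) = k) (hk1 : 1 ≤ k) (hψ : ∀ f, 0 ≤ ψ f)
    (hθ : 0 < θ) (hd : ∀ x, fracDeg E ψ x ≤ 1 - θ) (hδ0 : 0 ≤ δ)
    (hδ : ∀ x y, x ≠ y → ∑ f, (if x ∈ E f ∧ y ∈ E f then ψ f else 0) ≤ δ)
    (hu : 0 ≤ u) (hu2 : u ≤ 1 / 2) (hΛ : ∀ i ≤ n, (((1 - u) ^ i) ^ (k - 1))⁻¹ ≤ Λ)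
    (hΛ1 : 1 ≤ Λ) (hR : u * (Λ * Fintype.card X + Fintype.card X) ≤ 1) (hT : n * u ≤ T)
    {C δ₁ δ₃ : ℝ} (hC : C = 2 ^ k * k ^ 3 * Λ * (1 + 1 / θ))
    (hδ1 : δ₁ = T * ((2 * k : ℕ) ^ 2 * (Λ * δ))) (hδ3 : δ₃ = δ₁ + Λ ^ 2 * (δ₁ + k * δ)) :
    (∑ f, ψ f) * (1 - (1 - u) ^ n) - T ^ 2 *
      (2 * C * (Real.exp (2 * C * T) * (T + 1) * (δ₃ + C * u)) + C * u) * Fintype.card X ≤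
      matchNum E univ := by
  have hT0 : 0 ≤ T := le_trans (by positivity) hT
  have hd1 : ∀ x, fracDeg E ψ x ≤ 1 := fun x => (hd x).trans (by linarith)
  have hψN := sum_weight_le hk hk1 hψ hd1
  have hW0 : ∀ j f, 0 ≤ stepWeight k u ψ j f := stepWeight_nonneg hψ (by linarith)
  have hR' : ∀ j < n, u * (∑ f, stepWeight k u ψ j f + Fintype.card X) ≤ 1 := by
    intro j hj
    refine le_trans ?_ hR
    gcongr
    calc _ ≤ ∑ f, Λ * ψ f := sum_le_sum fun f _ => stepWeight_le hψ (hΛ j hj.le) f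
      _ = Λ * ∑ f, ψ f := by rw [mul_sum]
      _ ≤ _ := by gcongr
  have hδ1' : 0 ≤ δ₁ := by rw [hδ1]; positivity
  have hδ3' : 0 ≤ δ₃ := by rw [hδ3]; positivity
  have hC0 : 0 ≤ C := by rw [hC]; positivity
  have hcod : ∀ j < n, ∀ x y, x ≠ y →
      ∑ f, (if x ∈ E f ∧ y ∈ E f then stepWeight k u ψ j f else 0) ≤ Λ * δ := by
    intro j hj x y hxy
    calc _ ≤ ∑ f, Λ * (if x ∈ E f ∧ y ∈ E f then ψ f else 0) := by
          refine sum_le_sum fun f _ => ?_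
          split_ifs
          · exact stepWeight_le hψ (hΛ j hj.le) f
          · simp
      _ ≤ _ := by rw [← mul_sum]; gcongr; exact hδ x y hxy
  have hsurv : ∀ i ≤ n, ∀ Z : Finset X, #Z ≤ 2 * k →
      nibbleE E u (stepWeight k u ψ) i (survives Z) ≤ ((1 - u) ^ i) ^ #Z + δ₁ := by
    intro i hi Z hZ
    refine (nibbleE_survives_le hW0 hu (by linarith) hR' (by positivity) hcod hi Z).trans ?_
    rw [mul_comm (#Z) i, pow_mul, hδ1]
    gcongr
    exact le_trans (by gcongr) hT
  set Lf : ℕ → ℝ := fun i => ∑ f, (∑ x ∈ E f, fracDeg E ψ x) * stepWeight k u ψ i f *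
    nibbleE E u (stepWeight k u ψ) i (survives (E f)) with hLf
  set Mf : ℕ → ℝ := fun i => ∑ f, 1 * stepWeight k u ψ i f *
    nibbleE E u (stepWeight k u ψ) i (survives (E f)) with hMf
  set Q : ℕ → ℝ := fun i => nibbleE E u (stepWeight k u ψ) i
    (degVar E (stepWeight k u ψ i) (fracDeg E ψ)) with hQ
  have h00 : ∀ Z : Finset X, nibbleE E u (stepWeight k u ψ) 0 (survives Z) = 1 := by
    intro Z; simp [nibbleE, survives]
  have hM0 : Mf 0 = ∑ f, ψ f := by
    simp only [hMf, h00]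
    exact sum_congr rfl fun f _ => by simp [stepWeight]
  have hL0 : Lf 0 = ∑ x, fracDeg E ψ x ^ 2 := by
    simp only [hLf, h00]
    simp only [stepWeight, pow_zero, one_pow, inv_one, one_mul, mul_one, sq]
    rw [sum_congr rfl fun x _ => show fracDeg E ψ x * fracDeg E ψ x =
      fracDeg E ψ x * ∑ f, (if x ∈ E f then ψ f else 0) from rfl]
    simp only [mul_sum, sum_mul]
    rw [sum_comm]
    refine sum_congr rfl fun f _ => ?_
    rw [← sum_subset (subset_univ (E f))]
    · exact sum_congr rfl fun x hx => by rw [if_pos hx]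
    · intro x _ hx; simp [hx]
  have key := recursion_bounds (Q := Q) (L := Lf) (M := Mf) (S := ∑ x, fracDeg E ψ x ^ 2)
    (N := Fintype.card X) (n := n) (T := T) hu hC0 hδ3' (by positivity) hT (by linarith) rfl
    (fun i hi => nibbleE_nonneg hW0 hu hR' hi.le (degVar_nonneg _))
    (fun i hi => by
      have := degVar_le (nibbleE E u (stepWeight k u ψ) i) hk hk1 hψ hd1 hδ1' hδ0 hδ
        (nibbleE_survives_le_one hW0 hu hR' hi.le) (hsurv i hi.le)
        (pow_pos (by linarith) i) (hΛ i hi.le)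
      rw [← hδ3] at this
      exact this)
    hL0
    (fun i hi => by
      rw [hC]
      refine sum_survives_succ hk hk1 hψ hθ hd hu hu2 hR' hΛ hΛ1
        (fun f => sum_nonneg fun x _ => fracDeg_nonneg hψ x) (fun f => ?_) hi
      refine (sum_le_card_nsmul _ _ 1 fun x _ => hd1 x).trans ?_
      rw [hk]; simp)
    (fun i hi => by
      rw [hC]
      exact sum_survives_succ hk hk1 hψ hθ hd hu hu2 hR' hΛ hΛ1
        (fun f => zero_le_one) (fun f => by exact_mod_cast hk1) hi)
  rw [hM0] at key
  refine key.trans ?_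
  have hne : ∀ f, (E f).Nonempty := fun f => card_pos.1 (by rw [hk]; omega)
  have hν : ∀ i ≤ n, nibbleE E u (stepWeight k u ψ) i (fun A => (matchNum E A : ℝ)) ≤
      matchNum E univ - u * ∑ j ∈ range i, Mf j := by
    intro i
    induction i with
    | zero => intro _; simp [nibbleE]
    | succ i ih =>
      intro hi
      have h1 := ih (by omega)
      rw [nibbleE, LinearMap.comp_apply, sum_range_succ]
      have h2 : nibbleE E u (stepWeight k u ψ) i
          (nibbleStep E u (stepWeight k u ψ i) fun A => (matchNum E A : ℝ)) ≤
          nibbleE E u (stepWeight k u ψ) i ((fun A => (matchNum E A : ℝ)) -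
            u • ∑ f, stepWeight k u ψ i f • survives (E f)) :=
        nibbleE_mono hW0 hu hR' (by omega) fun A => by
          simpa using nibbleStep_matchNum_le hne (hW0 i) hu A
      have h3 : Mf i = nibbleE E u (stepWeight k u ψ) i
          (∑ f, stepWeight k u ψ i f • survives (E f)) := by
        rw [map_sum]; simp only [map_smul, smul_eq_mul, hMf, one_mul]
      rw [map_sub, map_smul, ← h3, smul_eq_mul] at h2
      linarith
  have h1 := hν n le_rfl
  have h2 : 0 ≤ nibbleE E u (stepWeight k u ψ) n (fun A => (matchNum E A : ℝ)) :=
    nibbleE_nonneg hW0 hu hR' le_rfl fun A => by positivity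
  linarith

end Assembly

end Nibble

section Matching

open Finset

set_option maxHeartbeats 400000 in
/-- A fractional matching of a uniform hypergraph with bounded load and small codegrees yields a
matching of nearly the same size. -/
theorem exists_matching_of_fractional {k : ℕ} (hk1 : 1 ≤ k) {θ η : ℝ} (hθ : 0 < θ)
    (hη : 0 < η) : ∃ δ : ℝ, 0 < δ ∧ ∀ {X ι : Type*} [DecidableEq X] [Fintype X] [Fintype ι]
      (E : ι → Finset X) (ψ : ι → ℝ), (∀ f, #(E f) = k) → (∀ f, 0 ≤ ψ f) →
      (∀ x, fracDeg E ψ x ≤ 1 - θ) →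
      (∀ x y, x ≠ y → ∑ f, (if x ∈ E f ∧ y ∈ E f then ψ f else 0) ≤ δ) →
      ∃ M : Finset ι, (M : Set ι).PairwiseDisjoint E ∧
        ∑ f, ψ f - η * Fintype.card X ≤ #M := by
  obtain ⟨T, hT⟩ := exists_nat_gt (2 / η)
  set Λ := Real.exp (2 * k * T) with hΛ
  have hΛ1 : 1 ≤ Λ := Real.one_le_exp (by positivity)
  set C := 2 ^ k * k ^ 3 * Λ * (1 + 1 / θ) with hC
  have hC0 : 0 ≤ C := by positivity
  set e := Real.exp (2 * C * T) with he
  set B₁ := (T : ℝ) ^ 2 * (2 * C * (e * (T + 1))) with hB₁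
  set B₂ := (T : ℝ) ^ 2 * (2 * C * (e * (T + 1) * C) + C) with hB₂
  set c := (T : ℝ) * ((2 * k : ℕ) ^ 2 * Λ) +
    Λ ^ 2 * (T * ((2 * k : ℕ) ^ 2 * Λ) + k) with hc
  have hB₁0 : 0 ≤ B₁ := by positivity
  have hB₂0 : 0 ≤ B₂ := by positivity
  have hc0 : 0 ≤ c := by positivity
  set δ := η / (4 * (B₁ * c + 1)) with hδ
  have hδ0 : 0 < δ := by positivity
  refine ⟨δ, hδ0, fun {X ι} _ _ _ E ψ hk hψ hd hcod => ?_⟩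
  set N := Fintype.card X
  obtain ⟨R, hR⟩ := exists_nat_gt (2 + (Λ * N + N) + 4 * (B₂ + 1) / η)
  have hR1 : 0 ≤ Λ * N + N := by positivity
  have hR2 : 0 ≤ 4 * (B₂ + 1) / η := by positivity
  have hR0 : (0 : ℝ) < R := by linarith
  set u : ℝ := 1 / R with hu
  have hu0 : 0 < u := by positivity
  have hu2 : u ≤ 1 / 2 := one_div_le_one_div_of_le (by norm_num) (by linarith)
  have huN : u * (Λ * N + N) ≤ 1 := by
    rw [hu, one_div, inv_mul_le_iff₀ hR0]; linarith
  have huB : u * (4 * (B₂ + 1)) ≤ η := by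
    rw [hu, one_div, inv_mul_le_iff₀ hR0, ← div_le_iff₀ hη]; linarith
  have hTR : ((T * R : ℕ) : ℝ) * u = T := by
    rw [hu]; push_cast; field_simp
  have h1 : (1 - u)⁻¹ ≤ Real.exp (2 * u) := by
    rw [inv_le_iff_one_le_mul₀ (by linarith)]
    have := Real.add_one_le_exp (2 * u)
    nlinarith
  have hΛi : ∀ i ≤ T * R, (((1 - u) ^ i) ^ (k - 1))⁻¹ ≤ Λ := by
    intro i hi
    calc (((1 - u) ^ i) ^ (k - 1))⁻¹ = ((1 - u)⁻¹) ^ (i * (k - 1)) := by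
          rw [← pow_mul, inv_pow]
      _ ≤ Real.exp (2 * u) ^ (i * (k - 1)) :=
          pow_le_pow_left₀ (inv_nonneg.2 (by linarith)) h1 _
      _ ≤ Real.exp (2 * u) ^ (T * R * k) := by
          refine pow_le_pow_right₀ (Real.one_le_exp (by positivity)) ?_
          gcongr; omega
      _ = Λ := by
          rw [← Real.exp_nat_mul, hΛ]
          congr 1
          rw [Nat.cast_mul, mul_comm _ (2 * u)]
          calc 2 * u * (((T * R : ℕ) : ℝ) * k) = 2 * k * (((T * R : ℕ) : ℝ) * u) := by ring
            _ = _ := by rw [hTR]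
  have key := nibble_quantitative (n := T * R) hk hk1 hψ hθ hd hδ0.le hcod hu0.le hu2 hΛi hΛ1
    huN hTR.le hC rfl rfl
  obtain ⟨M, hM, -, hMc⟩ := exists_matchNum (E := E) univ
  refine ⟨M, hM, ?_⟩
  rw [hMc]
  refine le_trans ?_ key
  have hq : (1 - u) ^ (T * R) ≤ η / 2 := by
    have h2 : 1 - u ≤ Real.exp (-u) := by linarith [Real.add_one_le_exp (-u)]
    calc (1 - u) ^ (T * R) ≤ Real.exp (-u) ^ (T * R) := pow_le_pow_left₀ (by linarith) h2 _
      _ = Real.exp (-T) := by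
          rw [← Real.exp_nat_mul, mul_neg, hTR]
      _ = (Real.exp T)⁻¹ := Real.exp_neg _
      _ ≤ (2 / η)⁻¹ := by
          gcongr
          linarith [Real.add_one_le_exp (T : ℝ)]
      _ = η / 2 := by rw [inv_div]
  have hψN := sum_weight_le hk hk1 hψ fun x => (hd x).trans (by linarith)
  have hψ0 : 0 ≤ ∑ f, ψ f := sum_nonneg fun f _ => hψ f
  have h3 : (T : ℝ) ^ 2 * (2 * C * (e * (T + 1) * ((T * ((2 * k : ℕ) ^ 2 * (Λ * δ)) +
      Λ ^ 2 * (T * ((2 * k : ℕ) ^ 2 * (Λ * δ)) + k * δ)) + C * u)) + C * u) =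
      B₁ * c * δ + B₂ * u := by
    rw [hB₁, hB₂, hc]; ring
  rw [h3]
  have h4 : B₁ * c * δ ≤ η / 4 := by
    have : (B₁ * c + 1) * δ = η / 4 := by rw [hδ]; field_simp
    rw [add_mul, one_mul] at this
    linarith
  have h5 : B₂ * u ≤ η / 4 := by
    rw [show u * (4 * (B₂ + 1)) = 4 * (B₂ * u) + 4 * u by ring] at huB
    linarith
  have h6 : (∑ f, ψ f) * (1 - u) ^ (T * R) ≤ N * (η / 2) :=
    mul_le_mul hψN hq (pow_nonneg (by linarith) _) (by positivity)
  have h7 : (B₁ * c * δ + B₂ * u) * N ≤ (η / 2) * N := by gcongr; linarith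
  rw [mul_sub, mul_one]
  linarith

end Matching

section Sampling

open Finset BigOperators

lemma expect_pow_le {α : Type*} [Fintype α] [Nonempty α] {f : α → ℝ} (hf : ∀ x, 0 ≤ f x)
    (n : ℕ) : (𝔼 x, f x) ^ n ≤ 𝔼 x, f x ^ n := by
  have h := Real.pow_arith_mean_le_arith_mean_pow univ (fun _ : α => (Fintype.card α : ℝ)⁻¹) f
    (fun _ _ => by positivity) (by simp) (fun x _ => hf x) n
  rw [← mul_sum, ← mul_sum] at h
  rw [Fintype.expect_eq_sum_div_card, Fintype.expect_eq_sum_div_card, div_eq_inv_mul,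
    div_eq_inv_mul]
  exact h

lemma expect_prod_fun {M V : Type*} [Fintype M] [DecidableEq M] [Fintype V]
    (f : V → ℝ) : 𝔼 g : M → V, ∏ m, f (g m) = (𝔼 v, f v) ^ Fintype.card M := by
  rw [Fintype.expect_eq_sum_div_card, Fintype.expect_eq_sum_div_card, div_pow]
  congr 1
  · rw [← card_univ, ← prod_const, prod_univ_sum, Fintype.piFinset_univ]
  · simp

lemma expect_prod_type {α β : Type*} [Fintype α] [Fintype β] (f : α × β → ℝ) :
    𝔼 p, f p = 𝔼 a, 𝔼 b, f (a, b) := by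
  rw [← univ_product_univ, expect_product]

/-- Restricting a uniformly random function along an injection gives a uniformly random
function. -/
lemma expect_comp_injective {A B V : Type*} [Fintype A] [DecidableEq A] [Fintype B]
    [DecidableEq B] [Fintype V] [Nonempty V] {i : A → B} (hi : Function.Injective i)
    (F : (A → V) → ℝ) : 𝔼 x : B → V, F (x ∘ i) = 𝔼 y, F y := by
  classical
  have e := Equiv.piEquivPiSubtypeProd (fun b => b ∈ Set.range i) (fun _ : B => V)
  rw [Fintype.expect_equiv (Equiv.piEquivPiSubtypeProd (fun b => b ∈ Set.range i)
    (fun _ : B => V)) (fun x => F (x ∘ i))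
    (fun p => F (fun a => p.1 ⟨i a, Set.mem_range_self a⟩)) (fun x => rfl), expect_prod_type]
  simp only [Fintype.expect_const]
  refine Fintype.expect_equiv
    (Equiv.arrowCongr (Equiv.ofInjective i hi).symm (Equiv.refl V)) _ _ fun x => ?_
  rfl

lemma expect_fin_cons {r : ℕ} {U : Type*} [Fintype U] (f : (Fin (r + 1) → U) → ℝ) :
    𝔼 g, f g = 𝔼 a : U, 𝔼 g : Fin r → U, f (Fin.cons a g) := by
  rw [← expect_prod_type (fun p : U × (Fin r → U) => f (Fin.cons p.1 p.2))]
  exact (Fintype.expect_equiv (Fin.consEquiv fun _ => U) _ _ fun p => rfl).symm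

/-- The number of blow-ups of a configuration is at least what the density predicts. -/
lemma pow_expect_le_expect_box {M V : Type*} [Fintype M] [DecidableEq M] [Fintype V]
    [Nonempty V] (r : ℕ) (F : (Fin r → V) → ℝ) (hF : ∀ x, 0 ≤ F x) :
    (𝔼 x, F x) ^ (Fintype.card M ^ r) ≤
      𝔼 g : Fin r → M → V, ∏ t : Fin r → M, F fun i => g i (t i) := by
  induction r with
  | zero =>
    simp only [pow_zero, pow_one]
    refine le_of_eq (Fintype.expect_equiv (Equiv.ofUnique _ _) _ _ fun x => ?_)
    rw [Fintype.prod_unique]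
    congr 1
    exact Subsingleton.elim _ _
  | succ r ih =>
    set F' : (M → V) → (Fin r → V) → ℝ := fun a y => ∏ m, F (Fin.cons (a m) y) with hF'
    have hF'0 : ∀ a y, 0 ≤ F' a y := fun a y => prod_nonneg fun m _ => hF _
    have h1 : ∀ (a : M → V) (g : Fin r → M → V),
        ∏ t : Fin (r + 1) → M, F (fun i => (Fin.cons a g : Fin (r + 1) → M → V) i (t i)) =
        ∏ t : Fin r → M, F' a fun i => g i (t i) := by
      intro a g
      rw [← (Fin.consEquiv fun _ => M).prod_comp, Fintype.prod_prod_type, prod_comm]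
      refine prod_congr rfl fun t _ => prod_congr rfl fun m _ => ?_
      congr 1
      ext i
      refine Fin.cases ?_ (fun j => ?_) i <;> simp [Fin.consEquiv]
    rw [expect_fin_cons (U := M → V)]
    simp only [h1]
    calc (𝔼 x, F x) ^ Fintype.card M ^ (r + 1)
        = ((𝔼 y : Fin r → V, 𝔼 v, F (Fin.cons v y)) ^ Fintype.card M) ^ Fintype.card M ^ r := by
          rw [expect_fin_cons, expect_comm, ← pow_mul, pow_succ, mul_comm (Fintype.card M ^ r)]
      _ ≤ (𝔼 y : Fin r → V, (𝔼 v, F (Fin.cons v y)) ^ Fintype.card M) ^ Fintype.card M ^ r := by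
          gcongr
          · exact pow_nonneg (expect_nonneg fun y _ => expect_nonneg fun v _ => hF _) _
          · exact expect_pow_le (fun y => expect_nonneg fun v _ => hF _) _
      _ = (𝔼 a : M → V, 𝔼 y, F' a y) ^ Fintype.card M ^ r := by
          rw [expect_comm]
          congr 1
          refine expect_congr rfl fun y _ => ?_
          rw [hF', expect_prod_fun fun v => F (Fin.cons v y)]
      _ ≤ 𝔼 a : M → V, (𝔼 y, F' a y) ^ Fintype.card M ^ r :=
          expect_pow_le (fun a => expect_nonneg fun y _ => hF'0 _ _) _
      _ ≤ _ := expect_le_expect fun a _ => ih (F' a) (hF'0 a)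

open scoped Classical in
/-- The probability of an event under the uniform distribution. -/
noncomputable def prob {α : Type*} [Fintype α] (P : α → Prop) : ℝ := 𝔼 x, if P x then 1 else 0

variable {α ι : Type*} [Fintype α] {P Q : α → Prop}

lemma prob_nonneg (P : α → Prop) : 0 ≤ prob P :=
  expect_nonneg fun x _ => by split_ifs <;> simp

lemma prob_mono (h : ∀ x, P x → Q x) : prob P ≤ prob Q :=
  expect_le_expect fun x _ => by
    by_cases hP : P x
    · simp [hP, h x hP]
    · simp only [hP, if_false]; split_ifs <;> simp

lemma prob_exists_le (s : Finset ι) (R : ι → α → Prop) :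
    prob (fun x => ∃ i ∈ s, R i x) ≤ ∑ i ∈ s, prob (R i) := by
  classical
  unfold prob
  rw [← expect_sum_comm]
  refine expect_le_expect fun x _ => ?_
  have h0 : ∀ i ∈ s, (0 : ℝ) ≤ if R i x then 1 else 0 := fun i _ => by split_ifs <;> simp
  split_ifs with h
  · obtain ⟨i, hi, hR⟩ := h
    exact le_trans (by simp [hR]) (single_le_sum h0 hi)
  · exact sum_nonneg h0

lemma prob_or_le (P Q : α → Prop) : prob (fun x => P x ∨ Q x) ≤ prob P + prob Q := by
  unfold prob
  rw [← expect_add_distrib]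
  refine expect_le_expect fun x _ => ?_
  by_cases h1 : P x <;> by_cases h2 : Q x <;> simp [h1, h2]

lemma prob_comp_injective {A B V : Type*} [Fintype A] [DecidableEq A] [Fintype B]
    [DecidableEq B] [Fintype V] [Nonempty V] {i : A → B} (hi : Function.Injective i)
    (P : (A → V) → Prop) : prob (fun x : B → V => P (x ∘ i)) = prob P := by
  classical
  exact expect_comp_injective hi fun x => if P x then 1 else 0

lemma prob_eq_card (P : α → Prop) :
    prob P = ({x | P x} : Set α).ncard / (Fintype.card α : ℝ) := by
  classical
  unfold prob
  rw [Fintype.expect_eq_sum_div_card, Set.ncard_eq_toFinset_card']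
  congr 1
  simp [Finset.sum_boole]

end Sampling

section RainbowHom

open Finset BigOperators

variable {V W : Type*} [Fintype V] [Fintype W] [DecidableEq W]
  {H : SimpleGraph W} {G : SimpleGraph V} {χ : Sym2 V → ℕ}

/-- `f` embeds `H` into `G` as a rainbow subgraph. -/
def IsRainbowHom (H : SimpleGraph W) (G : SimpleGraph V) (χ : Sym2 V → ℕ) (f : W → V) : Prop :=
  Function.Injective f ∧ (∀ ⦃a b⦄, H.Adj a b → G.Adj (f a) (f b)) ∧
    Set.InjOn χ (Sym2.map f '' H.edgeSet)

lemma prob_le_inv_card [Nonempty V] (w : W) {P : (W → V) → Prop}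
    (h : ∀ f f', P f → P f' → (∀ a, a ≠ w → f a = f' a) → f = f') :
    prob P ≤ 1 / Fintype.card V := by
  have h1 : ({f | P f} : Set (W → V)).ncard ≤ Nat.card ({a // a ≠ w} → V) := by
    rw [← Set.ncard_univ]
    refine Set.ncard_le_ncard_of_injOn (fun f a => f a.1) (fun _ _ => Set.mem_univ _) ?_
      (Set.toFinite _)
    intro f hf f' hf' hff
    exact h f f' hf hf' fun a ha => congrFun hff ⟨a, ha⟩
  have hV : (0 : ℝ) < Fintype.card V := by exact_mod_cast Fintype.card_pos
  rw [prob_eq_card]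
  have h2 : Nat.card ({a // a ≠ w} → V) * Fintype.card V = Fintype.card (W → V) := by
    rw [Nat.card_eq_fintype_card, Fintype.card_fun, Fintype.card_fun, ← pow_succ]
    congr 1
    rw [Fintype.card_subtype_compl, Fintype.card_subtype_eq]
    have : 0 < Fintype.card W := Fintype.card_pos_iff.2 ⟨w⟩
    omega
  have h3 : (0 : ℝ) < Fintype.card (W → V) := by exact_mod_cast Fintype.card_pos
  rw [div_le_div_iff₀ h3 hV, one_mul, ← h2]
  push_cast
  gcongr

lemma prob_not_injective_le [Nonempty V] :
    prob (fun f : W → V => ¬ Function.Injective f) ≤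
      (Fintype.card W : ℝ) ^ 2 / Fintype.card V := by
  calc prob (fun f : W → V => ¬ Function.Injective f) ≤
        prob (fun f : W → V => ∃ p ∈ (univ : Finset (W × W)), p.1 ≠ p.2 ∧ f p.1 = f p.2) := by
        refine prob_mono fun f hf => ?_
        simp only [Function.Injective, not_forall] at hf
        obtain ⟨a, b, hab, hne⟩ := hf
        exact ⟨(a, b), mem_univ _, hne, hab⟩
    _ ≤ ∑ p : W × W, prob (fun f : W → V => p.1 ≠ p.2 ∧ f p.1 = f p.2) := prob_exists_le _ _
    _ ≤ ∑ p : W × W, (1 / Fintype.card V : ℝ) := by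
        refine sum_le_sum fun p _ => prob_le_inv_card p.1 fun f f' hf hf' h => ?_
        ext a
        by_cases ha : a = p.1
        · rw [ha, hf.2, hf'.2, h _ hf.1.symm]
        · exact h a ha
    _ = _ := by
        rw [sum_const, card_univ, Fintype.card_prod, nsmul_eq_mul]; push_cast; ring

lemma prob_not_rainbow_le [Nonempty V] (hχ : ProperEdgeColoring G χ) :
    prob (fun f : W → V => Function.Injective f ∧ (∀ ⦃a b⦄, H.Adj a b → G.Adj (f a) (f b)) ∧
      ¬ Set.InjOn χ (Sym2.map f '' H.edgeSet)) ≤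
      (Fintype.card W : ℝ) ^ 4 / Fintype.card V := by
  set R : W × W × W × W → (W → V) → Prop := fun p f =>
    (∀ ⦃a b⦄, H.Adj a b → G.Adj (f a) (f b)) ∧ p.2.2.2 ≠ p.1 ∧ p.2.2.2 ≠ p.2.1 ∧
    p.2.2.2 ≠ p.2.2.1 ∧ H.Adj p.2.2.1 p.2.2.2 ∧
    χ s(f p.1, f p.2.1) = χ s(f p.2.2.1, f p.2.2.2) with hR
  refine (prob_mono (Q := fun f => ∃ p ∈ univ, R p f) ?_).trans
    ((prob_exists_le _ _).trans ?_)
  · rintro f ⟨hinj, hhom, hnot⟩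
    simp only [Set.InjOn, not_forall] at hnot
    obtain ⟨_, ⟨e, he, rfl⟩, _, ⟨e', he', rfl⟩, hc, hne⟩ := hnot
    induction e with | _ a b
    induction e' with | _ c d
    rw [SimpleGraph.mem_edgeSet] at he he'
    simp only [Sym2.map_mk] at hc hne
    have hdis : ∀ v, v ∈ s(f a, f b) → v ∈ s(f c, f d) → False := fun v h h' =>
      hχ (hhom he) (hhom he') hne ⟨v, h, h'⟩ hc
    refine ⟨(a, b, c, d), mem_univ _, hhom, ?_, ?_, he'.ne', he', hc⟩
    · intro h; exact hdis (f d) (by simp [show d = a from h]) (by simp)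
    · intro h; exact hdis (f d) (by simp [show d = b from h]) (by simp)
  · calc ∑ p, prob (R p) ≤ ∑ p : W × W × W × W, (1 / Fintype.card V : ℝ) := by
          refine sum_le_sum fun ⟨a, b, c, d⟩ _ => prob_le_inv_card d fun f f' hf hf' h => ?_
          obtain ⟨hom, h1, h2, h3, h4, h5⟩ := hf
          obtain ⟨hom', -, -, -, -, h5'⟩ := hf'
          simp only at h1 h2 h3 h4 h5 h5'
          rw [← h a h1.symm, ← h b h2.symm, ← h c h3.symm, h5] at h5'
          have h6 := hom h4
          have h7 := hom' h4
          rw [← h c h3.symm] at h7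
          ext x
          by_cases hx : x = d
          · subst hx
            by_contra hne
            refine hχ (e := s(f c, f x)) (f := s(f c, f' x)) h6 h7 ?_ ⟨f c, by simp, by simp⟩ h5'
            simp only [ne_eq, Sym2.congr_right]
            exact hne
          · exact h x hx
      _ = _ := by
          rw [sum_const, card_univ, nsmul_eq_mul]
          simp only [Fintype.card_prod]; push_cast; ring

variable {r : ℕ} {c : W → Fin r} {y : Sym2 V → ℝ} {κ : ℝ}

/-- `x` spans a clique of `G`, and blowing it down along `c` gives `H` weight more than `κ`. -/
def IsHeavyClique (G : SimpleGraph V) (c : W → Fin r) (S : Finset (Sym2 W)) (y : Sym2 V → ℝ)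
    (κ : ℝ) (x : Fin r → V) : Prop :=
  (∀ i j, i ≠ j → G.Adj (x i) (x j)) ∧ κ < ∑ e ∈ S, y (e.map (x ∘ c))

lemma exists_shift {M : Type*} [AddCommGroup M] [Fintype M] [DecidableEq M]
    (hc : ∀ ⦃a b⦄, H.Adj a b → c a ≠ c b) {S : Finset (Sym2 W)} (hS : ∀ e ∈ S, e ∈ H.edgeSet)
    (e : W → M) {g : Fin r → M → V}
    (hg : ∀ t : Fin r → M, IsHeavyClique G c S y κ fun i => g i (t i)) :
    ∃ t : Fin r → M, (∀ ⦃a b⦄, H.Adj a b →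
        G.Adj (g (c a) (e a + t (c a))) (g (c b) (e b + t (c b)))) ∧
      κ < ∑ ε ∈ S, y (ε.map fun w => g (c w) (e w + t (c w))) := by
  have h1 : ∀ ε ∈ S, ∑ t : Fin r → M, y (ε.map fun w => g (c w) (e w + t (c w))) =
      ∑ t : Fin r → M, y (ε.map ((fun i => g i (t i)) ∘ c)) := by
    intro ε hε
    have := hS ε hε
    induction ε with | _ a b
    have hab := hc this
    refine Fintype.sum_equiv
      (Equiv.addLeft fun i => if i = c a then e a else if i = c b then e b else 0) _ _ fun t => ?_
    simp [hab.symm]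
  have h2 : ∑ t : Fin r → M, κ < ∑ t : Fin r → M,
      ∑ ε ∈ S, y (ε.map fun w => g (c w) (e w + t (c w))) := by
    rw [sum_comm, sum_congr rfl h1, sum_comm]
    exact sum_lt_sum_of_nonempty univ_nonempty fun t _ => (hg t).2
  obtain ⟨t, -, ht⟩ := exists_lt_of_sum_lt h2
  refine ⟨t, fun a b hab => ?_, ht⟩
  have hab' := hc hab
  have := (hg fun i => (if i = c a then e a else e b) + t i).1 (c a) (c b) hab'
  simpa [hab'.symm] using this

lemma prob_heavyClique_pow_le [Nonempty V] {M : Type*} [AddCommGroup M] [Fintype M]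
    [DecidableEq M] (hχ : ProperEdgeColoring G χ) (hc : ∀ ⦃a b⦄, H.Adj a b → c a ≠ c b)
    {S : Finset (Sym2 W)} (hS : ∀ e ∈ S, e ∈ H.edgeSet) (e : W ≃ M) :
    prob (IsHeavyClique G c S y κ) ^ (Fintype.card W ^ r) ≤
      (Fintype.card W : ℝ) ^ r *
      (prob (fun f : W → V => IsRainbowHom H G χ f ∧ κ < ∑ ε ∈ S, y (ε.map f)) +
        (Fintype.card W : ℝ) ^ 2 / Fintype.card V +
        (Fintype.card W : ℝ) ^ 4 / Fintype.card V) := by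
  classical
  set P : (W → V) → Prop := fun f =>
    (∀ ⦃a b⦄, H.Adj a b → G.Adj (f a) (f b)) ∧ κ < ∑ ε ∈ S, y (ε.map f) with hP
  have hPle : prob P ≤ prob (fun f : W → V => IsRainbowHom H G χ f ∧
      κ < ∑ ε ∈ S, y (ε.map f)) + (Fintype.card W : ℝ) ^ 2 / Fintype.card V +
        (Fintype.card W : ℝ) ^ 4 / Fintype.card V := by
    refine (prob_mono (Q := fun f => ((IsRainbowHom H G χ f ∧ κ < ∑ ε ∈ S, y (ε.map f)) ∨
      ¬ Function.Injective f) ∨ (Function.Injective f ∧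
      (∀ ⦃a b⦄, H.Adj a b → G.Adj (f a) (f b)) ∧
      ¬ Set.InjOn χ (Sym2.map f '' H.edgeSet))) ?_).trans ?_
    · rintro f ⟨h1, h2⟩
      unfold IsRainbowHom
      tauto
    · exact (prob_or_le _ _).trans (add_le_add ((prob_or_le _ _).trans
        (add_le_add le_rfl prob_not_injective_le)) (prob_not_rainbow_le hχ))
  have hcard : Fintype.card M = Fintype.card W := (Fintype.card_congr e).symm
  have hbox := pow_expect_le_expect_box (M := M) (V := V) r
    (fun x => if IsHeavyClique G c S y κ x then 1 else 0) (fun x => by split_ifs <;> simp)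
  rw [hcard] at hbox
  refine (show _ ≤ _ from hbox).trans ?_
  calc (𝔼 g : Fin r → M → V, ∏ t : Fin r → M,
        if IsHeavyClique G c S y κ (fun i => g i (t i)) then (1 : ℝ) else 0)
      ≤ prob (fun g : Fin r → M → V => ∃ t ∈ (univ : Finset (Fin r → M)),
          P fun w => g (c w) (e w + t (c w))) := by
        refine expect_le_expect fun g _ => ?_
        by_cases h : ∀ t : Fin r → M, IsHeavyClique G c S y κ fun i => g i (t i)
        · obtain ⟨t, h1, h2⟩ := exists_shift hc hS e h
          have h3 : ∃ t ∈ (univ : Finset (Fin r → M)), P fun w => g (c w) (e w + t (c w)) :=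
            ⟨t, mem_univ _, h1, h2⟩
          rw [if_pos h3]
          exact prod_le_one (fun t _ => by split_ifs <;> simp) fun t _ => by split_ifs <;> simp
        · push Not at h
          obtain ⟨t, ht⟩ := h
          rw [prod_eq_zero (mem_univ t) (by simp [ht])]
          split_ifs <;> simp
    _ ≤ ∑ t : Fin r → M, prob (fun g : Fin r → M → V =>
          P fun w => g (c w) (e w + t (c w))) := prob_exists_le _ _
    _ = ∑ t : Fin r → M, prob P := by
        refine sum_congr rfl fun t _ => ?_
        have hi : Function.Injective fun w => (c w, e w + t (c w)) := by
          intro a b hab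
          simp only [Prod.mk.injEq] at hab
          rw [hab.1] at hab
          exact e.injective (add_right_cancel hab.2)
        rw [← prob_comp_injective (V := V) hi P]
        exact (Fintype.expect_equiv (Equiv.curry (Fin r) M V) _ _ fun x => rfl).symm
    _ = (Fintype.card W : ℝ) ^ r * prob P := by
        rw [sum_const, card_univ, nsmul_eq_mul, Fintype.card_fun, hcard]; simp
    _ ≤ _ := by gcongr

/-- If few rainbow copies of `H` are heavy, then few `r`-cliques are heavy. -/
theorem prob_heavyClique_le [Nonempty W] (hc : ∀ ⦃a b⦄, H.Adj a b → c a ≠ c b)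
    {S : Finset (Sym2 W)} (hS : ∀ e ∈ S, e ∈ H.edgeSet) {β : ℝ} (hβ : 0 < β) :
    ∃ ω : ℝ, 0 < ω ∧ ∃ n₀ : ℕ, 0 < n₀ ∧ ∀ {V : Type*} [Fintype V] {G : SimpleGraph V}
      {χ : Sym2 V → ℕ} {y : Sym2 V → ℝ} {κ : ℝ}, n₀ ≤ Fintype.card V → ProperEdgeColoring G χ →
      prob (fun f : W → V => IsRainbowHom H G χ f ∧ κ < ∑ ε ∈ S, y (ε.map f)) ≤ ω →
      prob (IsHeavyClique G c S y κ) ≤ β := by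
  set m := Fintype.card W with hm
  have hm0 : 0 < m := Fintype.card_pos
  have : NeZero m := ⟨hm0.ne'⟩
  have hm0' : (0 : ℝ) < m := by exact_mod_cast hm0
  obtain ⟨n₀, hn₀⟩ := exists_nat_gt (((m : ℝ) ^ 2 + m ^ 4) / (β ^ (m ^ r) / (2 * m ^ r)))
  refine ⟨β ^ (m ^ r) / (2 * m ^ r), by positivity, n₀, ?_, ?_⟩
  · have : (0 : ℝ) < n₀ := lt_of_le_of_lt (by positivity) hn₀
    exact_mod_cast this
  · intro V _ G χ y κ hn hχ hω
    have hV0 : (0 : ℝ) < n₀ := lt_of_le_of_lt (by positivity) hn₀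
    have hV : (n₀ : ℝ) ≤ Fintype.card V := by exact_mod_cast hn
    have : Nonempty V := Fintype.card_pos_iff.1 (by
      have : (0 : ℝ) < Fintype.card V := by linarith
      exact_mod_cast this)
    have h1 := prob_heavyClique_pow_le (c := c) (y := y) (κ := κ) hχ hc hS
      ((Fintype.equivFin W).trans (ZMod.finEquiv m).toEquiv)
    rw [← hm] at h1
    have h2 : (m : ℝ) ^ 2 / Fintype.card V + m ^ 4 / Fintype.card V ≤
        β ^ (m ^ r) / (2 * m ^ r) := by
      rw [← add_div, div_le_iff₀ (by linarith), ← div_le_iff₀' (by positivity)]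
      linarith
    have h3 : prob (IsHeavyClique G c S y κ) ^ m ^ r ≤ β ^ m ^ r := by
      refine h1.trans ?_
      calc _ ≤ (m : ℝ) ^ r * (β ^ (m ^ r) / (2 * m ^ r) + β ^ (m ^ r) / (2 * m ^ r)) := by
            rw [add_assoc]
            exact mul_le_mul_of_nonneg_left (add_le_add hω h2) (by positivity)
        _ = _ := by field_simp; ring
    exact (pow_le_pow_iff_left₀ (prob_nonneg _) hβ.le (pow_pos hm0 r).ne').1 h3

end RainbowHom

section MotzkinStraus

open Finset Matrix

variable {ι : Type*} [Fintype ι] [DecidableEq ι] {y : Matrix ι ι ℝ}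

lemma quadForm_shift (hsymm : ∀ i j, y i j = y j i) (hdiag : ∀ i, y i i = 0) (z : ι → ℝ)
    (i j : ι) (t : ℝ) :
    (z + t • (Pi.single i 1 - Pi.single j 1)) ⬝ᵥ (y *ᵥ (z + t • (Pi.single i 1 - Pi.single j 1))) =
      z ⬝ᵥ (y *ᵥ z) + 2 * t * ((y *ᵥ z) i - (y *ᵥ z) j) - 2 * t ^ 2 * y i j := by
  have h1 : ∀ k, z ⬝ᵥ y.col k = (y *ᵥ z) k := by
    intro k
    exact sum_congr rfl fun l _ => by rw [Matrix.col_apply, hsymm l k, mul_comm]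
  simp only [mulVec_add, mulVec_smul, mulVec_sub, dotProduct_add, add_dotProduct, smul_dotProduct,
    dotProduct_smul, sub_dotProduct, dotProduct_sub, h1, single_one_dotProduct, mulVec_single_one,
    Matrix.col_apply, smul_eq_mul, hdiag, hsymm j i]
  ring

lemma sum_shift (z : ι → ℝ) (i j : ι) (t : ℝ) :
    ∑ k, (z + t • (Pi.single i 1 - Pi.single j 1) : ι → ℝ) k = ∑ k, z k := by
  simp [sum_add_distrib, ← mul_sum]

/-- A weighted Motzkin–Straus inequality. -/
theorem quadForm_le {r : ℕ} (hr : 3 ≤ r) (hsymm : ∀ i j, y i j = y j i) (hdiag : ∀ i, y i i = 0)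
    (hle : ∀ i j, y i j ≤ 1)
    (htri : ∀ T : Finset ι, r ≤ #T → (∀ i ∈ T, ∀ j ∈ T, i ≠ j → 0 < y i j) →
      ∀ a ∈ T, ∀ b ∈ T, ∀ k ∈ T, a ≠ b → a ≠ k → b ≠ k → y a b + y a k + y b k ≤ 5 / 4)
    (n : ℕ) (T : Finset ι) (hT : #T = n) (z : ι → ℝ) (hz : ∀ i, 0 ≤ z i)
    (hzT : ∀ i ∉ T, z i = 0) (hz1 : ∑ i, z i = 1) :
    z ⬝ᵥ (y *ᵥ z) ≤ 1 - 1 / (r - 1 : ℝ) := by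
  induction n generalizing T z with
  | zero =>
    rw [card_eq_zero] at hT
    subst hT
    exfalso
    rw [sum_eq_zero fun i _ => hzT i (by simp)] at hz1
    exact zero_ne_one hz1
  | succ n ih =>
    have hstep : ∀ i ∈ T, ∀ z : ι → ℝ, (∀ i, 0 ≤ z i) → (∀ i ∉ T, z i = 0) → ∑ i, z i = 1 →
        z i = 0 → z ⬝ᵥ (y *ᵥ z) ≤ 1 - 1 / (r - 1 : ℝ) := by
      intro i hi z hz hzT hz1 hzi
      refine ih (T.erase i) (by rw [card_erase_of_mem hi, hT]; rfl) z hz (fun j hj => ?_) hz1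
      by_cases hji : j = i
      · rw [hji, hzi]
      · exact hzT j fun h => hj (mem_erase.2 ⟨hji, h⟩)
    have hshift : ∀ (z : ι → ℝ), (∀ i, 0 ≤ z i) → (∀ i ∉ T, z i = 0) →
        ∀ i ∈ T, ∀ j ∈ T, i ≠ j → ∀ t, 0 ≤ t → t ≤ z j →
        (∀ k, 0 ≤ (z + t • (Pi.single i 1 - Pi.single j 1) : ι → ℝ) k) ∧
        ∀ k ∉ T, (z + t • (Pi.single i 1 - Pi.single j 1) : ι → ℝ) k = 0 := by
      intro z hz hzT i hi j hj hij t ht0 ht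
      refine ⟨fun k => ?_, fun k hk => ?_⟩
      · rcases eq_or_ne k j with rfl | hkj
        · simp [hij.symm]; exact ht
        · rcases eq_or_ne k i with rfl | hki
          · simp [hkj]; linarith [hz k]
          · simpa [hki, hkj] using hz k
      · have hki : k ≠ i := fun h => hk (h ▸ hi)
        have hkj : k ≠ j := fun h => hk (h ▸ hj)
        simpa [hki, hkj] using hzT k hk
    set Δ : Set (ι → ℝ) := {z | (∀ i, 0 ≤ z i) ∧ ∑ i, z i = 1} ∩ {z | ∀ i ∉ T, z i = 0} with hΔ
    have hcomp : IsCompact Δ := by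
      refine (isCompact_stdSimplex (𝕜 := ℝ) (ι := ι)).inter_right ?_
      simp only [Set.ofPred_forall]
      exact isClosed_iInter fun i => isClosed_iInter fun _ =>
        isClosed_eq (continuous_apply i) continuous_const
    have hcont : Continuous fun z : ι → ℝ => z ⬝ᵥ (y *ᵥ z) := by
      unfold dotProduct mulVec dotProduct
      fun_prop
    obtain ⟨p, ⟨⟨hp0, hp1⟩, hpT⟩, hpmax⟩ := hcomp.exists_isMaxOn ⟨z, ⟨hz, hz1⟩, hzT⟩ hcont.continuousOn
    refine (hpmax (⟨⟨hz, hz1⟩, hzT⟩ : z ∈ Δ)).trans ?_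
    show p ⬝ᵥ (y *ᵥ p) ≤ _
    by_cases hp : ∃ i ∈ T, p i = 0
    · obtain ⟨i, hi, hpi⟩ := hp
      exact hstep i hi p hp0 hpT hp1 hpi
    push Not at hp
    have hppos : ∀ i ∈ T, 0 < p i := fun i hi => (hp0 i).lt_of_ne' (hp i hi)
    by_cases hneg : ∃ i ∈ T, ∃ j ∈ T, i ≠ j ∧ y i j ≤ 0 ∧ (y *ᵥ p) j ≤ (y *ᵥ p) i
    · obtain ⟨i, hi, j, hj, hij, hy, hD⟩ := hneg
      obtain ⟨h1, h2⟩ := hshift p hp0 hpT i hi j hj hij (p j) (hp0 j) le_rfl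
      have h3 := hstep j hj _ h1 h2 ((sum_shift p i j _).trans hp1) (by simp [hij.symm])
      rw [quadForm_shift hsymm hdiag] at h3
      have h4 := mul_nonneg (hp0 j) (sub_nonneg.2 hD)
      have h5 := mul_nonneg (sq_nonneg (p j)) (neg_nonneg.2 hy)
      linarith
    have hypos : ∀ i ∈ T, ∀ j ∈ T, i ≠ j → 0 < y i j := by
      intro i hi j hj hij
      by_contra h
      push Not at h hneg
      rcases le_total ((y *ᵥ p) j) ((y *ᵥ p) i) with h' | h'
      · exact (hneg i hi j hj hij h).not_ge h'
      · exact (hneg j hj i hi hij.symm (by rwa [hsymm])).not_ge h'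
    have hr' : (3 : ℝ) ≤ r := by exact_mod_cast hr
    have hsumT : ∑ i ∈ T, p i = 1 := by
      rw [← hp1]; exact sum_subset (subset_univ _) fun i _ hi => hpT i hi
    rcases lt_or_ge (#T) r with hTr | hTr
    · have h1 : p ⬝ᵥ (y *ᵥ p) ≤ ∑ i, p i * ((∑ j, p j) - p i) := by
        refine sum_le_sum fun i _ => mul_le_mul_of_nonneg_left ?_ (hp0 i)
        rw [← sum_erase_eq_sub (mem_univ i)]
        show ∑ j, y i j * p j ≤ _
        rw [← sum_erase (s := univ) (a := i) (f := fun j => y i j * p j) (by rw [hdiag, zero_mul])]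
        exact sum_le_sum fun j _ => mul_le_of_le_one_left (hp0 j) (hle i j)
      have h2 : ∑ i, p i * ((∑ j, p j) - p i) = 1 - ∑ i ∈ T, p i ^ 2 := by
        rw [hp1]
        simp only [mul_sub, mul_one, sum_sub_distrib, hp1]
        congr 1
        rw [← sum_subset (subset_univ T) fun i _ hi => by simp [hpT i hi]]
        exact sum_congr rfl fun i _ => by ring
      have h3 := sq_sum_le_card_mul_sum_sq (s := T) (f := p)
      rw [hsumT] at h3
      have h4 : (#T : ℝ) ≤ r - 1 := by
        have : (#T : ℝ) + 1 ≤ r := by exact_mod_cast hTr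
        linarith
      have h5 : 1 / (r - 1 : ℝ) ≤ ∑ i ∈ T, p i ^ 2 := by
        rw [div_le_iff₀ (by linarith), mul_comm]
        have := mul_le_mul_of_nonneg_right h4 (sum_nonneg fun i (_ : i ∈ T) => sq_nonneg (p i))
        linarith
      linarith
    · have hhalf : (1 / 2 : ℝ) ≤ 1 - 1 / (r - 1 : ℝ) := by
        have : 1 / (r - 1 : ℝ) ≤ 1 / 2 := one_div_le_one_div_of_le (by norm_num) (by linarith)
        linarith
      refine le_trans ?_ hhalf
      have hDle : ∀ i ∈ T, ∀ j ∈ T, (y *ᵥ p) i ≤ (y *ᵥ p) j := by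
        intro i hi j hj
        by_contra h
        push Not at h
        have hij : i ≠ j := by rintro rfl; exact lt_irrefl _ h
        set d := (y *ᵥ p) i - (y *ᵥ p) j with hd
        have hd0 : 0 < d := sub_pos.2 h
        have ht0 : 0 < min (p j) (d / 2) := lt_min (hppos j hj) (half_pos hd0)
        obtain ⟨h1, h2⟩ := hshift p hp0 hpT i hi j hj hij _ ht0.le (min_le_left _ _)
        have h3 := hpmax (⟨⟨h1, (sum_shift p i j _).trans hp1⟩, h2⟩ : _ ∈ Δ)
        simp only [Set.mem_ofPred_eq] at h3
        rw [quadForm_shift hsymm hdiag, ← hd] at h3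
        have ht2 : min (p j) (d / 2) ≤ d / 2 := min_le_right _ _
        set t := min (p j) (d / 2)
        have h4 : t ^ 2 * y i j ≤ t ^ 2 := mul_le_of_le_one_right (sq_nonneg t) (hle i j)
        have h5 : t * t ≤ t * (d / 2) := mul_le_mul_of_nonneg_left ht2 ht0.le
        have h6 := mul_pos ht0 hd0
        nlinarith
      have hD : ∀ i ∈ T, p ⬝ᵥ (y *ᵥ p) = (y *ᵥ p) i := by
        intro i hi
        have : p ⬝ᵥ (y *ᵥ p) = ∑ k, p k * (y *ᵥ p) i := by
          refine sum_congr rfl fun k _ => ?_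
          by_cases hk : k ∈ T
          · rw [le_antisymm (hDle k hk i hi) (hDle i hi k hk)]
          · simp [hpT k hk]
        rw [this, ← sum_mul, hp1, one_mul]
      by_cases hbig : ∃ a ∈ T, ∃ b ∈ T, a ≠ b ∧ 1 / 4 ≤ y a b
      · obtain ⟨a, ha, b, hb, hab, hy⟩ := hbig
        have h1 : (y *ᵥ p) a + (y *ᵥ p) b ≤ ∑ k, p k := by
          simp only [mulVec, dotProduct]
          rw [← sum_add_distrib]
          refine sum_le_sum fun k _ => ?_
          rw [← add_mul]
          by_cases hk : k ∈ T
          · refine mul_le_of_le_one_left (hp0 k) ?_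
            rcases eq_or_ne a k with rfl | hak
            · rw [hdiag, zero_add]; exact hle _ _
            rcases eq_or_ne b k with rfl | hbk
            · rw [hdiag, add_zero]; exact hle _ _
            linarith [htri T hTr hypos a ha b hb k hk hab hak hbk]
          · simp [hpT k hk]
        rw [hp1] at h1
        linarith [hD a ha, hD b hb]
      · push Not at hbig
        have hne : T.Nonempty := card_pos.1 (by omega)
        obtain ⟨i, hi⟩ := hne
        rw [hD i hi]
        have : (y *ᵥ p) i ≤ ∑ j, 1 / 4 * p j := by
          refine sum_le_sum fun j _ => ?_
          by_cases hj : j ∈ T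
          · refine mul_le_mul_of_nonneg_right ?_ (hp0 j)
            rcases eq_or_ne i j with rfl | hij
            · exact (hdiag i).le.trans (by norm_num)
            · exact (hbig i hi j hj hij).le
          · simp [hpT j hj]
        rw [← mul_sum, hp1] at this
        linarith

end MotzkinStraus

section WeightedTuran

open Finset BigOperators Matrix

lemma triangle_le_sum {V W : Type*} {H : SimpleGraph W} {r : ℕ} {c : W → Fin r}
    (hpair : ∀ i j, i ≠ j → ∃ a b, H.Adj a b ∧ c a = i ∧ c b = j)
    (hc : ∀ ⦃a b⦄, H.Adj a b → c a ≠ c b)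
    {S : Finset (Sym2 W)} (hS : ∀ e, e ∈ S ↔ e ∈ H.edgeSet) {y : Sym2 V → ℝ} {x : Fin r → V}
    (hpos : ∀ i j, i ≠ j → 0 < y s(x i, x j)) {i j k : Fin r} (hij : i ≠ j) (hik : i ≠ k)
    (hjk : j ≠ k) :
    y s(x i, x j) + y s(x i, x k) + y s(x j, x k) ≤ ∑ e ∈ S, y (e.map (x ∘ c)) := by
  classical
  obtain ⟨a₁, b₁, h₁, ha₁, hb₁⟩ := hpair i j hij
  obtain ⟨a₂, b₂, h₂, ha₂, hb₂⟩ := hpair i k hik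
  obtain ⟨a₃, b₃, h₃, ha₃, hb₃⟩ := hpair j k hjk
  have n₁₂ : s(a₁, b₁) ≠ s(a₂, b₂) := by
    intro h
    have := congrArg (Sym2.map c) h
    simp only [Sym2.map_mk, ha₁, hb₁, ha₂, hb₂, Sym2.eq_iff] at this
    grind
  have n₁₃ : s(a₁, b₁) ≠ s(a₃, b₃) := by
    intro h
    have := congrArg (Sym2.map c) h
    simp only [Sym2.map_mk, ha₁, hb₁, ha₃, hb₃, Sym2.eq_iff] at this
    grind
  have n₂₃ : s(a₂, b₂) ≠ s(a₃, b₃) := by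
    intro h
    have := congrArg (Sym2.map c) h
    simp only [Sym2.map_mk, ha₂, hb₂, ha₃, hb₃, Sym2.eq_iff] at this
    grind
  have hsub : ({s(a₁, b₁), s(a₂, b₂), s(a₃, b₃)} : Finset (Sym2 W)) ⊆ S := by
    intro e he
    simp only [mem_insert, mem_singleton] at he
    rw [hS]
    rcases he with rfl | rfl | rfl <;> assumption
  have := sum_le_sum_of_subset_of_nonneg (f := fun e => y (e.map (x ∘ c))) hsub
    fun e he _ => by
      rw [hS] at he
      induction e with | _ a b
      exact (hpos _ _ (hc he)).le
  rw [sum_insert (by simp [n₁₂, n₁₃]), sum_pair n₂₃] at this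
  simpa [ha₁, hb₁, ha₂, hb₂, ha₃, hb₃, add_assoc] using this

variable {W : Type*} [Fintype W] [DecidableEq W] {H : SimpleGraph W} {r : ℕ} {c : W → Fin r}

open scoped Classical in
/-- The weight of a pair of vertices, zero for non-edges. -/
noncomputable def pairWeight {V : Type*} (G : SimpleGraph V) (y : Sym2 V → ℝ) (u v : V) : ℝ :=
  if G.Adj u v then y s(u, v) else 0

lemma sum_pairWeight_le {V : Type*} {G : SimpleGraph V} {y : Sym2 V → ℝ} (hr : 3 ≤ r)
    (hc : ∀ ⦃a b⦄, H.Adj a b → c a ≠ c b)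
    (hpair : ∀ i j, i ≠ j → ∃ a b, H.Adj a b ∧ c a = i ∧ c b = j)
    {S : Finset (Sym2 W)} (hS : ∀ e, e ∈ S ↔ e ∈ H.edgeSet) (hy : ∀ e, y e ≤ 1) {s : ℕ}
    (hs : 0 < s) (x : Fin s → V)
    (hx : ∀ t : Fin r → Fin s, Function.Injective t → ¬ IsHeavyClique G c S y (5 / 4) (x ∘ t)) :
    ∑ i, ∑ j, pairWeight G y (x i) (x j) ≤ (1 - 1 / (r - 1 : ℝ)) * (s : ℝ) ^ 2 := by
  have hs' : (0 : ℝ) < s := by exact_mod_cast hs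
  have key := quadForm_le (y := Matrix.of fun i j : Fin s => pairWeight G y (x i) (x j)) hr
    (fun i j => by
      simp only [pairWeight, Matrix.of_apply]
      rw [Sym2.eq_swap]; congr 1; exact propext (G.adj_comm _ _))
    (fun i => by simp [pairWeight])
    (fun i j => by
      simp only [pairWeight, Matrix.of_apply]; split_ifs
      exacts [hy _, zero_le_one])
    (fun T hT hpos a ha b hb k hk hab hak hbk => by
      obtain ⟨T', hT'1, hT'2, hT'3⟩ := exists_subsuperset_card_eq (s := {a, b, k}) (t := T) (n := r)
        (by simp [insert_subset_iff, ha, hb, hk])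
        (by rw [card_eq_three.2 ⟨a, b, k, hab, hak, hbk, rfl⟩]; exact hr) hT
      have e : Fin r ≃ T' := (T'.equivFinOfCardEq hT'3).symm
      set t : Fin r → Fin s := fun i => (e i : Fin s) with ht
      have hti : Function.Injective t := Subtype.val_injective.comp e.injective
      have hget : ∀ v ∈ ({a, b, k} : Finset (Fin s)), ∃ i, t i = v := fun v hv =>
        ⟨e.symm ⟨v, hT'1 hv⟩, by simp [ht]⟩
      obtain ⟨i, rfl⟩ := hget a (by simp)
      obtain ⟨j, rfl⟩ := hget b (by simp)
      obtain ⟨l, rfl⟩ := hget k (by simp)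
      have hpos' : ∀ i j, i ≠ j → 0 < pairWeight G y (x (t i)) (x (t j)) := fun i j hij =>
        hpos _ (hT'2 (e i).2) _ (hT'2 (e j).2) (hti.ne hij)
      have hadj : ∀ i j, i ≠ j → G.Adj (x (t i)) (x (t j)) := fun i j hij => by
        by_contra h
        have := hpos' i j hij
        simp [pairWeight, h] at this
      have hval : ∀ i j, i ≠ j → pairWeight G y (x (t i)) (x (t j)) = y s(x (t i), x (t j)) :=
        fun i j hij => by simp [pairWeight, hadj i j hij]
      have hij : i ≠ j := fun h => hab (by rw [h])
      have hil : i ≠ l := fun h => hak (by rw [h])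
      have hjl : j ≠ l := fun h => hbk (by rw [h])
      have h1 := triangle_le_sum hpair hc hS (y := y) (x := x ∘ t)
        (fun i j hij => by have := hpos' i j hij; rwa [hval i j hij] at this) hij hil hjl
      have h2 : ∑ e ∈ S, y (e.map ((x ∘ t) ∘ c)) ≤ 5 / 4 := by
        by_contra h
        exact hx t hti ⟨hadj, not_le.1 h⟩
      simp only [Matrix.of_apply, hval _ _ hij, hval _ _ hil, hval _ _ hjl]
      exact h1.trans h2)
    s univ (by simp) (fun _ => (1 : ℝ) / s) (fun _ => by positivity) (by simp)
    (by simp [hs'.ne'])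
  have : (fun _ : Fin s => (1 : ℝ) / s) ⬝ᵥ
      ((Matrix.of fun i j : Fin s => pairWeight G y (x i) (x j)) *ᵥ fun _ => (1 : ℝ) / s) =
      (∑ i, ∑ j, pairWeight G y (x i) (x j)) / (s : ℝ) ^ 2 := by
    simp only [dotProduct, mulVec, Matrix.of_apply, ← sum_mul, ← mul_sum]
    field_simp
  rw [this, div_le_iff₀ (by positivity)] at key
  exact key

lemma expect_pairWeight_le {V : Type*} [Fintype V] [Nonempty V] {G : SimpleGraph V}
    {y : Sym2 V → ℝ} (hr : 3 ≤ r)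
    (hc : ∀ ⦃a b⦄, H.Adj a b → c a ≠ c b)
    (hpair : ∀ i j, i ≠ j → ∃ a b, H.Adj a b ∧ c a = i ∧ c b = j)
    {S : Finset (Sym2 W)} (hS : ∀ e, e ∈ S ↔ e ∈ H.edgeSet) (hy : ∀ e, y e ≤ 1) {s : ℕ}
    (hs : 0 < s) :
    𝔼 x : Fin 2 → V, pairWeight G y (x 0) (x 1) ≤
      (1 - 1 / (r - 1 : ℝ)) + (s : ℝ) ^ r * prob (IsHeavyClique G c S y (5 / 4)) + 1 / s := by
  classical
  have hs' : (0 : ℝ) < s := by exact_mod_cast hs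
  set A := 𝔼 x : Fin 2 → V, pairWeight G y (x 0) (x 1) with hA
  set l : ℝ := 1 - 1 / (r - 1 : ℝ) with hl
  have hr' : (3 : ℝ) ≤ r := by exact_mod_cast hr
  have hl0 : 0 ≤ l := by
    rw [hl, sub_nonneg, div_le_one (by linarith)]; linarith
  have hw1 : ∀ u v, pairWeight G y u v ≤ 1 := fun u v => by
    unfold pairWeight; split_ifs
    exacts [hy _, zero_le_one]
  have hA1 : A ≤ 1 := by
    refine (expect_le_expect fun x _ => hw1 _ _).trans ?_
    simp
  set B : (Fin s → V) → Prop := fun x => ∃ t ∈ (univ : Finset (Fin r → Fin s)),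
    Function.Injective t ∧ IsHeavyClique G c S y (5 / 4) (x ∘ t) with hB
  have hpB : prob B ≤ (s : ℝ) ^ r * prob (IsHeavyClique G c S y (5 / 4)) := by
    refine (prob_exists_le _ _).trans ?_
    calc _ ≤ ∑ t : Fin r → Fin s, prob (IsHeavyClique G c S y (5 / 4)) := by
          refine sum_le_sum fun t _ => ?_
          by_cases ht : Function.Injective t
          · rw [← prob_comp_injective ht]
            exact prob_mono fun x hx => hx.2
          · refine le_trans (le_of_eq ?_) (prob_nonneg _)
            simp [prob, ht]
      _ = _ := by simp
  have h1 : 𝔼 x : Fin s → V, ∑ i, ∑ j, pairWeight G y (x i) (x j) = ((s : ℝ) ^ 2 - s) * A := by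
    simp only [expect_sum_comm]
    have : ∀ i j : Fin s, 𝔼 x : Fin s → V, pairWeight G y (x i) (x j) =
        A - if i = j then A else 0 := by
      intro i j
      split_ifs with h
      · subst h; simp [pairWeight]
      · have hi : Function.Injective ![i, j] := by
          intro a b
          fin_cases a <;> fin_cases b <;> simp [h, Ne.symm h]
        have := expect_comp_injective (V := V) hi fun x => pairWeight G y (x 0) (x 1)
        rw [sub_zero, hA, ← this]
        rfl
    simp only [this, sum_sub_distrib, sum_const, sum_ite_eq, mem_univ, if_true, card_univ,
      Fintype.card_fin, nsmul_eq_mul]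
    ring
  have h2 : 𝔼 x : Fin s → V, ∑ i, ∑ j, pairWeight G y (x i) (x j) ≤
      l * (s : ℝ) ^ 2 + (s : ℝ) ^ 2 * prob B := by
    unfold prob
    rw [mul_expect, ← Fintype.expect_const (ι := Fin s → V) (l * (s : ℝ) ^ 2),
      ← expect_add_distrib]
    refine expect_le_expect fun x _ => ?_
    split_ifs with h
    · have : ∑ i, ∑ j, pairWeight G y (x i) (x j) ≤ ∑ i : Fin s, ∑ j : Fin s, (1 : ℝ) :=
        sum_le_sum fun i _ => sum_le_sum fun j _ => hw1 _ _
      simp only [sum_const, card_univ, Fintype.card_fin, nsmul_eq_mul, mul_one] at this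
      have h3 : 0 ≤ l * (s : ℝ) ^ 2 := by positivity
      linarith [sq (s : ℝ)]
    · rw [mul_zero, add_zero]
      refine sum_pairWeight_le hr hc hpair hS hy hs x fun t ht hh => h ⟨t, mem_univ _, ht, hh⟩
  rw [h1] at h2
  have h3 : (s : ℝ) ^ 2 * A ≤ (s : ℝ) ^ 2 * (l + prob B + 1 / s) := by
    have e1 : (s : ℝ) ^ 2 * (l + prob B + 1 / s) = l * (s : ℝ) ^ 2 + (s : ℝ) ^ 2 * prob B + s := by
      field_simp
    have e2 := mul_le_mul_of_nonneg_left hA1 hs'.le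
    rw [e1]
    linarith
  have h4 := le_of_mul_le_mul_left h3 (by positivity)
  linarith

lemma sum_edges_eq {V : Type*} [Fintype V] [Nonempty V] {G : SimpleGraph V} {y : Sym2 V → ℝ}
    {F : Finset (Sym2 V)} (hF : ∀ e, e ∈ F ↔ e ∈ G.edgeSet) :
    ∑ e ∈ F, y e = (𝔼 x : Fin 2 → V, pairWeight G y (x 0) (x 1)) * (Fintype.card V : ℝ) ^ 2 / 2 := by
  classical
  have h1 : (𝔼 x : Fin 2 → V, pairWeight G y (x 0) (x 1)) * (Fintype.card V : ℝ) ^ 2 =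
      ∑ p : V × V, pairWeight G y p.1 p.2 := by
    rw [Fintype.expect_eq_sum_div_card]
    have h0 : ((Fintype.card (Fin 2 → V) : ℕ) : ℝ) = (Fintype.card V : ℝ) ^ 2 := by simp
    have : (Fintype.card V : ℝ) ≠ 0 := by exact_mod_cast Fintype.card_ne_zero
    rw [h0, div_mul_cancel₀ _ (by positivity)]
    exact Fintype.sum_equiv (finTwoArrowEquiv V) _ _ fun x => rfl
  have h2 : ∑ p : V × V, pairWeight G y p.1 p.2 = ∑ d : G.Dart, y d.edge := by
    have : ∑ p : V × V, pairWeight G y p.1 p.2 = ∑ p ∈ univ.filter fun p : V × V => G.Adj p.1 p.2, y s(p.1, p.2) := by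
      rw [sum_filter]; rfl
    rw [this]
    refine (sum_bij (fun d _ => d.toProd) (fun d _ => by simp) (fun d _ d' _ h => ?_)
      (fun p hp => ?_) (fun d _ => rfl)).symm
    · exact SimpleGraph.Dart.ext _ _ h
    · exact ⟨⟨p, by simpa using hp⟩, mem_univ _, rfl⟩
  rw [h1, h2, ← sum_fiberwise_of_maps_to (s := univ) (t := F) (g := fun d : G.Dart => d.edge)
    fun d _ => (hF _).2 d.edge_mem]
  rw [eq_div_iff two_ne_zero, sum_mul]
  refine sum_congr rfl fun e he => ?_
  rw [sum_congr rfl (g := fun _ => y e) fun d hd => by rw [(mem_filter.1 hd).2], sum_const,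
    G.dart_edge_fiber_card e ((hF e).1 he), nsmul_eq_mul]
  push_cast; ring

/-- Turán's theorem for edge weights at most `1` for which few rainbow copies of `H` have total
weight more than `5 / 4`. -/
theorem sum_edgeWeight_le [Nonempty W] (hr : 3 ≤ r)
    (hc : ∀ ⦃a b⦄, H.Adj a b → c a ≠ c b)
    (hpair : ∀ i j, i ≠ j → ∃ a b, H.Adj a b ∧ c a = i ∧ c b = j)
    {S : Finset (Sym2 W)} (hS : ∀ e, e ∈ S ↔ e ∈ H.edgeSet) {η : ℝ} (hη : 0 < η) :
    ∃ ω : ℝ, 0 < ω ∧ ∃ n₀ : ℕ, 0 < n₀ ∧ ∀ {V : Type*} [Fintype V] {G : SimpleGraph V}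
      {χ : Sym2 V → ℕ} {y : Sym2 V → ℝ} {F : Finset (Sym2 V)}, n₀ ≤ Fintype.card V →
      ProperEdgeColoring G χ → (∀ e, y e ≤ 1) → (∀ e, e ∈ F ↔ e ∈ G.edgeSet) →
      prob (fun f : W → V => IsRainbowHom H G χ f ∧ 5 / 4 < ∑ ε ∈ S, y (ε.map f)) ≤ ω →
      ∑ e ∈ F, y e ≤ ((1 - 1 / (r - 1 : ℝ)) / 2 + η) * (Fintype.card V : ℝ) ^ 2 := by
  obtain ⟨s, hs⟩ := exists_nat_gt (1 / η)
  have hs0 : (0 : ℝ) < s := lt_trans (by positivity) hs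
  obtain ⟨ω, hω, n₀, hn₀, h⟩ := prob_heavyClique_le (c := c) hc (S := S) (fun e he => (hS e).1 he)
    (β := η / (s : ℝ) ^ r) (by positivity)
  refine ⟨ω, hω, n₀, hn₀, fun {V _ G χ y F} hn hχ hy hF hp => ?_⟩
  have : Nonempty V := Fintype.card_pos_iff.1 (by omega)
  have h1 := h hn hχ hp
  have h2 := expect_pairWeight_le (G := G) hr hc hpair hS hy (s := s) (by exact_mod_cast hs0)
  have h3 : (s : ℝ) ^ r * prob (IsHeavyClique G c S y (5 / 4)) ≤ η := by
    rw [le_div_iff₀ (by positivity)] at h1; linarith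
  have h4 : (1 : ℝ) / s ≤ η := by
    rw [div_lt_iff₀ hη] at hs
    rw [div_le_iff₀ hs0]; linarith
  rw [sum_edges_eq hF, mul_div_right_comm]
  exact mul_le_mul_of_nonneg_right (by linarith) (by positivity)

end WeightedTuran

section Penalty

open Finset

lemma sq_max_add_le (a t : ℝ) : (max (a + t) 0) ^ 2 ≤ (max a 0) ^ 2 + 2 * max a 0 * t + t ^ 2 := by
  have h : (max a 0) ^ 2 + 2 * max a 0 * t + t ^ 2 = (max a 0 + t) ^ 2 := by ring
  rw [h]
  rcases le_total (a + t) 0 with h' | h'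
  · rw [max_eq_right h']; nlinarith [sq_nonneg (max a 0 + t)]
  · rw [max_eq_left h']
    have : a ≤ max a 0 := le_max_left _ _
    gcongr

variable {X ι : Type*} [DecidableEq X] [Fintype X] [Fintype ι]

/-- An approximately optimal bounded fractional packing together with an approximate dual. -/
theorem exists_fractional_packing (E : ι → Finset X) {A B : ℝ} (hA : 0 < A) (hB : 0 < B) :
    ∃ (ψ : ι → ℝ) (z : X → ℝ), (∀ f, 0 ≤ ψ f) ∧ (∀ f, ψ f ≤ B) ∧ (∀ x, 0 ≤ z x) ∧
      (∀ f, ψ f < B → 1 ≤ ∑ x ∈ E f, z x) ∧ ∑ x, z x ≤ ∑ f, ψ f ∧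
      ∀ x, fracDeg E ψ x ≤ 1 + 1 / (2 * A) := by
  classical
  set Φ : (ι → ℝ) → ℝ := fun ψ => A * ∑ x, (max (fracDeg E ψ x - 1) 0) ^ 2 - ∑ f, ψ f with hΦ
  have hcont : Continuous Φ := by
    have h : ∀ x, Continuous fun ψ : ι → ℝ => fracDeg E ψ x := fun x => by
      unfold fracDeg
      refine continuous_finsetSum _ fun f _ => ?_
      split_ifs
      exacts [continuous_apply f, continuous_const]
    refine (continuous_const.mul (continuous_finsetSum _ fun x _ => ?_)).sub
      (continuous_finsetSum _ fun f _ => continuous_apply f)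
    exact (((h x).sub continuous_const).max continuous_const).pow 2
  obtain ⟨ψ, hψ, hmin⟩ := (isCompact_Icc (a := (0 : ι → ℝ)) (b := fun _ => B)).exists_isMinOn
    ⟨0, by simp only [Set.mem_Icc, le_refl, true_and]; exact fun _ => hB.le⟩ hcont.continuousOn
  have hψ0 : ∀ f, 0 ≤ ψ f := fun f => hψ.1 f
  have hψB : ∀ f, ψ f ≤ B := fun f => hψ.2 f
  set z : X → ℝ := fun x => 2 * A * max (fracDeg E ψ x - 1) 0 with hz
  have hz0 : ∀ x, 0 ≤ z x := fun x => by positivity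
  have hvar : ∀ f t, 0 ≤ ψ f + t → ψ f + t ≤ B →
      0 ≤ t * (∑ x ∈ E f, z x - 1) + A * #(E f) * t ^ 2 := by
    intro f t h0 h1
    have hmem : ψ + Pi.single f t ∈ Set.Icc (0 : ι → ℝ) fun _ => B := by
      refine ⟨fun g => ?_, fun g => ?_⟩
      · rcases eq_or_ne g f with rfl | hg
        · simpa using h0
        · simpa [hg] using hψ0 g
      · rcases eq_or_ne g f with rfl | hg
        · simpa using h1
        · simpa [hg] using hψB g
    have h2 := hmin hmem
    simp only [Set.mem_ofPred_eq, hΦ] at h2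
    have h3 : ∀ x, fracDeg E (ψ + Pi.single f t) x = fracDeg E ψ x + if x ∈ E f then t else 0 := by
      intro x
      unfold fracDeg
      have : ∀ g, (if x ∈ E g then (ψ + Pi.single f t : ι → ℝ) g else 0) =
          (if x ∈ E g then ψ g else 0) + if g = f then (if x ∈ E f then t else 0) else 0 := by
        intro g
        rcases eq_or_ne g f with rfl | hg
        · by_cases hx : x ∈ E g <;> simp [hx]
        · simp [hg]
      simp only [this, sum_add_distrib, sum_ite_eq', mem_univ, if_true]
    have h4 : ∑ g, (ψ + Pi.single f t : ι → ℝ) g = ∑ g, ψ g + t := by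
      simp [sum_add_distrib]
    have h5 : ∑ x, (max (fracDeg E (ψ + Pi.single f t) x - 1) 0) ^ 2 ≤
        ∑ x, (max (fracDeg E ψ x - 1) 0) ^ 2 +
          ∑ x ∈ E f, (2 * max (fracDeg E ψ x - 1) 0 * t + t ^ 2) := by
      rw [← sum_filter_add_sum_filter_not univ (fun x => x ∈ E f) fun x =>
        (max (fracDeg E ψ x - 1) 0) ^ 2, filter_mem_eq_inter, univ_inter, add_right_comm,
        ← sum_add_distrib,
        ← sum_filter_add_sum_filter_not univ (fun x => x ∈ E f), filter_mem_eq_inter, univ_inter]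
      refine add_le_add (sum_le_sum fun x hx => ?_) (sum_le_sum fun x hx => ?_)
      · rw [h3, if_pos hx, add_sub_right_comm, ← add_assoc]
        exact sq_max_add_le _ _
      · rw [h3, if_neg (mem_filter.1 hx).2, add_zero]
    have h6 : A * ∑ x ∈ E f, (2 * max (fracDeg E ψ x - 1) 0 * t + t ^ 2) =
        t * ∑ x ∈ E f, z x + A * #(E f) * t ^ 2 := by
      rw [sum_add_distrib, sum_const, nsmul_eq_mul, mul_add, mul_sum, mul_sum, ← mul_assoc]
      congr 1
      exact sum_congr rfl fun x _ => by rw [hz]; ring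
    have h7 := mul_le_mul_of_nonneg_left h5 hA.le
    rw [mul_add, h6] at h7
    rw [h4] at h2
    linarith
  have hlow : ∀ f, ψ f < B → 1 ≤ ∑ x ∈ E f, z x := by
    intro f hf
    by_contra h
    push Not at h
    set d := 1 - ∑ x ∈ E f, z x with hd
    have hd0 : 0 < d := sub_pos.2 h
    set t := min (B - ψ f) (d / (2 * (A * #(E f) + 1))) with ht
    have ht0 : 0 < t := lt_min (sub_pos.2 hf) (by positivity)
    have h1 := hvar f t (by linarith [hψ0 f]) (by linarith [min_le_left (B - ψ f) (d / (2 * (A * #(E f) + 1)))])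
    have h2 : t ≤ d / (2 * (A * #(E f) + 1)) := min_le_right _ _
    rw [le_div_iff₀ (by positivity)] at h2
    have h3 : t * (t * (2 * (A * #(E f) + 1))) ≤ t * d := mul_le_mul_of_nonneg_left h2 ht0.le
    have h4 : ∑ x ∈ E f, z x - 1 = -d := by rw [hd]; ring
    rw [h4] at h1
    have h5 := mul_pos ht0 hd0
    nlinarith [sq_nonneg t]
  have hup : ∀ f, 0 < ψ f → ∑ x ∈ E f, z x ≤ 1 := by
    intro f hf
    by_contra h
    push Not at h
    set d := ∑ x ∈ E f, z x - 1 with hd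
    have hd0 : 0 < d := sub_pos.2 h
    set t := min (ψ f) (d / (2 * (A * #(E f) + 1))) with ht
    have ht0 : 0 < t := lt_min hf (by positivity)
    have h1 := hvar f (-t) (by linarith [min_le_left (ψ f) (d / (2 * (A * #(E f) + 1)))])
      (by linarith [hψB f])
    have h2 : t ≤ d / (2 * (A * #(E f) + 1)) := min_le_right _ _
    rw [le_div_iff₀ (by positivity)] at h2
    have h3 : t * (t * (2 * (A * #(E f) + 1))) ≤ t * d := mul_le_mul_of_nonneg_left h2 ht0.le
    have h5 := mul_pos ht0 hd0
    nlinarith [sq_nonneg t]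
  refine ⟨ψ, z, hψ0, hψB, hz0, hlow, ?_, fun x => ?_⟩
  · calc ∑ x, z x ≤ ∑ x, z x * fracDeg E ψ x := by
          refine sum_le_sum fun x _ => ?_
          rcases le_or_gt (fracDeg E ψ x) 1 with h | h
          · have : z x = 0 := by simp [hz, max_eq_right (sub_nonpos.2 h)]
            simp [this]
          · exact le_mul_of_one_le_right (hz0 x) h.le
      _ = ∑ f, ψ f * ∑ x ∈ E f, z x := by
          simp only [fracDeg, mul_sum]
          rw [sum_comm]
          refine sum_congr rfl fun f _ => ?_
          have : ∑ x ∈ E f, z x = ∑ x, if x ∈ E f then z x else 0 := by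
            rw [← sum_filter, filter_mem_eq_inter, univ_inter]
          rw [← mul_sum, this, mul_sum]
          exact sum_congr rfl fun x _ => by split_ifs <;> ring
      _ ≤ ∑ f, ψ f := by
          refine sum_le_sum fun f _ => ?_
          rcases (hψ0 f).eq_or_lt with h | h
          · rw [← h]; simp
          · exact mul_le_of_le_one_right h.le (hup f h)
  · by_contra h
    push Not at h
    have hA2 : 0 < 1 / (2 * A) := by positivity
    have h1 : ∃ f, x ∈ E f ∧ 0 < ψ f := by
      by_contra h'
      push Not at h'
      have : fracDeg E ψ x ≤ 0 := sum_nonpos fun f _ => by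
        split_ifs with hx
        exacts [h' f hx, le_rfl]
      linarith
    obtain ⟨f, hxf, hf⟩ := h1
    have h2 : z x ≤ 1 := (single_le_sum (fun x _ => hz0 x) hxf).trans (hup f hf)
    have h3 : 2 * A * (1 / (2 * A)) = 1 := by field_simp
    have h4 : 2 * A * (1 / (2 * A)) < z x := by
      rw [hz]
      exact mul_lt_mul_of_pos_left (lt_of_lt_of_le (by linarith) (le_max_left _ _)) (by positivity)
    linarith

end Penalty

section Packing

open Finset BigOperators

variable {V W : Type*} [Fintype V] [Fintype W] [DecidableEq W]

lemma prob_eq_three_le [Nonempty V] {w : Fin 3 → W} (hw : Function.Injective w)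
    (v : Fin 3 → V) : prob (fun f : W → V => f ∘ w = v) = 1 / (Fintype.card V : ℝ) ^ 3 := by
  rw [prob_comp_injective hw fun g => g = v, prob_eq_card]
  simp

/-- Few maps send edges onto two given distinct edges. -/
lemma prob_two_edges_le [Nonempty V] (S : Set (Sym2 W)) {x y : Sym2 V}
    (hxy : x ≠ y) (hx : ¬ x.IsDiag) (hy : ¬ y.IsDiag) :
    prob (fun f : W → V => Function.Injective f ∧ x ∈ Sym2.map f '' S ∧ y ∈ Sym2.map f '' S) ≤
      (Fintype.card W : ℝ) ^ 3 / (Fintype.card V : ℝ) ^ 3 := by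
  classical
  induction x with | _ a b
  rw [Sym2.mk_isDiag_iff] at hx
  obtain ⟨p, hp, hpa, hpb⟩ : ∃ p ∈ y, p ≠ a ∧ p ≠ b := by
    induction y with | _ p q
    rw [Sym2.mk_isDiag_iff] at hy
    by_contra h
    push Not at h
    have h1 := h p (by simp)
    have h2 := h q (by simp)
    apply hxy
    rw [Sym2.eq_iff]
    grind
  calc _ ≤ prob (fun f : W → V => ∃ w ∈ (univ : Finset (Fin 3 → W)),
        Function.Injective w ∧ f ∘ w = ![a, b, p]) := by
        refine prob_mono ?_
        rintro f ⟨hf, ⟨e, he, hex⟩, ⟨e', he', hey⟩⟩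
        have hget : ∀ (e : Sym2 W) (v : V), v ∈ Sym2.map f e → ∃ w, f w = v := fun e v hv => by
          obtain ⟨w, -, hw⟩ := Sym2.mem_map.1 hv
          exact ⟨w, hw⟩
        obtain ⟨w₁, h₁⟩ := hget e a (by rw [hex]; simp)
        obtain ⟨w₂, h₂⟩ := hget e b (by rw [hex]; simp)
        obtain ⟨w₃, h₃⟩ := hget e' p (by rwa [hey])
        have hcomp : f ∘ ![w₁, w₂, w₃] = ![a, b, p] := by
          ext i; fin_cases i <;> simp [h₁, h₂, h₃]
        refine ⟨![w₁, w₂, w₃], mem_univ _, ?_, hcomp⟩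
        apply Function.Injective.of_comp (f := f)
        rw [hcomp]
        intro i j
        fin_cases i <;> fin_cases j <;> simp [hx, Ne.symm hx, hpa, hpb, hpa.symm, hpb.symm]
    _ ≤ ∑ w : Fin 3 → W, prob (fun f : W → V => Function.Injective w ∧ f ∘ w = ![a, b, p]) :=
        prob_exists_le _ _
    _ ≤ ∑ w : Fin 3 → W, 1 / (Fintype.card V : ℝ) ^ 3 := by
        refine sum_le_sum fun w _ => ?_
        by_cases hw : Function.Injective w
        · rw [← prob_eq_three_le hw]
          exact prob_mono fun f hf => hf.2
        · refine le_trans (le_of_eq ?_) (by positivity : (0 : ℝ) ≤ 1 / (Fintype.card V : ℝ) ^ 3)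
          simp [prob, hw]
    _ = _ := by
        rw [sum_const, card_univ, nsmul_eq_mul, Fintype.card_fun, Fintype.card_fin]
        push_cast; ring

variable {H : SimpleGraph W} {r : ℕ} {c : W → Fin r}

/-- A properly coloured graph contains many edge-disjoint rainbow copies of `H`, compared to its
excess over the Turán density. -/
theorem exists_rainbow_packing [Nonempty W] (hr : 3 ≤ r)
    (hc : ∀ ⦃a b⦄, H.Adj a b → c a ≠ c b)
    (hpair : ∀ i j, i ≠ j → ∃ a b, H.Adj a b ∧ c a = i ∧ c b = j)
    {S : Finset (Sym2 W)} (hS : ∀ e, e ∈ S ↔ e ∈ H.edgeSet) (hS2 : 2 ≤ #S) {η : ℝ} (hη : 0 < η) :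
    ∃ n₀ : ℕ, 0 < n₀ ∧ ∀ {V : Type*} [Fintype V] {G : SimpleGraph V}
      {χ : Sym2 V → ℕ} {F : Finset (Sym2 V)}, n₀ ≤ Fintype.card V →
      ProperEdgeColoring G χ → (∀ e, e ∈ F ↔ e ∈ G.edgeSet) →
      ∃ M : Finset {f : W → V // IsRainbowHom H G χ f},
        (M : Set {f : W → V // IsRainbowHom H G χ f}).PairwiseDisjoint
          (fun f => Sym2.map f.1 '' H.edgeSet) ∧
        #F - (#S - 5 / 4 : ℝ) * #M ≤
          ((1 - 1 / (r - 1 : ℝ)) / 2 + η) * (Fintype.card V : ℝ) ^ 2 := by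
  classical
  have hS2' : (2 : ℝ) ≤ #S := by exact_mod_cast hS2
  set a : ℝ := #S - 5 / 4 with ha
  have ha0 : 0 < a := by rw [ha]; linarith
  set θ : ℝ := min (1 / 2) (η / (16 * a)) with hθ
  have hθ0 : 0 < θ := lt_min (by norm_num) (by positivity)
  have hθ1 : θ ≤ 1 / 2 := min_le_left _ _
  have hθ2 : a * θ ≤ η / 16 := by
    have : θ ≤ η / (16 * a) := min_le_right _ _
    rw [le_div_iff₀ (by positivity)] at this
    linarith
  obtain ⟨ω, hω, n₁, hn₁, hturan⟩ := sum_edgeWeight_le hr hc hpair hS (half_pos hη)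
  obtain ⟨δ, hδ, hnib⟩ := exists_matching_of_fractional (k := #S) (by omega) hθ0
    (show 0 < η / (4 * a) by positivity)
  set K : ℝ := 2 / ω with hK
  have hK0 : 0 < K := by positivity
  obtain ⟨n₂, hn₂⟩ := exists_nat_gt (K * (Fintype.card W : ℝ) ^ 3 / δ)
  refine ⟨max n₁ n₂, lt_max_of_lt_left hn₁, fun {V _ G χ F} hn hχ hF => ?_⟩
  have hV1 : n₁ ≤ Fintype.card V := (le_max_left _ _).trans hn
  have hV2 : (n₂ : ℝ) ≤ Fintype.card V := by exact_mod_cast (le_max_right _ _).trans hn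
  have : Nonempty V := Fintype.card_pos_iff.1 (by omega)
  set n : ℝ := (Fintype.card V : ℝ) with hndef
  have hn1 : 1 ≤ n := by
    have : 1 ≤ Fintype.card V := Fintype.card_pos
    rw [hndef]; exact_mod_cast this
  have hn0 : 0 < n := by linarith
  set m := Fintype.card W with hm
  have hcardfun : (Fintype.card (W → V) : ℝ) = n ^ m := by simp [hndef, hm]
  set B : ℝ := K * n ^ 2 / n ^ m with hB
  have hB0 : 0 < B := by positivity
  set E : {f : W → V // IsRainbowHom H G χ f} → Finset (Sym2 V) := fun f => S.image (Sym2.map f.1)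
    with hE
  have hEset : ∀ f, (E f : Set (Sym2 V)) = Sym2.map f.1 '' H.edgeSet := by
    intro f
    rw [hE, coe_image]
    congr 1
    ext e
    exact hS e
  have hEcard : ∀ f, #(E f) = #S := fun f =>
    card_image_of_injective _ (Sym2.map.injective f.2.1)
  obtain ⟨ψ, z, hψ0, hψB, hz0, hlow, hzψ, hload⟩ :=
    exists_fractional_packing E (A := 1 / (2 * θ)) (B := B) (by positivity) hB0
  have hAθ : 1 / (2 * (1 / (2 * θ))) = θ := by field_simp
  rw [hAθ] at hload
  have hsym : (Fintype.card (Sym2 V) : ℝ) ≤ n ^ 2 := by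
    have h1 : Fintype.card (Sym2 V) ≤ Fintype.card (V × V) :=
      Fintype.card_le_of_surjective (fun p : V × V => s(p.1, p.2)) fun e => by
        induction e with | _ a b
        exact ⟨(a, b), rfl⟩
    rw [Fintype.card_prod] at h1
    have h2 : (Fintype.card (Sym2 V) : ℝ) ≤ (Fintype.card V : ℝ) * Fintype.card V := by
      exact_mod_cast h1
    rw [sq]; exact h2
  have hψsum0 : 0 ≤ ∑ f, ψ f := sum_nonneg fun f _ => hψ0 f
  have hψsum : ∑ f, ψ f ≤ 2 * n ^ 2 := by
    have h1 : ∑ x, fracDeg E ψ x = #S * ∑ f, ψ f := by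
      simp only [fracDeg]
      rw [sum_comm, mul_sum]
      refine sum_congr rfl fun f _ => ?_
      rw [← sum_filter, filter_mem_eq_inter, univ_inter, sum_const, hEcard, nsmul_eq_mul]
    have h2 : ∑ x, fracDeg E ψ x ≤ ∑ x : Sym2 V, (2 : ℝ) :=
      sum_le_sum fun x _ => (hload x).trans (by linarith)
    rw [sum_const, card_univ, nsmul_eq_mul] at h2
    have h3 : (1 : ℝ) * ∑ f, ψ f ≤ #S * ∑ f, ψ f :=
      mul_le_mul_of_nonneg_right (by linarith) hψsum0
    linarith
  have hheavy : prob (fun f : W → V => IsRainbowHom H G χ f ∧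
      5 / 4 < ∑ ε ∈ S, (1 - a * z (ε.map f))) ≤ ω := by
    rw [prob_eq_card, hcardfun, div_le_iff₀ (by positivity)]
    have h1 : ({f | IsRainbowHom H G χ f ∧ 5 / 4 < ∑ ε ∈ S, (1 - a * z (ε.map f))} :
        Set (W → V)).ncard ≤ #(univ.filter fun f => B ≤ ψ f) := by
      rw [← Set.ncard_coe_finset]
      refine (Set.ncard_le_ncard ?_ (Set.toFinite _)).trans
        (Set.ncard_image_le (f := Subtype.val) (Set.toFinite _))
      rintro f ⟨hf, hlt⟩
      refine ⟨⟨f, hf⟩, ?_, rfl⟩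
      simp only [coe_filter, mem_univ, true_and, Set.mem_ofPred_eq]
      by_contra h
      have h2 := hlow _ (not_le.1 h)
      rw [hE, sum_image fun _ _ _ _ h => Sym2.map.injective hf.1 h] at h2
      rw [sum_sub_distrib, ← mul_sum, sum_const, nsmul_eq_mul, mul_one] at hlt
      have h3 := mul_le_mul_of_nonneg_left h2 ha0.le
      linarith
    have h2 : (#(univ.filter fun f => B ≤ ψ f) : ℝ) * B ≤ 2 * n ^ 2 := by
      rw [← nsmul_eq_mul]
      exact (card_nsmul_le_sum _ _ _ fun f hf => (mem_filter.1 hf).2).trans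
        ((sum_le_sum_of_subset_of_nonneg (filter_subset _ _) fun f _ _ => hψ0 f).trans hψsum)
    have h3 : (#(univ.filter fun f => B ≤ ψ f) : ℝ) ≤ 2 * n ^ 2 / B := by
      rwa [le_div_iff₀ hB0]
    have h4 : 2 * n ^ 2 / B = ω * n ^ m := by
      rw [hB, hK]; field_simp
    rw [← h4]
    exact le_trans (by exact_mod_cast h1) h3
  have hyle : ∀ e, 1 - a * z e ≤ 1 := fun e => by
    have := mul_nonneg ha0.le (hz0 e); linarith
  have hF1 := hturan hV1 hχ hyle hF hheavy
  have hF2 : (#F : ℝ) - a * ∑ f, ψ f ≤ ((1 - 1 / (r - 1 : ℝ)) / 2 + η / 2) * n ^ 2 := by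
    rw [sum_sub_distrib, ← mul_sum, sum_const, nsmul_eq_mul, mul_one] at hF1
    have h1 : ∑ e ∈ F, z e ≤ ∑ f, ψ f :=
      (sum_le_sum_of_subset_of_nonneg (subset_univ F) fun e _ _ => hz0 e).trans hzψ
    have h2 := mul_le_mul_of_nonneg_left h1 ha0.le
    linarith
  have h2θ : 0 ≤ 1 - 2 * θ := by linarith
  obtain ⟨M, hM, hMcard⟩ := hnib E (fun f => (1 - 2 * θ) * ψ f) hEcard
    (fun f => mul_nonneg h2θ (hψ0 f))
    (fun x => by
      have h1 : fracDeg E (fun f => (1 - 2 * θ) * ψ f) x = (1 - 2 * θ) * fracDeg E ψ x := by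
        simp only [fracDeg, mul_sum, mul_ite, mul_zero]
      rw [h1]
      have := mul_le_mul_of_nonneg_left (hload x) h2θ
      nlinarith [sq_nonneg θ])
    (fun x y hxy => by
      have hle : ∀ f, (if x ∈ E f ∧ y ∈ E f then (1 - 2 * θ) * ψ f else 0) ≤
          if x ∈ E f ∧ y ∈ E f then B else 0 := fun f => by
        split_ifs
        · exact (mul_le_of_le_one_left (hψ0 f) (by linarith)).trans (hψB f)
        · exact le_rfl
      refine (sum_le_sum fun f _ => hle f).trans ?_
      rw [← sum_filter, sum_const, nsmul_eq_mul]
      have hnd : ∀ f e, e ∈ E f → ¬ e.IsDiag := by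
        intro f e he
        obtain ⟨ε, hε, rfl⟩ := mem_image.1 he
        have := (hS ε).1 hε
        induction ε with | _ u v
        simp only [Sym2.map_mk, Sym2.mk_isDiag_iff]
        exact (f.2.2.1 this).ne
      by_cases hd : x.IsDiag ∨ y.IsDiag
      · rw [filter_false_of_mem fun f _ hf => hd.elim (hnd f x hf.1) (hnd f y hf.2)]
        simpa using hδ.le
      push Not at hd
      have h1 := prob_two_edges_le (W := W) H.edgeSet hxy hd.1 hd.2
      rw [prob_eq_card, hcardfun, ← hndef, ← hm, div_le_iff₀ (by positivity)] at h1
      have h2 : #(univ.filter fun f => x ∈ E f ∧ y ∈ E f) ≤ ({f | Function.Injective f ∧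
          x ∈ Sym2.map f '' H.edgeSet ∧ y ∈ Sym2.map f '' H.edgeSet} : Set (W → V)).ncard := by
        rw [← Set.ncard_coe_finset]
        refine Set.ncard_le_ncard_of_injOn Subtype.val ?_ Subtype.val_injective.injOn
          (Set.toFinite _)
        intro f hf
        simp only [coe_filter, mem_univ, true_and, Set.mem_ofPred_eq] at hf
        refine ⟨f.2.1, ?_, ?_⟩
        · rw [← hEset]; exact hf.1
        · rw [← hEset]; exact hf.2
      have h3 : (#(univ.filter fun f => x ∈ E f ∧ y ∈ E f) : ℝ) ≤ (m : ℝ) ^ 3 / n ^ 3 * n ^ m :=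
        le_trans (by exact_mod_cast h2) h1
      calc _ ≤ (m : ℝ) ^ 3 / n ^ 3 * n ^ m * B := mul_le_mul_of_nonneg_right h3 hB0.le
        _ = K * (m : ℝ) ^ 3 / n := by rw [hB]; field_simp
        _ ≤ δ := by
          rw [div_le_iff₀ hn0, mul_comm δ, ← div_le_iff₀ hδ]
          linarith)
  refine ⟨M, fun f hf g hg hfg => ?_, ?_⟩
  · show Disjoint (Sym2.map f.1 '' H.edgeSet) (Sym2.map g.1 '' H.edgeSet)
    rw [← hEset, ← hEset, disjoint_coe]
    exact hM hf hg hfg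
  · rw [← mul_sum] at hMcard
    have h1 := mul_le_mul_of_nonneg_left hMcard ha0.le
    have h2 : a * (η / (4 * a) * Fintype.card (Sym2 V)) ≤ η / 4 * n ^ 2 := by
      have : a * (η / (4 * a) * Fintype.card (Sym2 V)) = η / 4 * Fintype.card (Sym2 V) := by
        field_simp
      rw [this]
      exact mul_le_mul_of_nonneg_left hsym (by positivity)
    have h3 : (a * θ) * ∑ f, ψ f ≤ η / 16 * (2 * n ^ 2) :=
      mul_le_mul hθ2 hψsum hψsum0 (by positivity)
    have h4 : a * ((1 - 2 * θ) * ∑ f, ψ f - η / (4 * a) * Fintype.card (Sym2 V)) =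
        a * ∑ f, ψ f - 2 * ((a * θ) * ∑ f, ψ f) - a * (η / (4 * a) * Fintype.card (Sym2 V)) := by
      ring
    rw [h4] at h1
    linarith

end Packing

section Stability

open Finset

lemma exists_top_subset {V : Type*} [DecidableEq V] (d : V → ℕ) (U : Finset V) :
    ∀ t ≤ #U, ∃ T ⊆ U, #T = t ∧ ∀ x ∈ T, ∀ v ∈ U, v ∉ T → d v ≤ d x
  | 0, _ => ⟨∅, by simp, rfl, by simp⟩
  | t + 1, ht => by
    obtain ⟨T, hTU, hTc, hT⟩ := exists_top_subset d U t (by omega)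
    obtain ⟨x, hx, hmax⟩ := exists_max_image (U \ T) d (by
      rw [← card_pos, card_sdiff_of_subset hTU]; omega)
    rw [mem_sdiff] at hx
    refine ⟨insert x T, insert_subset hx.1 hTU, by rw [card_insert_of_notMem hx.2, hTc], ?_⟩
    intro w hw v hv hvT
    rw [mem_insert, not_or] at hvT
    rcases mem_insert.1 hw with rfl | hw
    · exact hmax v (mem_sdiff.2 ⟨hv, hvT.2⟩)
    · exact hT w hw v hv hvT.2

variable {V : Type*} [Fintype V]

open scoped Classical in
/-- The number of ordered `k`-cliques of `F` inside `U`. -/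
noncomputable def cliqueTuples (F : SimpleGraph V) (k : ℕ) (U : Finset V) : ℕ :=
  #{x : Fin k → V | (∀ i, x i ∈ U) ∧ ∀ i j, i ≠ j → F.Adj (x i) (x j)}

open scoped Classical in
lemma sum_cliqueTuples_le (F : SimpleGraph V) (k : ℕ) {U T : Finset V} (hT : T ⊆ U) :
    ∑ x ∈ T, cliqueTuples F k (U.filter (F.Adj x)) ≤ cliqueTuples F (k + 1) U := by
  unfold cliqueTuples
  rw [← card_sigma]
  refine card_le_card_of_injOn (fun p => (Fin.cons p.1 p.2 : Fin (k + 1) → V)) ?_ ?_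
  · rintro ⟨x, y⟩ hp
    simp only [coe_sigma, Set.mem_sigma_iff, mem_coe, mem_filter, mem_univ, true_and] at hp
    obtain ⟨hx, hy, hadj⟩ := hp
    simp only [coe_filter, mem_univ, true_and, Set.mem_ofPred_eq]
    refine ⟨fun i => ?_, fun i j => ?_⟩
    · refine Fin.cases (hT hx) (fun i => (hy i).1) i
    · refine Fin.cases ?_ (fun i => ?_) i <;> refine Fin.cases ?_ (fun j => ?_) j
      · simp
      · intro _; exact (hy j).2
      · intro _; exact (hy i).2.symm
      · intro h; exact hadj i j fun h' => h (by rw [h'])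
  · rintro ⟨x, y⟩ - ⟨x', y'⟩ - h
    obtain ⟨rfl, rfl⟩ := Fin.cons_injective2 h
    rfl

open scoped Classical in
/-- A stability lemma: a graph with few cliques has a vertex colouring with few monochromatic
edges, compared to the defect from the Turán density. -/
theorem exists_coloring_of_few_cliques (F : SimpleGraph V) {τ : ℝ} (hτ0 : 0 < τ) (hτ1 : τ ≤ 1)
    (hτn : 1 ≤ τ * Fintype.card V) (p : ℕ) :
    ∀ U : Finset V, (cliqueTuples F (p + 2) U : ℝ) < (τ * Fintype.card V) ^ (p + 2) →
    ∃ g : V → Fin (p + 1),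
      (#{q ∈ U ×ˢ U | F.Adj q.1 q.2 ∧ g q.1 = g q.2} : ℝ) + #{q ∈ U ×ˢ U | F.Adj q.1 q.2} ≤
        #{q ∈ U ×ˢ U | g q.1 ≠ g q.2} + (4 * p + 2) * (τ * (Fintype.card V : ℝ) ^ 2) := by
  set n : ℝ := (Fintype.card V : ℝ) with hn
  have hn0 : 0 ≤ n := by positivity
  have hτnn : τ * n ≤ n := mul_le_of_le_one_left hn0 hτ1
  induction p with
  | zero =>
    intro U hU
    refine ⟨fun _ => 0, ?_⟩
    have h1 : #{q ∈ U ×ˢ U | F.Adj q.1 q.2} ≤ cliqueTuples F 2 U := by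
      refine card_le_card_of_injOn (fun q => ![q.1, q.2]) ?_ ?_
      · rintro ⟨a, b⟩ h
        simp only [coe_filter, mem_product, Set.mem_ofPred_eq] at h
        simp only [coe_filter, mem_univ, true_and, Set.mem_ofPred_eq,
          Fin.forall_fin_two]
        simp [h.1.1, h.1.2, h.2, h.2.symm]
      · rintro ⟨a, b⟩ - ⟨a', b'⟩ - h
        have h0 := congrFun h 0
        have h1 := congrFun h 1
        simp only [Matrix.cons_val_zero, Matrix.cons_val_one] at h0 h1
        rw [h0, h1]
    have h2 : (#{q ∈ U ×ˢ U | F.Adj q.1 q.2} : ℝ) ≤ τ * n ^ 2 := by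
      have e1 : (#{q ∈ U ×ˢ U | F.Adj q.1 q.2} : ℝ) ≤ (cliqueTuples F 2 U : ℝ) := by
        exact_mod_cast h1
      have e2 : (τ * n) ^ 2 ≤ τ * n ^ 2 := by
        rw [mul_pow]
        exact mul_le_mul_of_nonneg_right (by nlinarith) (by positivity)
      have e3 : (cliqueTuples F 2 U : ℝ) < (τ * n) ^ 2 := hU
      linarith
    simp only [and_true, ne_eq, not_true_eq_false, filter_false, card_empty]
    push_cast
    linarith
  | succ p ih =>
    intro U hU
    have hUn : (#U : ℝ) ≤ n := by rw [hn]; exact_mod_cast card_le_univ U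
    rcases lt_or_ge (#U : ℝ) (τ * n) with hsmall | hbig
    · refine ⟨fun _ => 0, ?_⟩
      have h1 : (#{q ∈ U ×ˢ U | F.Adj q.1 q.2} : ℝ) ≤ #U * #U := by
        have := card_filter_le (U ×ˢ U) fun q => F.Adj q.1 q.2
        rw [card_product] at this
        exact_mod_cast this
      have h2 : (#U : ℝ) * #U ≤ (τ * n) * n := mul_le_mul hsmall.le hUn (by positivity) (by positivity)
      have h3 : (0 : ℝ) ≤ (p + 1 : ℕ) * (τ * n ^ 2) := by positivity
      simp only [and_true, ne_eq, not_true_eq_false, filter_false, card_empty]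
      push_cast at h3 ⊢
      linarith
    set d : V → ℕ := fun v => #(U.filter (F.Adj v)) with hd
    obtain ⟨T, hTU, hTc, hT⟩ := exists_top_subset d U ⌈τ * n⌉₊ (Nat.ceil_le.2 hbig)
    have hTc1 : τ * n ≤ #T := by rw [hTc]; exact Nat.le_ceil _
    have hTc2 : (#T : ℝ) ≤ 2 * (τ * n) := by
      rw [hTc]
      have := Nat.ceil_lt_add_one (show 0 ≤ τ * n by linarith)
      linarith
    obtain ⟨x, hx, hxcl⟩ : ∃ x ∈ T,
        (cliqueTuples F (p + 2) (U.filter (F.Adj x)) : ℝ) < (τ * n) ^ (p + 2) := by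
      by_contra h
      push Not at h
      have h1 := card_nsmul_le_sum T _ _ h
      have h2 : (∑ x ∈ T, cliqueTuples F (p + 2) (U.filter (F.Adj x)) : ℝ) ≤
          cliqueTuples F (p + 2 + 1) U := by exact_mod_cast sum_cliqueTuples_le F (p + 2) hTU
      rw [nsmul_eq_mul] at h1
      have h3 : (τ * n) * (τ * n) ^ (p + 2) ≤ #T * (τ * n) ^ (p + 2) :=
        mul_le_mul_of_nonneg_right hTc1 (by positivity)
      have h4 : (τ * n) ^ (p + 1 + 2) = (τ * n) * (τ * n) ^ (p + 2) := by ring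
      rw [h4] at hU
      exact absurd (h3.trans (h1.trans h2)) (not_le.2 hU)
    obtain ⟨g', hg'⟩ := ih _ hxcl
    set A := U.filter (F.Adj x) with hA
    set B := U.filter fun v => ¬ F.Adj x v with hB
    set g : V → Fin (p + 1 + 1) := fun v => if v ∈ A then (g' v).succ else 0 with hg
    have hgA : ∀ v ∈ A, g v = (g' v).succ := fun v hv => if_pos hv
    have hAB : Disjoint A B := disjoint_filter_filter_not _ _ _
    have hgB : ∀ v ∈ B, g v = 0 := fun v hv => if_neg (disjoint_right.1 hAB hv)
    have hU' : A ∪ B = U := filter_union_filter_not_eq _ _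
    have hcard : ∀ (P : V × V → Prop) [DecidablePred P], #((U ×ˢ U).filter P) = #((A ×ˢ A).filter P) +
        #((A ×ˢ B).filter P) + (#((B ×ˢ A).filter P) + #((B ×ˢ B).filter P)) := by
      intro P _
      simp only [card_filter, sum_product, ← hU', sum_union hAB, sum_add_distrib]
    refine ⟨g, ?_⟩
    rw [hcard fun q => F.Adj q.1 q.2 ∧ g q.1 = g q.2, hcard fun q => F.Adj q.1 q.2,
      hcard fun q => g q.1 ≠ g q.2]
    have e1 : #((A ×ˢ A).filter fun q => F.Adj q.1 q.2 ∧ g q.1 = g q.2) =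
        #((A ×ˢ A).filter fun q => F.Adj q.1 q.2 ∧ g' q.1 = g' q.2) := by
      congr 1
      refine filter_congr fun q hq => ?_
      rw [mem_product] at hq
      rw [hgA _ hq.1, hgA _ hq.2, Fin.succ_inj]
    have e2 : #((A ×ˢ A).filter fun q => g q.1 ≠ g q.2) =
        #((A ×ˢ A).filter fun q => g' q.1 ≠ g' q.2) := by
      congr 1
      refine filter_congr fun q hq => ?_
      rw [mem_product] at hq
      rw [hgA _ hq.1, hgA _ hq.2, ne_eq, Fin.succ_inj]
    have e3 : #((A ×ˢ B).filter fun q => F.Adj q.1 q.2 ∧ g q.1 = g q.2) = 0 := by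
      rw [card_eq_zero]
      refine filter_false_of_mem fun q hq h => ?_
      rw [mem_product] at hq
      rw [hgA _ hq.1, hgB _ hq.2] at h
      exact Fin.succ_ne_zero _ h.2
    have e4 : #((B ×ˢ A).filter fun q => F.Adj q.1 q.2 ∧ g q.1 = g q.2) = 0 := by
      rw [card_eq_zero]
      refine filter_false_of_mem fun q hq h => ?_
      rw [mem_product] at hq
      rw [hgA _ hq.2, hgB _ hq.1] at h
      exact Fin.succ_ne_zero _ h.2.symm
    have e5 : #((B ×ˢ B).filter fun q => F.Adj q.1 q.2 ∧ g q.1 = g q.2) =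
        #((B ×ˢ B).filter fun q => F.Adj q.1 q.2) := by
      congr 1
      refine filter_congr fun q hq => ?_
      rw [mem_product] at hq
      simp [hgB _ hq.1, hgB _ hq.2]
    have e6 : #((A ×ˢ B).filter fun q => g q.1 ≠ g q.2) = #A * #B := by
      rw [← card_product, filter_true_of_mem]
      intro q hq
      rw [mem_product] at hq
      rw [hgA _ hq.1, hgB _ hq.2]
      exact Fin.succ_ne_zero _
    have e7 : #((B ×ˢ A).filter fun q => g q.1 ≠ g q.2) = #A * #B := by
      rw [mul_comm, ← card_product, filter_true_of_mem]
      intro q hq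
      rw [mem_product] at hq
      rw [hgA _ hq.2, hgB _ hq.1]
      exact (Fin.succ_ne_zero _).symm
    have e8 : #((A ×ˢ B).filter fun q => F.Adj q.1 q.2) =
        #((B ×ˢ A).filter fun q => F.Adj q.1 q.2) := by
      refine card_bij (fun q _ => q.swap) ?_ ?_ ?_
      · rintro ⟨a, b⟩ h
        simp only [mem_filter, mem_product, Prod.swap] at h ⊢
        exact ⟨h.1.symm, h.2.symm⟩
      · intro a _ b _ h; exact Prod.swap_injective h
      · rintro ⟨a, b⟩ h
        simp only [mem_filter, mem_product] at h
        refine ⟨(b, a), ?_, rfl⟩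
        simp only [mem_filter, mem_product]
        exact ⟨h.1.symm, h.2.symm⟩
    have hmain : (#((B ×ˢ A).filter fun q => F.Adj q.1 q.2) : ℝ) +
        #((B ×ˢ B).filter fun q => F.Adj q.1 q.2) ≤ #A * #B + 2 * (τ * n ^ 2) := by
      have h1 : #((B ×ˢ A).filter fun q => F.Adj q.1 q.2) +
          #((B ×ˢ B).filter fun q => F.Adj q.1 q.2) = ∑ v ∈ B, d v := by
        simp only [card_filter, sum_product]
        rw [← sum_add_distrib]
        refine sum_congr rfl fun v _ => ?_
        rw [hd]
        simp only [card_filter]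
        rw [← hU', sum_union hAB]
      have h2 : ∑ v ∈ B, d v ≤ ∑ v ∈ B, (#A + if v ∈ T then #U else 0) := by
        refine sum_le_sum fun v hv => ?_
        split_ifs with hvT
        · exact (card_filter_le _ _).trans (Nat.le_add_left _ _)
        · exact hT x hx v (mem_filter.1 hv).1 hvT
      have h3 : ∑ v ∈ B, (#A + if v ∈ T then #U else 0) ≤ #B * #A + #T * #U := by
        rw [sum_add_distrib, sum_const, smul_eq_mul, ← sum_filter, sum_const, smul_eq_mul]
        gcongr
        intro v hv
        exact (mem_filter.1 hv).2
      have h4 : (#((B ×ˢ A).filter fun q => F.Adj q.1 q.2) : ℝ) +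
          #((B ×ˢ B).filter fun q => F.Adj q.1 q.2) ≤ #B * #A + #T * #U := by
        exact_mod_cast h1.le.trans (h2.trans h3)
      have h5 : (#T : ℝ) * #U ≤ 2 * (τ * n) * n :=
        mul_le_mul hTc2 hUn (by positivity) (by linarith)
      linarith
    have e9 : (0 : ℝ) ≤ #((B ×ˢ B).filter fun q => g q.1 ≠ g q.2) := by positivity
    rw [e1, e2, e3, e4, e5, e6, e7, e8]
    push_cast
    linarith

end Stability

section Assembly

open Finset

variable {V W : Type*}

/-- An optimal colouring uses every pair of colours on some edge. -/
lemma exists_coloring_all_pairs {H : SimpleGraph W} {r : ℕ}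
    (hH : H.chromaticNumber = (r : ℕ∞)) :
    ∃ c : W → Fin r, (∀ ⦃a b⦄, H.Adj a b → c a ≠ c b) ∧
      ∀ i j, i ≠ j → ∃ a b, H.Adj a b ∧ c a = i ∧ c b = j := by
  obtain ⟨C⟩ := SimpleGraph.chromaticNumber_le_iff_colorable.1 hH.le
  refine ⟨C, fun a b h => C.valid h, ?_⟩
  by_contra! h
  obtain ⟨i, j, hij, h⟩ := h
  let C' : H.Coloring {k : Fin r // k ≠ j} := SimpleGraph.Coloring.mk
    (fun a => if ha : C a = j then ⟨i, hij⟩ else ⟨C a, ha⟩) (by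
      intro a b hab heq
      have hne := C.valid hab
      by_cases ha : C a = j <;> by_cases hb : C b = j
      · exact hne (ha.trans hb.symm)
      · simp only [ha, hb, dif_pos, dif_neg, not_false_iff, Subtype.mk.injEq] at heq
        exact h b a hab.symm heq.symm ha
      · simp only [ha, hb, dif_pos, dif_neg, not_false_iff, Subtype.mk.injEq] at heq
        exact h a b hab heq hb
      · simp only [ha, hb, dif_neg, not_false_iff, Subtype.mk.injEq] at heq
        exact hne heq)
  have h1 := C'.colorable
  have h2 := SimpleGraph.chromaticNumber_le_iff_colorable.2 h1
  rw [hH, Nat.cast_le] at h2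
  have h3 : Fintype.card {k : Fin r // k ≠ j} = r - 1 := by
    simp [Fintype.card_subtype_compl]
  have := j.pos
  omega

lemma ncard_map_edgeSet {H : SimpleGraph W} {f : W → V} (hf : Function.Injective f) :
    (Sym2.map f '' H.edgeSet).ncard = eCount H :=
  Set.ncard_image_of_injective _ (Sym2.map.injective hf)

lemma ncard_biUnion_map_edgeSet [Finite W] {H : SimpleGraph W} {G : SimpleGraph V}
    {χ : Sym2 V → ℕ} (M : Finset {f : W → V // IsRainbowHom H G χ f})
    (hM : (M : Set {f : W → V // IsRainbowHom H G χ f}).PairwiseDisjoint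
      (fun f => Sym2.map f.1 '' H.edgeSet)) :
    (⋃ f ∈ M, Sym2.map f.1 '' H.edgeSet).ncard = eCount H * #M := by
  classical
  induction M using Finset.induction_on with
  | empty => simp
  | insert f M hf ih =>
    rw [set_biUnion_insert, Set.ncard_union_eq, ncard_map_edgeSet f.2.1,
      ih (hM.subset (by simp)), card_insert_of_notMem hf]
    · ring
    · rw [Set.disjoint_iUnion₂_right]
      intro g hg
      exact hM (by simp) (by simp [hg]) (by rintro rfl; exact hf hg)

lemma phiR_add_le [Finite V] [Finite W] {H : SimpleGraph W} {G : SimpleGraph V}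
    {χ : Sym2 V → ℕ} (M : Finset {f : W → V // IsRainbowHom H G χ f})
    (hM : (M : Set {f : W → V // IsRainbowHom H G χ f}).PairwiseDisjoint
      (fun f => Sym2.map f.1 '' H.edgeSet)) :
    phiR G H χ + eCount H * #M ≤ eCount G + #M := by
  classical
  have := Fintype.ofFinite V
  set U : Set (Sym2 V) := ⋃ f ∈ M, Sym2.map f.1 '' H.edgeSet with hU
  have hUG : U ⊆ G.edgeSet := by
    refine Set.iUnion₂_subset fun f _ => ?_
    rintro _ ⟨e, he, rfl⟩
    induction e with
    | _ a b => exact f.2.2.1 he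
  let Q : M ⊕ (G.edgeSet \ U : Set (Sym2 V)) → Set (Sym2 V) :=
    Sum.elim (fun f => Sym2.map f.1.1 '' H.edgeSet) fun e => {e.1}
  have hQ : ∀ i, Q i ⊆ G.edgeSet := by
    rintro (f | e)
    · exact (Set.subset_iUnion₂ (s := fun (f : {f : W → V // IsRainbowHom H G χ f}) (_ : f ∈ M) =>
        Sym2.map f.1 '' H.edgeSet) f.1 f.2).trans hUG
    · exact Set.singleton_subset_iff.2 e.2.1
  have hQu : ∀ e ∈ G.edgeSet, ∃! i, e ∈ Q i := by
    intro e he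
    by_cases heU : e ∈ U
    · obtain ⟨f, hf, hef⟩ := Set.mem_iUnion₂.1 heU
      refine ⟨Sum.inl ⟨f, hf⟩, hef, ?_⟩
      rintro (g | e') hg
      · by_contra hne
        refine Set.disjoint_left.1 (hM g.2 hf ?_) hg hef
        rintro h
        exact hne (congrArg Sum.inl (Subtype.ext h))
      · exact absurd heU (by rw [Set.mem_singleton_iff.1 hg]; exact e'.2.2)
    · refine ⟨Sum.inr ⟨e, he, heU⟩, rfl, ?_⟩
      rintro (g | e') hg
      · exact absurd (Set.mem_iUnion₂.2 ⟨g.1, g.2, hg⟩) heU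
      · exact congrArg Sum.inr (Subtype.ext (Set.mem_singleton_iff.1 hg).symm)
  have hQr : ∀ i, (∃ e, Q i = {e}) ∨ (IsCopyEdgeSet H G (Q i) ∧ Set.InjOn χ (Q i)) := by
    rintro (f | e)
    · exact Or.inr ⟨⟨f.1.1, f.1.2.1, f.1.2.2.1, rfl⟩, f.1.2.2.2⟩
    · exact Or.inl ⟨e, rfl⟩
  let φ := Fintype.equivFin (M ⊕ (G.edgeSet \ U : Set (Sym2 V)))
  have h1 : phiR G H χ ≤ Fintype.card (M ⊕ (G.edgeSet \ U : Set (Sym2 V))) := by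
    refine Nat.sInf_le ⟨fun i => Q (φ.symm i), ⟨fun i => hQ _, fun e he => ?_⟩, fun i => ?_⟩
    · obtain ⟨i, hi, hiu⟩ := hQu e he
      exact ⟨φ i, by simpa using hi, fun j hj => φ.symm_apply_eq.1 (hiu _ hj)⟩
    · exact hQr _
  have h2 : (G.edgeSet \ U).ncard + eCount H * #M = eCount G := by
    rw [← ncard_biUnion_map_edgeSet M hM]
    exact Set.ncard_sdiff_add_ncard_of_subset hUG
  rw [Fintype.card_sum, Fintype.card_coe, ← Nat.card_eq_fintype_card,
    Nat.card_coe_set_eq] at h1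
  omega

lemma turan_le_exNum {H : SimpleGraph W} {p : ℕ} (hp : 0 < p) (hH : ¬ H.Colorable p) (n : ℕ) :
    #(SimpleGraph.turanGraph n p).edgeFinset ≤ exNum n H := by
  refine le_csSup ⟨Nat.card (Sym2 (Fin n)), ?_⟩ ⟨SimpleGraph.turanGraph n p, ?_, ?_⟩
  · rintro _ ⟨G, -, rfl⟩
    exact Set.ncard_le_card _
  · rintro ⟨f, -, hf⟩
    exact hH ⟨SimpleGraph.Coloring.mk (fun a => (⟨f a % p, Nat.mod_lt _ hp⟩ : Fin p))
      fun h h' => hf h (Fin.mk.inj h')⟩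
  · rw [eCount, ← SimpleGraph.coe_edgeFinset, Set.ncard_coe_finset]

lemma exists_le_exNum {H : SimpleGraph W} {p : ℕ} (hH : ¬ H.Colorable (p + 1)) {ε : ℝ}
    (hε : 0 < ε) : ∃ n₀ : ℕ, ∀ n : ℕ, n₀ ≤ n →
      ((1 - 1 / (p + 1 : ℝ)) / 2 - ε) * (n : ℝ) ^ 2 ≤ exNum n H := by
  obtain ⟨n₀, hn₀⟩ := exists_nat_ge ((p * (p + 1 : ℝ) ^ 2 + 2 * (p + 1)) / ε)
  refine ⟨max n₀ 1, fun n hn => ?_⟩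
  have hn1 : (1 : ℝ) ≤ n := by exact_mod_cast (le_max_right _ _).trans hn
  have hn2 : p * (p + 1 : ℝ) ^ 2 + 2 * (p + 1) ≤ ε * n := by
    rw [div_le_iff₀' hε] at hn₀
    refine hn₀.trans ?_
    gcongr
    exact (le_max_left _ _).trans hn
  have hT : (#(SimpleGraph.turanGraph n (p + 1)).edgeFinset : ℝ) ≤ exNum n H := by
    exact_mod_cast turan_le_exNum p.succ_pos hH n
  refine le_trans ?_ hT
  rw [SimpleGraph.card_edgeFinset_turanGraph, Nat.add_sub_cancel]
  set s := n % (p + 1) with hs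
  have hsp : s ≤ p + 1 := (Nat.mod_lt _ p.succ_pos).le
  set X := (n ^ 2 - s ^ 2) * p with hX
  have h1 : (X : ℝ) < 2 * (p + 1) * ((X / (2 * (p + 1)) : ℕ) + 1 : ℝ) := by
    have := Nat.lt_mul_div_succ X (show 0 < 2 * (p + 1) by omega)
    exact_mod_cast this
  have h2 : ((n : ℝ) ^ 2 - (p + 1) ^ 2) * p ≤ X := by
    rw [hX]
    rw [Nat.cast_mul, Nat.cast_sub (Nat.pow_le_pow_left (Nat.mod_le n (p + 1)) 2), ← hs]
    push_cast
    have : (s : ℝ) ≤ p + 1 := by exact_mod_cast hsp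
    gcongr
  have h3 : (0 : ℝ) ≤ (s.choose 2 : ℕ) := by positivity
  set Y : ℝ := ((X / (2 * (p + 1)) : ℕ) : ℝ) with hY
  have h4 : ε * n ≤ ε * (n : ℝ) ^ 2 := by
    gcongr
    nlinarith
  have hp0 : (0 : ℝ) < p + 1 := by positivity
  have h5 : (1 - 1 / (p + 1 : ℝ)) / 2 * (n : ℝ) ^ 2 = p * (n : ℝ) ^ 2 / (2 * (p + 1)) := by
    field_simp
    ring
  have h6 : p * (n : ℝ) ^ 2 / (2 * (p + 1)) ≤
      Y + (p * (p + 1 : ℝ) ^ 2 + 2 * (p + 1)) / (2 * (p + 1)) := by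
    rw [← sub_le_iff_le_add, ← sub_div, div_le_iff₀ (by positivity)]
    linarith
  have h7 : (p * (p + 1 : ℝ) ^ 2 + 2 * (p + 1)) / (2 * (p + 1)) ≤
      p * (p + 1 : ℝ) ^ 2 + 2 * (p + 1) :=
    div_le_self (by positivity) (by linarith [(Nat.cast_nonneg p : (0 : ℝ) ≤ p)])
  push_cast
  rw [← hY]
  linarith

/-- The graph of monochromatic edges of `G` under the vertex colouring `g`. -/
def monoGraph {κ : Type*} (G : SimpleGraph V) (g : V → κ) : SimpleGraph V where
  Adj a b := G.Adj a b ∧ g a = g b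
  symm := ⟨fun _ _ h => ⟨h.1.symm, h.2.symm⟩⟩
  loopless := ⟨fun _ h => h.1.ne rfl⟩

lemma monoGraph_adj {κ : Type*} {G : SimpleGraph V} {g : V → κ} {a b : V} :
    (monoGraph G g).Adj a b ↔ G.Adj a b ∧ g a = g b :=
  Iff.rfl

lemma sum_eInside_eq [Finite V] {k : ℕ} (G : SimpleGraph V) (g : V → Fin k) :
    ∑ i, eInside G {v | g v = i} = eCount (monoGraph G g) := by
  classical
  have := Fintype.ofFinite V
  have h1 : ∀ i, eInside G {v | g v = i} =
      #{e ∈ (monoGraph G g).edgeFinset | ∀ v ∈ e, g v = i} := by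
    intro i
    rw [eInside, ← Set.ncard_coe_finset]
    congr 1
    ext e
    induction e with
    | _ a b =>
      simp only [Set.mem_ofPred_eq, coe_filter, SimpleGraph.mem_edgeFinset,
        SimpleGraph.mem_edgeSet, Sym2.mem_iff, forall_eq_or_imp, forall_eq, monoGraph_adj]
      constructor
      · rintro ⟨h, ha, hb⟩; exact ⟨⟨h, ha.trans hb.symm⟩, ha, hb⟩
      · rintro ⟨h, ha⟩; exact ⟨h.1, ha⟩
  rw [eCount, ← SimpleGraph.coe_edgeFinset, Set.ncard_coe_finset]
  simp_rw [h1]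
  rw [← card_biUnion]
  · congr 1
    ext e
    induction e with
    | _ a b =>
      simp only [mem_biUnion, mem_univ, true_and, mem_filter, SimpleGraph.mem_edgeFinset,
        SimpleGraph.mem_edgeSet, Sym2.mem_iff, forall_eq_or_imp, forall_eq]
      constructor
      · rintro ⟨i, h, -⟩; exact h
      · intro h; exact ⟨g b, h, h.2, rfl⟩
  · intro i _ j _ hij
    rw [Function.onFun, disjoint_left]
    intro e hi hj
    induction e with
    | _ a b =>
      exact hij (((mem_filter.1 hi).2 a (by simp)).symm.trans ((mem_filter.1 hj).2 a (by simp)))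

open scoped Classical in
lemma card_adj_pairs [Fintype V] (G : SimpleGraph V) :
    #{q : V × V | G.Adj q.1 q.2} = 2 * eCount G := by
  rw [eCount, ← SimpleGraph.coe_edgeFinset, Set.ncard_coe_finset,
    ← SimpleGraph.sum_degrees_eq_twice_card_edges, card_filter, Fintype.sum_prod_type]
  refine sum_congr rfl fun v _ => ?_
  rw [← card_filter, ← SimpleGraph.card_neighborFinset_eq_degree]
  congr 1
  ext w
  simp

open scoped Classical in
lemma card_mono_pairs [Fintype V] {k : ℕ} (F : SimpleGraph V) (g : V → Fin k) :
    #{q : V × V | F.Adj q.1 q.2 ∧ g q.1 = g q.2} = 2 * eCount (monoGraph F g) := by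
  convert card_adj_pairs (monoGraph F g)
  rfl

open scoped Classical in
lemma card_ne_pairs_le [Fintype V] {p : ℕ} (g : V → Fin (p + 1)) :
    (#{q : V × V | g q.1 ≠ g q.2} : ℝ) ≤ (1 - 1 / (p + 1 : ℝ)) * (Fintype.card V : ℝ) ^ 2 := by
  have h1 : (#{q : V × V | g q.1 = g q.2} : ℝ) = ∑ i, (#{v | g v = i} : ℝ) ^ 2 := by
    have : #{q : V × V | g q.1 = g q.2} = ∑ i, #{v | g v = i} ^ 2 := by
      rw [card_eq_sum_card_fiberwise (f := fun q : V × V => g q.1) (t := univ) (by simp)]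
      refine sum_congr rfl fun i _ => ?_
      rw [sq, ← card_product]
      congr 1
      ext ⟨a, b⟩
      simp only [mem_filter, mem_univ, true_and, mem_product]
      constructor
      · rintro ⟨h, rfl⟩; exact ⟨rfl, h.symm⟩
      · rintro ⟨rfl, h⟩; exact ⟨h.symm, rfl⟩
    rw [this]
    push_cast
    rfl
  have h2 : ((∑ i, #{v | g v = i} : ℕ) : ℝ) = Fintype.card V := by
    rw [← card_eq_sum_card_fiberwise (by simp), card_univ]
  have h3 := sq_sum_le_card_mul_sum_sq (s := (univ : Finset (Fin (p + 1))))
    (f := fun i => (#{v | g v = i} : ℝ))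
  rw [← h1, card_univ, Fintype.card_fin] at h3
  push_cast at h2 h3
  rw [h2] at h3
  have h4 : (#{q : V × V | g q.1 = g q.2} : ℝ) + #{q : V × V | g q.1 ≠ g q.2} =
      (Fintype.card V : ℝ) ^ 2 := by
    have := card_filter_add_card_filter_not (s := (univ : Finset (V × V))) fun q => g q.1 = g q.2
    rw [card_univ, Fintype.card_prod, ← sq] at this
    exact_mod_cast this
  have h5 : (Fintype.card V : ℝ) ^ 2 / (p + 1) ≤ #{q : V × V | g q.1 = g q.2} := by
    rw [div_le_iff₀' (by positivity)]
    exact h3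
  have h6 : (1 - 1 / (p + 1 : ℝ)) * (Fintype.card V : ℝ) ^ 2 =
      (Fintype.card V : ℝ) ^ 2 - (Fintype.card V : ℝ) ^ 2 / (p + 1) := by ring
  linarith

/-- A maximum packing leaves a graph without rainbow copies. -/
lemma exists_max_packing [Finite V] [Finite W] {H : SimpleGraph W} (hH : H.edgeSet.Nonempty)
    (G : SimpleGraph V) (χ : Sym2 V → ℕ) :
    ∃ M : Finset {f : W → V // IsRainbowHom H G χ f},
      (M : Set {f : W → V // IsRainbowHom H G χ f}).PairwiseDisjoint
        (fun f => Sym2.map f.1 '' H.edgeSet) ∧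
      (∀ M' : Finset {f : W → V // IsRainbowHom H G χ f},
        (M' : Set {f : W → V // IsRainbowHom H G χ f}).PairwiseDisjoint
          (fun f => Sym2.map f.1 '' H.edgeSet) → #M' ≤ #M) ∧
      ∀ f : W → V,
        ¬ IsRainbowHom H (G.deleteEdges (⋃ f ∈ M, Sym2.map f.1 '' H.edgeSet)) χ f := by
  classical
  have := Fintype.ofFinite {f : W → V // IsRainbowHom H G χ f}
  obtain ⟨M, hM, hmax⟩ := exists_max_image
    (univ.filter fun M : Finset {f : W → V // IsRainbowHom H G χ f} =>
      (M : Set {f : W → V // IsRainbowHom H G χ f}).PairwiseDisjoint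
        (fun f => Sym2.map f.1 '' H.edgeSet)) card ⟨∅, by simp⟩
  simp only [mem_filter, mem_univ, true_and] at hM hmax
  refine ⟨M, hM, hmax, ?_⟩
  rintro f ⟨hf1, hf2, hf3⟩
  let f' : {f : W → V // IsRainbowHom H G χ f} :=
    ⟨f, hf1, fun a b h => (SimpleGraph.deleteEdges_adj.1 (hf2 h)).1, hf3⟩
  have hdisj : ∀ g ∈ M, Disjoint (Sym2.map f '' H.edgeSet) (Sym2.map g.1 '' H.edgeSet) := by
    intro g hg
    rw [Set.disjoint_left]
    rintro _ ⟨e, he, rfl⟩ h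
    induction e with
    | _ a b =>
      exact (SimpleGraph.deleteEdges_adj.1 (hf2 he)).2 (Set.mem_iUnion₂.2 ⟨g, hg, h⟩)
  have hfM : f' ∉ M := fun h =>
    (hH.image _).ne_empty (disjoint_self.1 (hdisj f' h))
  have := hmax (insert f' M) (by
    rw [coe_insert]
    exact hM.insert fun g hg _ => hdisj g hg)
  rw [card_insert_of_notMem hfM] at this
  omega

lemma exists_cliqueTuples_lt [Fintype W] [Nonempty W] {H : SimpleGraph W} {r : ℕ} (hr : 0 < r)
    {c : W → Fin r} (hc : ∀ ⦃a b⦄, H.Adj a b → c a ≠ c b) (hH : H.edgeSet.Nonempty)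
    {τ : ℝ} (hτ : 0 < τ) :
    ∃ n₀ : ℕ, 0 < n₀ ∧ ∀ {V : Type*} [Fintype V] {F : SimpleGraph V} {χ : Sym2 V → ℕ},
      n₀ ≤ Fintype.card V → ProperEdgeColoring F χ → (∀ f : W → V, ¬ IsRainbowHom H F χ f) →
      (cliqueTuples F r univ : ℝ) < (τ * Fintype.card V) ^ r := by
  classical
  obtain ⟨ω, hω, n₀, hn₀, h⟩ := prob_heavyClique_le hc (S := H.edgeSet.toFinset)
    (fun e he => by simpa using he) (show 0 < (τ / 2) ^ r by positivity)
  refine ⟨n₀, hn₀, fun {V} _ {F χ} hV hχ hF => ?_⟩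
  have hcard : (0 : ℝ) < Fintype.card V := by exact_mod_cast hn₀.trans_le hV
  have h1 := h (y := fun _ => (1 : ℝ)) (κ := 0) hV hχ (by
    rw [prob_eq_card]
    simp only [hF, false_and]
    simpa using hω.le)
  rw [prob_eq_card, div_le_iff₀ (by
    rw [Fintype.card_fun, Fintype.card_fin]; push_cast; positivity)] at h1
  have hS : (0 : ℝ) < #H.edgeSet.toFinset := by
    rw [Nat.cast_pos, card_pos]
    simpa using hH
  have h2 : ({x | IsHeavyClique F c H.edgeSet.toFinset (fun _ => (1 : ℝ)) 0 x} :
      Set (Fin r → V)).ncard = cliqueTuples F r univ := by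
    rw [cliqueTuples, ← Set.ncard_coe_finset]
    congr 1
    ext x
    simp only [IsHeavyClique, sum_const, nsmul_eq_mul, mul_one, hS, and_true, mem_univ,
      implies_true, true_and, coe_filter, Set.mem_ofPred_eq]
  rw [h2, Fintype.card_fun, Fintype.card_fin] at h1
  refine h1.trans_lt ?_
  push_cast
  rw [← mul_pow]
  exact pow_lt_pow_left₀ (by nlinarith) (by positivity) hr.ne'

theorem exists_partition_of_le_phiR [Fintype W] (H : SimpleGraph W) (p : ℕ)
    (hχH : H.chromaticNumber = ((p + 3 : ℕ) : ℕ∞)) (γ : ℝ) (hγ : 0 < γ) :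
    ∃ ε : ℝ, 0 < ε ∧ ∃ n₀ : ℕ, ∀ (V : Type*) [Fintype V] (G : SimpleGraph V),
      n₀ ≤ Fintype.card V → ∀ χ : Sym2 V → ℕ, ProperEdgeColoring G χ →
        (exNum (Fintype.card V) H : ℝ) - ε * (Fintype.card V : ℝ) ^ 2 ≤ (phiR G H χ : ℝ) →
        ∃ g : V → Fin (p + 2),
          (∑ i, (eInside G {v | g v = i} : ℝ)) < γ * (Fintype.card V : ℝ) ^ 2 := by
  classical
  obtain ⟨c, hc, hpair⟩ := exists_coloring_all_pairs hχH
  obtain ⟨a, b, hab, ha, hb⟩ := hpair 0 1 (by simp)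
  obtain ⟨a', b', hab', ha', hb'⟩ := hpair 0 ⟨2, by omega⟩ (by simp [Fin.ext_iff])
  have : Nonempty W := ⟨a⟩
  have hHne : H.edgeSet.Nonempty := ⟨s(a, b), hab⟩
  have hS : ∀ e, e ∈ H.edgeSet.toFinset ↔ e ∈ H.edgeSet := fun e => Set.mem_toFinset
  have hS2 : 2 ≤ #H.edgeSet.toFinset := by
    refine one_lt_card.2 ⟨s(a, b), (hS _).2 hab, s(a', b'), (hS _).2 hab', fun h => ?_⟩
    have := congrArg (Sym2.map c) h
    rw [Sym2.map_mk, Sym2.map_mk, ha, hb, ha', hb'] at this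
    simp [Fin.ext_iff] at this
  have hHcol : ¬ H.Colorable (p + 1 + 1) := fun h => by
    have := SimpleGraph.chromaticNumber_le_iff_colorable.2 h
    rw [hχH, Nat.cast_le] at this
    omega
  have hhS : eCount H = #H.edgeSet.toFinset := Set.ncard_eq_toFinset_card' _
  set h : ℝ := (eCount H : ℝ) with hh
  have hh2 : 2 ≤ h := by rw [hh, hhS]; exact_mod_cast hS2
  set ε : ℝ := γ / (4 * (12 * (h + 1) + 2)) with hε
  have hε0 : 0 < ε := by positivity
  set τ : ℝ := min 1 (γ / (4 * (2 * p + 3))) with hτ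
  have hτ0 : 0 < τ := lt_min one_pos (by positivity)
  have hτ1 : τ ≤ 1 := min_le_left _ _
  have hε' : 2 * ε + 12 * (h + 1) * ε = γ / 4 := by rw [hε]; field_simp; ring
  have hτ' : (2 * p + 3) * τ ≤ γ / 4 := by
    have : τ ≤ γ / (4 * (2 * p + 3)) := min_le_right _ _
    rw [le_div_iff₀ (by positivity)] at this
    linarith
  obtain ⟨n₁, -, hpack⟩ := exists_rainbow_packing (show 3 ≤ p + 3 by omega) hc hpair hS hS2 hε0
  obtain ⟨n₂, hex⟩ := exists_le_exNum hHcol hε0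
  obtain ⟨n₃, -, hclique⟩ := exists_cliqueTuples_lt (show 0 < p + 3 by omega) hc hHne hτ0
  obtain ⟨n₄, hn₄⟩ := exists_nat_ge (1 / τ)
  refine ⟨ε, hε0, n₁ + n₂ + n₃ + n₄ + 1, fun V _ G hV χ hχ hphi => ?_⟩
  set n : ℝ := (Fintype.card V : ℝ) with hn
  have hn0 : 0 < n := by rw [hn]; exact_mod_cast (show 0 < Fintype.card V by omega)
  have hτn : 1 ≤ τ * n := by
    rw [div_le_iff₀' hτ0] at hn₄
    refine hn₄.trans ?_
    rw [hn]
    gcongr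
    omega
  obtain ⟨M, hM, hmax, hfree⟩ := exists_max_packing hHne G χ
  set U : Set (Sym2 V) := ⋃ f ∈ M, Sym2.map f.1 '' H.edgeSet with hU
  have hUG : U ⊆ G.edgeSet := by
    refine Set.iUnion₂_subset fun f _ => ?_
    rintro _ ⟨e, he, rfl⟩
    induction e with
    | _ a b => exact f.2.2.1 he
  set F := G.deleteEdges U with hF
  have hUc : (U.ncard : ℝ) = h * #M := by
    rw [hU, ncard_biUnion_map_edgeSet M hM, hh]; push_cast; rfl
  have hFc : (eCount F : ℝ) + h * #M = eCount G := by
    rw [← hUc]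
    have : eCount F + U.ncard = eCount G := by
      rw [eCount, hF, SimpleGraph.edgeSet_deleteEdges]
      exact Set.ncard_sdiff_add_ncard_of_subset hUG
    exact_mod_cast this
  have hphi' : (phiR G H χ : ℝ) + h * #M ≤ eCount G + #M := by
    rw [hh]; exact_mod_cast phiR_add_le M hM
  have hex' := hex (Fintype.card V) (by omega)
  rw [← hn] at hex'
  obtain ⟨M', hM', hM'e⟩ := hpack (V := V) (F := G.edgeFinset) (by omega) hχ (by simp)
  have hMM' : (#M' : ℝ) ≤ #M := by exact_mod_cast hmax M' hM'
  have hGc : (#G.edgeFinset : ℝ) = eCount G := by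
    rw [eCount, ← SimpleGraph.coe_edgeFinset, Set.ncard_coe_finset]
  rw [hGc, ← hhS, ← hh, ← hn] at hM'e
  have hμ : (((p + 3 : ℕ) : ℝ) - 1) = p + 1 + 1 := by push_cast; ring
  rw [hμ] at hM'e
  push_cast at hex'
  set μ : ℝ := (1 - 1 / (p + 1 + 1 : ℝ)) / 2 with hμ'
  have hMN : (h - 5 / 4) * #M' ≤ (h - 5 / 4) * #M := mul_le_mul_of_nonneg_left hMM' (by linarith)
  have hN : (#M : ℝ) ≤ 12 * ε * n ^ 2 := by linarith
  have hFχ : ProperEdgeColoring F χ := by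
    have hle : F.edgeSet ⊆ G.edgeSet := SimpleGraph.edgeSet_mono (SimpleGraph.deleteEdges_le _)
    exact fun e f he hf => hχ (hle he) (hle hf)
  obtain ⟨g, hg⟩ := exists_coloring_of_few_cliques F hτ0 hτ1 hτn (p + 1) univ
    (hclique (by omega) hFχ hfree)
  rw [univ_product_univ] at hg
  have hne := card_ne_pairs_le g
  rw [card_mono_pairs, card_adj_pairs, ← hn] at hg
  push_cast at hg hne
  rw [← hn] at hne
  refine ⟨g, ?_⟩
  have hsum : (∑ i, (eInside G {v | g v = i} : ℝ)) = eCount (monoGraph G g) := by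
    exact_mod_cast sum_eInside_eq G g
  have hsub : (eCount (monoGraph G g) : ℝ) ≤ eCount (monoGraph F g) + h * #M := by
    rw [← hUc]
    have hss : (monoGraph G g).edgeSet ⊆ (monoGraph F g).edgeSet ∪ U := by
      intro e he
      induction e with
      | _ a b =>
        by_cases h : s(a, b) ∈ U
        · exact Or.inr h
        · exact Or.inl ⟨SimpleGraph.deleteEdges_adj.2 ⟨he.1, h⟩, he.2⟩
    exact_mod_cast (Set.ncard_le_ncard hss (Set.toFinite _)).trans (Set.ncard_union_le _ _)
  rw [hsum]
  have hμn : (1 - 1 / (p + 1 + 1 : ℝ)) * n ^ 2 = 2 * μ * n ^ 2 := by rw [hμ']; ring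
  rw [hμn] at hne
  have hn2 : 0 < n ^ 2 := by positivity
  have hhN : (h + 1) * #M ≤ (h + 1) * (12 * ε * n ^ 2) :=
    mul_le_mul_of_nonneg_left hN (by linarith)
  have hτ'' : (2 * p + 3) * τ * n ^ 2 ≤ γ / 4 * n ^ 2 := mul_le_mul_of_nonneg_right hτ' hn2.le
  have hε'' : (2 * ε + 12 * (h + 1) * ε) * n ^ 2 = γ / 4 * n ^ 2 := by rw [hε']
  have hγn : 0 < γ * n ^ 2 := mul_pos hγ hn2
  linarith

end Assembly

theorem stmt14 {W : Type*} [Fintype W] (H : SimpleGraph W) (r : ℕ) (hr : 3 ≤ r)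
    (hχH : H.chromaticNumber = (r : ℕ∞)) (γ : ℝ) (hγ : 0 < γ) :
    ∃ ε : ℝ, 0 < ε ∧ ∃ n₀ : ℕ, ∀ n : ℕ, n₀ ≤ n →
      ∀ (V : Type) [Fintype V] (G : SimpleGraph V), Fintype.card V = n →
      ∀ χ : Sym2 V → ℕ, ProperEdgeColoring G χ →
        (exNum n H : ℝ) - ε * (n : ℝ) ^ 2 ≤ (phiR G H χ : ℝ) →
        ∃ Vs : Fin (r - 1) → Set V, (∀ v : V, ∃! i, v ∈ Vs i) ∧
          (∑ i, (eInside G (Vs i) : ℝ)) < γ * (n : ℝ) ^ 2 := by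
  obtain ⟨p, rfl⟩ : ∃ p, r = p + 3 := ⟨r - 3, by omega⟩
  obtain ⟨ε, hε, n₀, h⟩ := exists_partition_of_le_phiR H p hχH γ hγ
  refine ⟨ε, hε, n₀, fun n hn V _ G hV χ hχ hphi => ?_⟩
  subst hV
  obtain ⟨g, hg⟩ := h V G hn χ hχ hphi
  exact ⟨fun i => {v | g v = i}, fun v => ⟨g v, rfl, fun _ hi => hi.symm⟩, hg⟩

end RainbowDecomp
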